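/- Assume the AG₂ setup and the definition of the operator D₂ below. If p ∈ R^a_{AG₂}, then there exists q ∈ R^a_{AG₂} such that q(z) = D₂p(z) for every D₂-regular z ∈ ℂ². In other words, the generalised Macdonald–Ruijsenaars operator D₂ preserves the ring R^a_{AG₂} of analytic quasi-invariants. -/

import Mathlib

noncomputable section

open Complex

/-- The bilinear extension of the Euclidean inner product on `ℂ²`. -/
def bil (z w : Fin 2 → ℂ) : ℂ := z 0 * w 0 + z 1 * w 1

/-- `√3` as a complex number. -/
def rt3 : ℂ := (Real.sqrt 3 : ℝ)

def vα₁ : Fin 2 → ℂ := ![0, rt3]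
def vα₂ : Fin 2 → ℂ := ![-(3/2), rt3 / 2]
def vα₃ : Fin 2 → ℂ := ![3/2, rt3 / 2]
def vβ₁ : Fin 2 → ℂ := ![1, 0]
def vβ₂ : Fin 2 → ℂ := ![1/2, rt3 / 2]
def vβ₃ : Fin 2 → ℂ := ![-(1/2), rt3 / 2]

/-- Positive roots of `G₂`: `α₁, α₂, α₃, β₁, β₂, β₃`. -/
def G2plus : List (Fin 2 → ℂ) := [vα₁, vα₂, vα₃, vβ₁, vβ₂, vβ₃]
/-- The six short roots `±βᵢ` of `G₂`. -/
def shortRoots : List (Fin 2 → ℂ) := [vβ₁, vβ₂, vβ₃, -vβ₁, -vβ₂, -vβ₃]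
/-- The six long roots `±αᵢ` of `G₂`. -/
def longRoots : List (Fin 2 → ℂ) := [vα₁, vα₂, vα₃, -vα₁, -vα₂, -vα₃]
/-- All twelve roots of `G₂`. -/
def G2all : List (Fin 2 → ℂ) := longRoots ++ shortRoots
/-- The twelve vectors `2γ`, `γ ∈ G₂`. -/
def twoG2 : List (Fin 2 → ℂ) := G2all.map (fun γ => (2 : ℂ) • γ)
/-- The six vectors `±2βⱼ`. -/
def twoShort : List (Fin 2 → ℂ) := shortRoots.map (fun γ => (2 : ℂ) • γ)
/-- The six vectors `±2αⱼ`. -/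
def twoLong : List (Fin 2 → ℂ) := longRoots.map (fun γ => (2 : ℂ) • γ)
/-- The six vectors `±4βⱼ`. -/
def fourShort : List (Fin 2 → ℂ) := shortRoots.map (fun γ => (4 : ℂ) • γ)
/-- The eighteen vectors `2γ`, `γ ∈ AG₂`. -/
def twoAG2 : List (Fin 2 → ℂ) := twoG2 ++ fourShort

/-- The quasi-invariance conditions for the configuration `AG₂` with
multiplicities `m_{αᵢ} = m`, `m_{βᵢ} = 3m`, `m_{2βᵢ} = 1`. -/
def QuasiInvAG2 (m : ℕ) (ψ : (Fin 2 → ℂ) → ℂ) : Prop :=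
  (∀ α ∈ [vα₁, vα₂, vα₃], ∀ s : ℕ, 1 ≤ s → s ≤ m →
    ∀ z : Fin 2 → ℂ, bil α z = 0 →
      ψ (z + (s : ℂ) • α) = ψ (z - (s : ℂ) • α)) ∧
  (∀ β ∈ [vβ₁, vβ₂, vβ₃], ∀ s : ℕ, ((1 ≤ s ∧ s ≤ 3 * m) ∨ s = 3 * m + 2) →
    ∀ z : Fin 2 → ℂ, bil β z = 0 →
      ψ (z + (s : ℂ) • β) = ψ (z - (s : ℂ) • β))

/-- The linear form `z ↦ ⟨γ, z⟩` as a polynomial in `z₁, z₂`. -/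
def linForm (γ : Fin 2 → ℂ) : MvPolynomial (Fin 2) ℂ :=
  MvPolynomial.C (γ 0) * MvPolynomial.X 0 + MvPolynomial.C (γ 1) * MvPolynomial.X 1

/-- The highest-order term `∏ᵢ ⟨αᵢ,z⟩^m ⟨βᵢ,z⟩^{3m} ⟨2βᵢ,z⟩` of the polynomial
part of the Baker–Akhiezer function for `AG₂`. -/
def topTerm (m : ℕ) : MvPolynomial (Fin 2) ℂ :=
  (linForm vα₁ * linForm vα₂ * linForm vα₃) ^ m *
    (linForm vβ₁ * linForm vβ₂ * linForm vβ₃) ^ (3 * m) *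
    (linForm ((2 : ℂ) • vβ₁) * linForm ((2 : ℂ) • vβ₂) * linForm ((2 : ℂ) • vβ₃))

/-- A Baker–Akhiezer function for `AG₂` at `x`. -/
def IsBAFunction (m : ℕ) (x : Fin 2 → ℂ) (ψ : (Fin 2 → ℂ) → ℂ) : Prop :=
  ∃ P : MvPolynomial (Fin 2) ℂ,
    P.totalDegree = 12 * m + 3 ∧
    MvPolynomial.homogeneousComponent (12 * m + 3) P = topTerm m ∧
    (∀ z, ψ z = MvPolynomial.eval z P * Complex.exp (bil z x)) ∧
    QuasiInvAG2 m ψ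

/-- `z` is `D₂`-regular: `⟨γ,z⟩ ∉ {0, ±γ², ±2γ², ±3γ²}` for every `γ ∈ G₂₊`. -/
def D2Reg (z : Fin 2 → ℂ) : Prop :=
  ∀ γ ∈ G2plus, bil γ z ≠ 0 ∧ bil γ z ≠ bil γ γ ∧ bil γ z ≠ -bil γ γ ∧
    bil γ z ≠ 2 * bil γ γ ∧ bil γ z ≠ -(2 * bil γ γ) ∧
    bil γ z ≠ 3 * bil γ γ ∧ bil γ z ≠ -(3 * bil γ γ)

open scoped Classical in
/-- The coefficient functions `a_τ` (for `τ/2 ∈ AG₂`) of the dual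
Macdonald–Ruijsenaars operator `D₂` for `AG₂`. -/
noncomputable def aD2 (m : ℕ) (τ z : Fin 2 → ℂ) : ℂ :=
  if τ ∈ fourShort then
    let h : Fin 2 → ℂ := (4⁻¹ : ℂ) • τ
    8 * bil h h *
      ((longRoots.filter (fun γ => bil τ γ = 2 * bil γ γ)).map (fun γ =>
        (1 - (m : ℂ) * bil γ γ / bil γ z) *
        (1 - (m : ℂ) * bil γ γ / (bil γ z + bil γ γ)))).prod *
      ((shortRoots.filter (fun γ => bil τ γ = 2 * bil γ γ)).map (fun γ =>
        (1 - (3 * (m : ℂ) + 2) * bil γ γ / bil γ z) *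
        (1 - 3 * (m : ℂ) * bil γ γ / (bil γ z + bil γ γ)))).prod *
      ((1 - (3 * (m : ℂ) + 2) * bil h h / bil h z) *
        (1 - 3 * (m : ℂ) * bil h h / (bil h z + bil h h)) *
        (1 - (3 * (m : ℂ) + 2) * bil h h / (bil h z + 2 * bil h h)) *
        (1 - 3 * (m : ℂ) * bil h h / (bil h z + 3 * bil h h)))
  else if τ ∈ twoShort then
    let h : Fin 2 → ℂ := (2⁻¹ : ℂ) • τ
    9 * (m : ℂ) * ((m : ℂ) + 1) * bil h h *
      ((longRoots.filter (fun γ => bil τ γ = 0)).map (fun γ =>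
        1 - (2 / 3 : ℂ) * bil γ γ / (bil γ z - bil γ γ))).prod *
      ((longRoots.filter (fun γ => bil τ γ = bil γ γ)).map (fun γ =>
        1 - (m : ℂ) * bil γ γ / bil γ z)).prod *
      ((shortRoots.filter (fun γ => bil τ γ = bil γ γ)).map (fun γ =>
        (1 - (3 * (m : ℂ) + 2) * bil γ γ / bil γ z) *
        (1 + 3 * (m : ℂ) * bil γ γ / (bil γ z + 2 * bil γ γ)) *
        (1 - (3 * (m : ℂ) - 1) * bil γ γ / (bil γ z - bil γ γ)))).prod *
      ((1 - (3 * (m : ℂ) + 2) * bil h h / bil h z) *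
        (1 - 3 * (m : ℂ) * bil h h / (bil h z + bil h h)) *
        (1 + 4 * bil h h / (bil h z + 3 * bil h h)) *
        (1 - 4 * bil h h / (bil h z - bil h h)))
  else
    let h : Fin 2 → ℂ := (2⁻¹ : ℂ) • τ
    (m : ℂ) * ((m : ℂ) + 1) * bil h h *
      ((shortRoots.filter (fun γ => bil τ γ = 3 * bil γ γ)).map (fun γ =>
        (1 - (3 * (m : ℂ) + 2) * bil γ γ / bil γ z) *
        (1 - (3 * (m : ℂ) + 1) * bil γ γ / (bil γ z + bil γ γ)) *
        (1 - 3 * (m : ℂ) * bil γ γ / (bil γ z + 2 * bil γ γ)))).prod *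
      ((shortRoots.filter (fun γ => bil τ γ = 0)).map (fun γ =>
        1 - 6 * bil γ γ / (bil γ z - bil γ γ))).prod *
      ((longRoots.filter (fun γ => bil τ γ = bil γ γ)).map (fun γ =>
        1 - (m : ℂ) * bil γ γ / bil γ z)).prod *
      ((1 - (m : ℂ) * bil h h / bil h z) *
        (1 - (m : ℂ) * bil h h / (bil h z + bil h h)))

/-- The ring `R^a_{AG₂}` of analytic quasi-invariants for `AG₂`. -/
def RaAG2 (m : ℕ) (p : (Fin 2 → ℂ) → ℂ) : Prop :=
  (∀ z, AnalyticAt ℂ p z) ∧ QuasiInvAG2 m p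

/-- The value `D₂p(z) = ∑_{τ : τ/2 ∈ AG₂} a_τ(z)(p(z+τ) − p(z))`. -/
noncomputable def applyD2 (m : ℕ) (p : (Fin 2 → ℂ) → ℂ) (z : Fin 2 → ℂ) : ℂ :=
  (twoAG2.map (fun τ => aD2 m τ z * (p (z + τ) - p z))).sum

namespace AG2pf

/-- points of the circle of radius `R` as elements of the sphere -/
noncomputable def cpt (R : ℝ) (hR : 0 ≤ R) (θ : ℝ) : Metric.sphere (0:ℂ) R :=
  ⟨circleMap 0 R θ, circleMap_mem_sphere 0 hR θ⟩

theorem cpt_cont (R : ℝ) (hR : 0 ≤ R) : Continuous (cpt R hR) :=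
  Continuous.subtype_mk (continuous_circleMap 0 R) _

abbrev Tor (R : ℝ) := C(Metric.sphere (0:ℂ) R × Metric.sphere (0:ℂ) R, ℂ)

/-- integrand -/
noncomputable def tint (R : ℝ) (hR : 0 ≤ R) (u : Tor R) (θ φ : ℝ) : ℂ :=
  deriv (circleMap 0 R) θ • (deriv (circleMap 0 R) φ • u (cpt R hR θ, cpt R hR φ))

theorem tint_cont (R : ℝ) (hR : 0 ≤ R) (u : Tor R) :
    Continuous (Function.uncurry (tint R hR u)) := by
  unfold tint Function.uncurry
  simp only [deriv_circleMap]
  have := cpt_cont R hR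
  have h2 := continuous_circleMap 0 R
  fun_prop

noncomputable def Lam (R : ℝ) (hR : 0 ≤ R) : Tor R →L[ℂ] ℂ :=
  LinearMap.mkContinuous
    { toFun := fun u => ∫ θ in (0:ℝ)..2 * Real.pi, ∫ φ in (0:ℝ)..2 * Real.pi, tint R hR u θ φ
      map_add' := by
        intro u v
        have hi : ∀ (w : Tor R) (θ : ℝ), IntervalIntegrable (tint R hR w θ) MeasureTheory.volume 0 (2 * Real.pi) := by
          intro w θ
          apply Continuous.intervalIntegrable
          exact (tint_cont R hR w).comp (by fun_prop : Continuous fun φ : ℝ => (θ, φ))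
        have hj : ∀ (w : Tor R), IntervalIntegrable (fun θ => ∫ φ in (0:ℝ)..2 * Real.pi, tint R hR w θ φ) MeasureTheory.volume 0 (2 * Real.pi) := by
          intro w
          apply Continuous.intervalIntegrable
          exact intervalIntegral.continuous_parametric_intervalIntegral_of_continuous' (tint_cont R hR w) _ _
        rw [← intervalIntegral.integral_add (hj u) (hj v)]
        congr 1; ext θ
        rw [← intervalIntegral.integral_add (hi u θ) (hi v θ)]
        congr 1; ext φ
        simp [tint]; ring
      map_smul' := by
        intro c u
        simp only [RingHom.id_apply, smul_eq_mul]
        rw [← intervalIntegral.integral_const_mul]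
        congr 1; ext θ
        rw [← intervalIntegral.integral_const_mul]
        congr 1; ext φ
        simp [tint]; ring }
    ((R * R * |2 * Real.pi - 0|) * |2 * Real.pi - 0|) (by
      intro u
      have hb : ∀ θ φ, ‖tint R hR u θ φ‖ ≤ R * R * ‖u‖ := by
        intro θ φ
        have := u.norm_coe_le_norm (cpt R hR θ, cpt R hR φ)
        simp only [tint, norm_smul, deriv_circleMap, norm_mul, norm_circleMap_zero, abs_of_nonneg hR, norm_I]
        have : R * (R * ‖u (cpt R hR θ, cpt R hR φ)‖) ≤ R * (R * ‖u‖) := by gcongr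
        nlinarith
      have h1 : ∀ θ, ‖∫ φ in (0:ℝ)..2 * Real.pi, tint R hR u θ φ‖ ≤ R * R * ‖u‖ * |2 * Real.pi - 0| := by
        intro θ
        exact intervalIntegral.norm_integral_le_of_norm_le_const (fun φ _ => hb θ φ)
      have h2 := intervalIntegral.norm_integral_le_of_norm_le_const (a := 0) (b := 2 * Real.pi) (fun θ _ => h1 θ)
      refine h2.trans (le_of_eq ?_)
      ring)

theorem Lam_apply (R : ℝ) (hR : 0 ≤ R) (u : Tor R) :
    Lam R hR u = ∫ θ in (0:ℝ)..2 * Real.pi, ∫ φ in (0:ℝ)..2 * Real.pi, tint R hR u θ φ := rfl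

def Wc (R : ℝ) : Tor R := ⟨fun q => (q.1 : ℂ), by fun_prop⟩
def Vc (R : ℝ) : Tor R := ⟨fun q => (q.2 : ℂ), by fun_prop⟩

theorem isUnit_tor {R : ℝ} (u : Tor R) (h : ∀ q, u q ≠ 0) : IsUnit u := by
  exact (ContinuousMap.isUnit_iff_forall_ne_zero u).2 h

theorem tor_inv_apply {R : ℝ} (u : Tor R) (h : ∀ q, u q ≠ 0) (q) : (Ring.inverse u) q = (u q)⁻¹ := by
  have := Ring.mul_inverse_cancel u (isUnit_tor u h)
  have := congrArg (fun v : Tor R => v q) this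
  simp at this
  exact eq_inv_of_mul_eq_one_right this

theorem analytic_of_cauchy {R : ℝ} (hR : 0 ≤ R) (F : Tor R) (G : ℂ × ℂ → ℂ)
    (hG : ∀ t y : ℂ, ‖t‖ < R → ‖y‖ < R → G (t, y) =
      Lam R hR (F * Ring.inverse (Wc R - algebraMap ℂ (Tor R) t) * Ring.inverse (Vc R - algebraMap ℂ (Tor R) y)))
    (z : ℂ × ℂ) (h1 : ‖z.1‖ < R) (h2 : ‖z.2‖ < R) : AnalyticAt ℂ G z := by
  have hW : ∀ t : ℂ, ‖t‖ < R → IsUnit (Wc R - algebraMap ℂ (Tor R) t) := by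
    intro t ht
    apply isUnit_tor
    rintro ⟨⟨a, ha⟩, b⟩
    simp only [mem_sphere_iff_norm, sub_zero] at ha
    simp [Wc, sub_eq_zero]
    rintro rfl
    linarith
  have hV : ∀ t : ℂ, ‖t‖ < R → IsUnit (Vc R - algebraMap ℂ (Tor R) t) := by
    intro t ht
    apply isUnit_tor
    rintro ⟨b, ⟨a, ha⟩⟩
    simp only [mem_sphere_iff_norm, sub_zero] at ha
    simp [Vc, sub_eq_zero]
    rintro rfl
    linarith
  have hal : ∀ t, AnalyticAt ℂ (fun t : ℂ => algebraMap ℂ (Tor R) t) t := by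
    intro t
    exact (Algebra.linearMap ℂ (Tor R)).toContinuousLinearMap.analyticAt t
  obtain ⟨U, hU⟩ := hW z.1 h1
  obtain ⟨V, hV⟩ := hV z.2 h2
  have e : (fun q : ℂ × ℂ => Lam R hR (F * Ring.inverse (Wc R - algebraMap ℂ (Tor R) q.1) * Ring.inverse (Vc R - algebraMap ℂ (Tor R) q.2))) =ᶠ[nhds z] G := by
    have o1 : ∀ᶠ q : ℂ × ℂ in nhds z, ‖q.1‖ < R :=
      (continuous_fst.norm).continuousAt.eventually_lt continuousAt_const h1
    have o2 : ∀ᶠ q : ℂ × ℂ in nhds z, ‖q.2‖ < R :=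
      (continuous_snd.norm).continuousAt.eventually_lt continuousAt_const h2
    filter_upwards [o1, o2] with q a b
    exact (hG q.1 q.2 a b).symm
  refine AnalyticAt.congr ?_ e
  refine ((Lam R hR).analyticAt _).comp ?_
  refine AnalyticAt.mul (AnalyticAt.mul analyticAt_const ?_) ?_
  · have : AnalyticAt ℂ (fun q : ℂ × ℂ => Wc R - algebraMap ℂ (Tor R) q.1) z :=
      analyticAt_const.sub ((hal z.1).comp analyticAt_fst)
    have hI : AnalyticAt ℂ (Ring.inverse : Tor R → Tor R) (Wc R - algebraMap ℂ (Tor R) z.1) := by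
      rw [← hU]; exact analyticAt_inverse U
    exact hI.comp (f := fun q : ℂ × ℂ => Wc R - algebraMap ℂ (Tor R) q.1) this
  · have : AnalyticAt ℂ (fun q : ℂ × ℂ => Vc R - algebraMap ℂ (Tor R) q.2) z :=
      analyticAt_const.sub ((hal z.2).comp analyticAt_snd)
    have hI : AnalyticAt ℂ (Ring.inverse : Tor R → Tor R) (Vc R - algebraMap ℂ (Tor R) z.2) := by
      rw [← hV]; exact analyticAt_inverse V
    exact hI.comp (f := fun q : ℂ × ℂ => Vc R - algebraMap ℂ (Tor R) q.2) this

theorem cauchy1 {R : ℝ} (f : ℂ → ℂ) (hf : Differentiable ℂ f) (w : ℂ) (hw : ‖w‖ < R) :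
    f w = (2 * Real.pi * I)⁻¹ * ∮ v in C(0, R), (v - w)⁻¹ * f v := by
  have := (hf.diffContOnCl (s := Metric.ball 0 R)).two_pi_i_inv_smul_circleIntegral_sub_inv_smul
    (w := w) (by simpa using hw)
  simp only [smul_eq_mul] at this
  exact this.symm

theorem div_prod (F : ℂ × ℂ → ℂ) (hF : ∀ z, AnalyticAt ℂ F z) (h0 : ∀ y, F (0, y) = 0) :
    ∃ G : ℂ × ℂ → ℂ, (∀ z, AnalyticAt ℂ G z) ∧ ∀ t y, F (t, y) = t * G (t, y) := by
  have hd : Differentiable ℂ F := fun z => (hF z).differentiableAt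
  refine ⟨fun q => dslope (fun t => F (t, q.2)) 0 q.1, ?_, ?_⟩
  · intro z
    obtain ⟨R, hR⟩ := exists_gt (max ‖z.1‖ ‖z.2‖)
    have h1 : ‖z.1‖ < R := (le_max_left _ _).trans_lt hR
    have h2 : ‖z.2‖ < R := (le_max_right _ _).trans_lt hR
    have hR0 : 0 < R := (norm_nonneg _).trans_lt h1
    have hc : Continuous F := hd.continuous
    have hcq : Continuous fun q : Metric.sphere (0:ℂ) R × Metric.sphere (0:ℂ) R =>
        ((2 * Real.pi * I)⁻¹ * (2 * Real.pi * I)⁻¹) * ((q.1 : ℂ)⁻¹ * F (q.1, q.2)) := by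
      have : Continuous fun q : Metric.sphere (0:ℂ) R × Metric.sphere (0:ℂ) R => (q.1 : ℂ)⁻¹ := by
        refine Continuous.inv₀ (by fun_prop) ?_
        rintro ⟨⟨a, ha⟩, b⟩
        simp only [mem_sphere_iff_norm, sub_zero] at ha
        simp only [ne_eq]
        rintro rfl
        simp at ha; linarith
      fun_prop
    refine analytic_of_cauchy hR0.le ⟨_, hcq⟩ _ ?_ z h1 h2
    · intro t y ht hy
      have hdy : Differentiable ℂ (fun t => F (t, y)) := by fun_prop
      have hds : Differentiable ℂ (dslope (fun t => F (t, y)) 0) := by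
        rw [← differentiableOn_univ] at hdy ⊢
        exact (Complex.differentiableOn_dslope (Filter.univ_mem)).2 hdy
      simp only
      rw [cauchy1 _ hds t ht, Lam_apply]
      simp only [circleIntegral]
      rw [← intervalIntegral.integral_const_mul]
      congr 1; ext θ
      have hne : circleMap 0 R θ ≠ 0 := circleMap_ne_center hR0.ne'
      rw [dslope_of_ne _ hne, slope_def_field, h0,
        cauchy1 (fun y => F (circleMap 0 R θ, y)) (by fun_prop) y hy]
      simp only [circleIntegral, smul_eq_mul, sub_zero]
      have e : ∀ φ, tint R hR0.le ((⟨_, hcq⟩ : Tor R) * Ring.inverse (Wc R - algebraMap ℂ (Tor R) t) * Ring.inverse (Vc R - algebraMap ℂ (Tor R) y)) θ φ = 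
        ((2 * Real.pi * I)⁻¹ * (deriv (circleMap 0 R) θ * ((circleMap 0 R θ - t)⁻¹ * ((2 * Real.pi * I)⁻¹ * (circleMap 0 R θ)⁻¹)))) *
        (deriv (circleMap 0 R) φ * ((circleMap 0 R φ - y)⁻¹ * F (circleMap 0 R θ, circleMap 0 R φ))) := by
        intro φ
        have i1 := tor_inv_apply (Wc R - algebraMap ℂ (Tor R) t) (by
          rintro ⟨⟨a, ha⟩, b⟩
          simp only [mem_sphere_iff_norm, sub_zero] at ha
          simp [Wc, sub_eq_zero]
          rintro rfl
          linarith) (cpt R hR0.le θ, cpt R hR0.le φ)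
        have i2 := tor_inv_apply (Vc R - algebraMap ℂ (Tor R) y) (by
          rintro ⟨b, ⟨a, ha⟩⟩
          simp only [mem_sphere_iff_norm, sub_zero] at ha
          simp [Vc, sub_eq_zero]
          rintro rfl
          linarith) (cpt R hR0.le θ, cpt R hR0.le φ)
        simp only [tint, ContinuousMap.mul_apply, i1, i2, smul_eq_mul]
        simp [Wc, Vc, cpt]
        ring
      simp only [e]
      rw [intervalIntegral.integral_const_mul]
      ring
  · intro t y
    simp only
    by_cases ht : t = 0
    · simp [ht, h0]
    · rw [dslope_of_ne _ ht, slope_def_field, h0]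
      field_simp
      simp [mul_comm]

end AG2pf

namespace AG2pf

theorem rt3_sq : rt3 * rt3 = 3 := by
  unfold rt3
  rw [← ofReal_mul, Real.mul_self_sqrt (by norm_num)]; norm_num

theorem rt3_ne : rt3 ≠ 0 := by
  intro h; have := rt3_sq; rw [h] at this; norm_num at this

abbrev V2 := Fin 2 → ℂ

structure Sym (w : V2 →ₗ[ℂ] V2) : Prop where
  bil : ∀ a b, bil (w a) (w b) = bil a b
  sh : (shortRoots.map w).Perm shortRoots
  lg : (longRoots.map w).Perm longRoots

theorem bil_ext {a b : V2} (h : ∀ c, bil a c = bil b c) : a = b := by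
  have h0 := h ![1, 0]
  have h1 := h ![0, 1]
  simp [bil] at h0 h1
  ext i; fin_cases i <;> simp [h0, h1]

theorem Sym.inj {w : V2 →ₗ[ℂ] V2} (h : Sym w) : Function.Injective w := by
  intro a b hab
  apply bil_ext
  intro c
  rw [← h.bil a c, ← h.bil b c, hab]

theorem Sym.perm_smul {w : V2 →ₗ[ℂ] V2} {L : List V2} (h : (L.map w).Perm L) (c : ℂ) :
    ((L.map (fun γ => c • γ)).map w).Perm (L.map (fun γ => c • γ)) := by
  have := h.map (fun γ => c • γ)
  refine List.Perm.trans (List.Perm.of_eq ?_) this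
  simp [List.map_map, Function.comp_def]

theorem Sym.mem_iff {w : V2 →ₗ[ℂ] V2} (h : Sym w) {L : List V2} (hL : (L.map w).Perm L) (τ : V2) :
    w τ ∈ L ↔ τ ∈ L := by
  rw [← hL.mem_iff, List.mem_map]
  constructor
  · rintro ⟨a, ha, e⟩; rwa [← h.inj e]
  · intro ha; exact ⟨τ, ha, rfl⟩

theorem prod_filter_perm {w : V2 →ₗ[ℂ] V2} {L : List V2} (hL : (L.map w).Perm L)
    (P Q : V2 → Bool) (F G : V2 → ℂ) (hP : ∀ γ, P (w γ) = Q γ) (hF : ∀ γ, F (w γ) = G γ) :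
    ((L.filter P).map F).prod = ((L.filter Q).map G).prod := by
  have := ((hL.filter P).map F).prod_eq
  rw [← this, List.filter_map, List.map_map]
  have e1 : (P ∘ w) = Q := funext hP
  have e2 : (F ∘ w) = G := funext hF
  rw [e1, e2]

theorem aD2_sym {w : V2 →ₗ[ℂ] V2} (h : Sym w) (m : ℕ) (τ z : V2) :
    aD2 m (w τ) (w z) = aD2 m τ z := by
  unfold aD2
  have h4 : w τ ∈ fourShort ↔ τ ∈ fourShort := h.mem_iff (Sym.perm_smul h.sh 4) τ
  have h2 : w τ ∈ twoShort ↔ τ ∈ twoShort := h.mem_iff (Sym.perm_smul h.sh 2) τ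
  simp only [h4, h2]
  simp only [← map_smul, h.bil]
  split_ifs
  · refine congrArg₂ (· * ·) (congrArg₂ (· * ·) (congrArg₂ (· * ·) rfl ?_) ?_) rfl
    · exact prod_filter_perm h.lg _ _ _ _ (fun γ => by simp only [h.bil]) (fun γ => by simp only [h.bil])
    · exact prod_filter_perm h.sh _ _ _ _ (fun γ => by simp only [h.bil]) (fun γ => by simp only [h.bil])
  · refine congrArg₂ (· * ·) (congrArg₂ (· * ·) (congrArg₂ (· * ·) (congrArg₂ (· * ·) rfl ?_) ?_) ?_) rfl
    · exact prod_filter_perm h.lg _ _ _ _ (fun γ => by simp only [h.bil]) (fun γ => by simp only [h.bil])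
    · exact prod_filter_perm h.lg _ _ _ _ (fun γ => by simp only [h.bil]) (fun γ => by simp only [h.bil])
    · exact prod_filter_perm h.sh _ _ _ _ (fun γ => by simp only [h.bil]) (fun γ => by simp only [h.bil])
  · refine congrArg₂ (· * ·) (congrArg₂ (· * ·) (congrArg₂ (· * ·) (congrArg₂ (· * ·) rfl ?_) ?_) ?_) rfl
    · exact prod_filter_perm h.sh _ _ _ _ (fun γ => by simp only [h.bil]) (fun γ => by simp only [h.bil])
    · exact prod_filter_perm h.sh _ _ _ _ (fun γ => by simp only [h.bil]) (fun γ => by simp only [h.bil])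
    · exact prod_filter_perm h.lg _ _ _ _ (fun γ => by simp only [h.bil]) (fun γ => by simp only [h.bil])

theorem twoAG2_perm {w : V2 →ₗ[ℂ] V2} (h : Sym w) : (twoAG2.map w).Perm twoAG2 := by
  unfold twoAG2 twoG2 fourShort
  rw [List.map_append]
  refine List.Perm.append (Sym.perm_smul ?_ 2) (Sym.perm_smul h.sh 4)
  unfold G2all
  rw [List.map_append]
  exact h.lg.append h.sh

theorem applyD2_sym {w : V2 →ₗ[ℂ] V2} (h : Sym w) (m : ℕ) (p : V2 → ℂ) (z : V2) :
    applyD2 m p (w z) = applyD2 m (fun z => p (w z)) z := by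
  unfold applyD2
  rw [← ((twoAG2_perm h).map _).sum_eq, List.map_map]
  congr 1
  apply List.map_congr_left
  intro τ _
  simp [aD2_sym h]

theorem QI_long {m : ℕ} {p : V2 → ℂ} (h : QuasiInvAG2 m p) : ∀ α ∈ longRoots, ∀ s : ℕ, 1 ≤ s → s ≤ m →
    ∀ z : V2, bil α z = 0 → p (z + (s : ℂ) • α) = p (z - (s : ℂ) • α) := by
  intro α hα s h1 h2 z hz
  have hneg : ∀ a : V2, bil (-a) z = 0 → bil a z = 0 := by
    intro a ha; simp [bil] at ha ⊢; linear_combination -ha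
  simp only [longRoots, List.mem_cons, List.not_mem_nil, or_false] at hα
  rcases hα with rfl | rfl | rfl | rfl | rfl | rfl
  · exact h.1 _ (by simp) s h1 h2 z hz
  · exact h.1 _ (by simp) s h1 h2 z hz
  · exact h.1 _ (by simp) s h1 h2 z hz
  · simpa [sub_eq_add_neg] using (h.1 vα₁ (by simp) s h1 h2 z (hneg _ hz)).symm
  · simpa [sub_eq_add_neg] using (h.1 vα₂ (by simp) s h1 h2 z (hneg _ hz)).symm
  · simpa [sub_eq_add_neg] using (h.1 vα₃ (by simp) s h1 h2 z (hneg _ hz)).symm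

theorem QI_short {m : ℕ} {p : V2 → ℂ} (h : QuasiInvAG2 m p) : ∀ β ∈ shortRoots, ∀ s : ℕ,
    ((1 ≤ s ∧ s ≤ 3 * m) ∨ s = 3 * m + 2) →
    ∀ z : V2, bil β z = 0 → p (z + (s : ℂ) • β) = p (z - (s : ℂ) • β) := by
  intro α hα s h1 z hz
  have hneg : ∀ a : V2, bil (-a) z = 0 → bil a z = 0 := by
    intro a ha; simp [bil] at ha ⊢; linear_combination -ha
  simp only [shortRoots, List.mem_cons, List.not_mem_nil, or_false] at hα
  rcases hα with rfl | rfl | rfl | rfl | rfl | rfl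
  · exact h.2 _ (by simp) s h1 z hz
  · exact h.2 _ (by simp) s h1 z hz
  · exact h.2 _ (by simp) s h1 z hz
  · simpa [sub_eq_add_neg] using (h.2 vβ₁ (by simp) s h1 z (hneg _ hz)).symm
  · simpa [sub_eq_add_neg] using (h.2 vβ₂ (by simp) s h1 z (hneg _ hz)).symm
  · simpa [sub_eq_add_neg] using (h.2 vβ₃ (by simp) s h1 z (hneg _ hz)).symm

theorem lin_analytic (w : V2 →ₗ[ℂ] V2) (z : V2) : AnalyticAt ℂ (fun z => w z) z :=
  w.toContinuousLinearMap.analyticAt z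

theorem Ra_sym {w : V2 →ₗ[ℂ] V2} (h : Sym w) {m : ℕ} {p : V2 → ℂ} (hp : RaAG2 m p) :
    RaAG2 m (fun z => p (w z)) := by
  refine ⟨fun z => (hp.1 (w z)).comp (lin_analytic w z), ?_, ?_⟩
  · intro α hα s h1 h2 z hz
    have hm : w α ∈ longRoots := (h.mem_iff h.lg α).2 (by
      simp only [longRoots, List.mem_cons, List.not_mem_nil, or_false] at hα ⊢; tauto)
    have := QI_long hp.2 (w α) hm s h1 h2 (w z) (by rw [h.bil, hz])
    simpa using this
  · intro α hα s h1 z hz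
    have hm : w α ∈ shortRoots := (h.mem_iff h.sh α).2 (by
      simp only [shortRoots, List.mem_cons, List.not_mem_nil, or_false] at hα ⊢; tauto)
    have := QI_short hp.2 (w α) hm s h1 (w z) (by rw [h.bil, hz])
    simpa using this

def lin2 (a b c d : ℂ) : V2 →ₗ[ℂ] V2 where
  toFun z := ![a * z 0 + b * z 1, c * z 0 + d * z 1]
  map_add' := by intro x y; ext i; fin_cases i <;> simp <;> ring
  map_smul' := by intro r y; ext i; fin_cases i <;> simp <;> ring

def rot : V2 →ₗ[ℂ] V2 := lin2 (1/2) (-(rt3/2)) (rt3/2) (1/2)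
def refx : V2 →ₗ[ℂ] V2 := lin2 (-1) 0 0 1
def refy : V2 →ₗ[ℂ] V2 := lin2 1 0 0 (-1)

theorem rot_β₁ : rot vβ₁ = vβ₂ := by
  ext i; fin_cases i <;> simp [rot, lin2, vβ₁, vβ₂]
theorem rot_β₂ : rot vβ₂ = vβ₃ := by
  ext i; fin_cases i <;> simp [rot, lin2, vβ₃, vβ₂] <;> first | ring1 | linear_combination (-1/4) * rt3_sq | linear_combination (-(-1/4)) * rt3_sq
theorem rot_β₃ : rot vβ₃ = -vβ₁ := by
  ext i; fin_cases i <;> simp [rot, lin2, vβ₃, vβ₁] <;> first | ring1 | linear_combination (-1/4) * rt3_sq | linear_combination (-(-1/4)) * rt3_sq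
theorem rot_α₁ : rot vα₁ = vα₂ := by
  ext i; fin_cases i <;> simp [rot, lin2, vα₁, vα₂] <;> first | ring1 | linear_combination (-1/2) * rt3_sq | linear_combination (-(-1/2)) * rt3_sq
theorem rot_α₂ : rot vα₂ = -vα₃ := by
  ext i; fin_cases i <;> simp [rot, lin2, vα₃, vα₂] <;> first | ring1 | linear_combination (-1/4) * rt3_sq | linear_combination (-(-1/4)) * rt3_sq
theorem rot_α₃ : rot vα₃ = vα₁ := by
  ext i; fin_cases i <;> simp [rot, lin2, vα₁, vα₃] <;> first | ring1 | linear_combination (-1/4) * rt3_sq | linear_combination (-(-1/4)) * rt3_sq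


theorem perm6 (g : Fin 6 → V2) (l : List (Fin 6)) (h : l.Perm [0,1,2,3,4,5]) :
    (l.map g).Perm [g 0, g 1, g 2, g 3, g 4, g 5] := h.map g

theorem rot_sym : Sym rot where
  bil := by
    intro a b
    simp [rot, lin2, bil]
    linear_combination ((a 1 * b 1 + a 0 * b 0) / 4) * rt3_sq
  sh := by
    have := perm6 ![vβ₁, vβ₂, vβ₃, -vβ₁, -vβ₂, -vβ₃] [1,2,3,4,5,0] (by decide)
    simpa [shortRoots, rot_β₁, rot_β₂, rot_β₃] using this
  lg := by
    have := perm6 ![vα₁, vα₂, vα₃, -vα₁, -vα₂, -vα₃] [1,5,0,4,2,3] (by decide)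
    simpa [longRoots, rot_α₁, rot_α₂, rot_α₃] using this

theorem refx_sym : Sym refx where
  bil := by
    intro a b
    simp [refx, lin2, bil]
  sh := by
    have := perm6 ![vβ₁, vβ₂, vβ₃, -vβ₁, -vβ₂, -vβ₃] [3,2,1,0,5,4] (by decide)
    have e1 : refx vβ₁ = -vβ₁ := by ext i; fin_cases i <;> simp [refx, lin2, vβ₁]
    have e2 : refx vβ₂ = vβ₃ := by ext i; fin_cases i <;> simp [refx, lin2, vβ₂, vβ₃]
    have e3 : refx vβ₃ = vβ₂ := by ext i; fin_cases i <;> simp [refx, lin2, vβ₂, vβ₃]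
    simpa [shortRoots, e1, e2, e3] using this
  lg := by
    have := perm6 ![vα₁, vα₂, vα₃, -vα₁, -vα₂, -vα₃] [0,2,1,3,5,4] (by decide)
    have e1 : refx vα₁ = vα₁ := by ext i; fin_cases i <;> simp [refx, lin2, vα₁]
    have e2 : refx vα₂ = vα₃ := by ext i; fin_cases i <;> simp [refx, lin2, vα₂, vα₃]
    have e3 : refx vα₃ = vα₂ := by ext i; fin_cases i <;> simp [refx, lin2, vα₂, vα₃]
    simpa [longRoots, e1, e2, e3] using this

theorem refy_sym : Sym refy where
  bil := by
    intro a b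
    simp [refy, lin2, bil]
  sh := by
    have := perm6 ![vβ₁, vβ₂, vβ₃, -vβ₁, -vβ₂, -vβ₃] [0,5,4,3,2,1] (by decide)
    have e1 : refy vβ₁ = vβ₁ := by ext i; fin_cases i <;> simp [refy, lin2, vβ₁]
    have e2 : refy vβ₂ = -vβ₃ := by ext i; fin_cases i <;> simp [refy, lin2, vβ₂, vβ₃]
    have e3 : refy vβ₃ = -vβ₂ := by ext i; fin_cases i <;> simp [refy, lin2, vβ₂, vβ₃]
    simpa [shortRoots, e1, e2, e3] using this
  lg := by
    have := perm6 ![vα₁, vα₂, vα₃, -vα₁, -vα₂, -vα₃] [3,5,4,0,2,1] (by decide)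
    have e1 : refy vα₁ = -vα₁ := by ext i; fin_cases i <;> simp [refy, lin2, vα₁]
    have e2 : refy vα₂ = -vα₃ := by ext i; fin_cases i <;> simp [refy, lin2, vα₂, vα₃]
    have e3 : refy vα₃ = -vα₂ := by ext i; fin_cases i <;> simp [refy, lin2, vα₂, vα₃]
    simpa [longRoots, e1, e2, e3] using this

end AG2pf

namespace AG2pf

def p4 (M f : ℂ) : ℂ := (1 - (3*M+2)/f) * (1 - 3*M/(f+1)) * (1 - (3*M+2)/(f+2)) * (1 - 3*M/(f+3))
def p22 (M f : ℂ) : ℂ := (1 - (3*M+2)/f) * (1 - 3*M/(f+1))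
def p2 (M f : ℂ) : ℂ := (1 - (3*M+2)/f) * (1 - 3*M/(f+1)) * (1 + 4/(f+3)) * (1 - 4/(f-1))
def p1 (M f : ℂ) : ℂ := (1 - (3*M+2)/f) * (1 + 3*M/(f+2)) * (1 - (3*M-1)/(f-1))
def p3 (M f : ℂ) : ℂ := (1 - (3*M+2)/f) * (1 - (3*M+1)/(f+1)) * (1 - 3*M/(f+2))
def p0 (f : ℂ) : ℂ := (1 - 6/(f-1)) * (1 - 6/(-f-1))
def h2 (M f : ℂ) : ℂ := (1 - M/f) * (1 - M/(f+1))
def h1 (M f : ℂ) : ℂ := 1 - M/f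
def h0 (f : ℂ) : ℂ := (1 - (2/3)/(f-1)) * (1 - (2/3)/(-f-1))

/-- parts of the coefficients regular along `x = const` -/
def gA4 (M x y : ℂ) : ℂ := 8 * (h2 M ((x+y)/2) * h2 M ((x-y)/2) * p22 M ((x+3*y)/2) * p22 M ((x-3*y)/2))
def gB4 (M x y : ℂ) : ℂ := 8 * (p4 M ((x+3*y)/2) * h2 M y * h2 M ((x+y)/2) * p22 M ((3*y-x)/2))
def gA2 (M x y : ℂ) : ℂ := 9*M*(M+1) * (h0 y * h1 M ((x+y)/2) * h1 M ((x-y)/2) * p1 M ((x+3*y)/2) * p1 M ((x-3*y)/2))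
def gB2 (M x y : ℂ) : ℂ := 9*M*(M+1) * (p2 M ((x+3*y)/2) * h0 ((y-x)/2) * h1 M y * h1 M ((x+y)/2) * p1 M ((3*y-x)/2))
def gAL (M x y : ℂ) : ℂ := 3*M*(M+1) * (h2 M y * p3 M ((x+3*y)/2) * p3 M ((3*y-x)/2) * h1 M ((x+y)/2) * h1 M ((y-x)/2))
def gBL (M x y : ℂ) : ℂ := 3*M*(M+1) * (h2 M ((x+y)/2) * p3 M ((x+3*y)/2) * p0 ((3*y-x)/2) * h1 M y * h1 M ((x-y)/2))

def A4 (M x y : ℂ) : ℂ := p4 M x * gA4 M x y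
def B4 (M x y : ℂ) : ℂ := p22 M x * gB4 M x y
def A2 (M x y : ℂ) : ℂ := p2 M x * gA2 M x y
def B2 (M x y : ℂ) : ℂ := p1 M x * gB2 M x y
def AL (M x y : ℂ) : ℂ := p0 x * gAL M x y
def BL (M x y : ℂ) : ℂ := p3 M x * gBL M x y

def pt (x y : ℂ) : V2 := ![x, rt3 * y]

def dX : Fin 18 → ℂ := ![4, -4, 2, -2, 2, -2, 2, -2, 1, -1, 1, -1, 0, 0, 3, -3, 3, -3]
def dY : Fin 18 → ℂ := ![0, 0, 2, 2, -2, -2, 0, 0, 1, 1, -1, -1, 2, -2, 1, 1, -1, -1]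
def cf (M : ℂ) (i : Fin 18) (x y : ℂ) : ℂ :=
  ![A4 M x y, A4 M (-x) y, B4 M x y, B4 M (-x) y, B4 M x (-y), B4 M (-x) (-y), A2 M x y, A2 M (-x) y,
    B2 M x y, B2 M (-x) y, B2 M x (-y), B2 M (-x) (-y), AL M x y, AL M x (-y),
    BL M x y, BL M (-x) y, BL M x (-y), BL M (-x) (-y)] i

theorem bsα₁ : bil vα₁ vα₁ = 3 := by simp [bil, vα₁, rt3_sq]
theorem bsα₂ : bil vα₂ vα₂ = 3 := by simp [bil, vα₂]; linear_combination (1/4) * rt3_sq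
theorem bsα₃ : bil vα₃ vα₃ = 3 := by simp [bil, vα₃]; linear_combination (1/4) * rt3_sq
theorem bsβ₁ : bil vβ₁ vβ₁ = 1 := by simp [bil, vβ₁]
theorem bsβ₂ : bil vβ₂ vβ₂ = 1 := by simp [bil, vβ₂]; linear_combination (1/4) * rt3_sq
theorem bsβ₃ : bil vβ₃ vβ₃ = 1 := by simp [bil, vβ₃]; linear_combination (1/4) * rt3_sq
theorem bil_negl (a b : V2) : bil (-a) b = - bil a b := by simp [bil]; ring
theorem bil_negr (a b : V2) : bil a (-b) = - bil a b := by simp [bil]; ring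
theorem bil_smull (c : ℂ) (a b : V2) : bil (c • a) b = c * bil a b := by simp [bil]; ring
theorem bil_smulr (c : ℂ) (a b : V2) : bil a (c • b) = c * bil a b := by simp [bil]; ring
theorem bβα₁ : bil vβ₁ vα₁ = 0 := by simp [bil, vβ₁, vα₁]
theorem bβα₂ : bil vβ₁ vα₂ = -(3/2) := by simp [bil, vβ₁, vα₂]
theorem bβα₃ : bil vβ₁ vα₃ = 3/2 := by simp [bil, vβ₁, vα₃]
theorem bββ₂ : bil vβ₁ vβ₂ = 1/2 := by simp [bil, vβ₁, vβ₂]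
theorem bββ₃ : bil vβ₁ vβ₃ = -(1/2) := by simp [bil, vβ₁, vβ₃]
theorem bαβ₁ : bil vα₁ vβ₁ = 0 := by simp [bil, vβ₁, vα₁]
theorem bαα₂ : bil vα₁ vα₂ = 3/2 := by simp [bil, vα₁, vα₂]; linear_combination (1/2) * rt3_sq
theorem bαα₃ : bil vα₁ vα₃ = 3/2 := by simp [bil, vα₁, vα₃]; linear_combination (1/2) * rt3_sq
theorem bαβ₂ : bil vα₁ vβ₂ = 3/2 := by simp [bil, vα₁, vβ₂]; linear_combination (1/2) * rt3_sq
theorem bαβ₃ : bil vα₁ vβ₃ = 3/2 := by simp [bil, vα₁, vβ₃]; linear_combination (1/2) * rt3_sq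

theorem zα₁ (x y : ℂ) : bil vα₁ (pt x y) = y * 3 := by
  simp [bil, vα₁, pt]; linear_combination y * rt3_sq
theorem zα₂ (x y : ℂ) : bil vα₂ (pt x y) = ((y-x)/2) * 3 := by
  simp [bil, vα₂, pt]; linear_combination (y/2) * rt3_sq
theorem zα₃ (x y : ℂ) : bil vα₃ (pt x y) = ((x+y)/2) * 3 := by
  simp [bil, vα₃, pt]; linear_combination (y/2) * rt3_sq
theorem zβ₁ (x y : ℂ) : bil vβ₁ (pt x y) = x := by
  simp [bil, vβ₁, pt]
theorem zβ₂ (x y : ℂ) : bil vβ₂ (pt x y) = (x+3*y)/2 := by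
  simp [bil, vβ₂, pt]; linear_combination (y/2) * rt3_sq
theorem zβ₃ (x y : ℂ) : bil vβ₃ (pt x y) = (3*y-x)/2 := by
  simp [bil, vβ₃, pt]; linear_combination (y/2) * rt3_sq

theorem d3a (a f : ℂ) : a * 3 / (f * 3) = a / f := mul_div_mul_right _ _ (by norm_num)
theorem d3b (a f : ℂ) : a * 3 / (f * 3 + 3) = a / (f + 1) := by
  rw [← mul_div_mul_right a (f+1) (c := 3) (by norm_num)]; ring_nf
theorem d3c (a f : ℂ) : a * 3 / (f * 3 - 3) = a / (f - 1) := by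
  rw [← mul_div_mul_right a (f-1) (c := 3) (by norm_num)]; ring_nf

theorem neg_mul3 (f : ℂ) : -(f * 3) = (-f) * 3 := by ring

theorem mem4 : (4:ℂ) • vβ₁ ∈ fourShort := by simp [fourShort, shortRoots]
theorem mem2 : (2:ℂ) • vβ₁ ∈ twoShort := by simp [twoShort, shortRoots]

theorem bsneg (a : V2) : bil (-a) (-a) = bil a a := by simp [bil]

theorem short_self {a : V2} (h : a ∈ shortRoots) : bil a a = 1 := by
  simp only [shortRoots, List.mem_cons, List.not_mem_nil, or_false] at h
  rcases h with rfl | rfl | rfl | rfl | rfl | rfl <;> simp only [bsneg, bsβ₁, bsβ₂, bsβ₃]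
theorem long_self {a : V2} (h : a ∈ longRoots) : bil a a = 3 := by
  simp only [longRoots, List.mem_cons, List.not_mem_nil, or_false] at h
  rcases h with rfl | rfl | rfl | rfl | rfl | rfl <;> simp only [bsneg, bsα₁, bsα₂, bsα₃]

theorem not4_of {τ : V2} {c : ℂ} (h : bil τ τ = c) (hc : c ≠ 16) : τ ∉ fourShort := by
  intro hm
  simp only [fourShort, List.mem_map] at hm
  obtain ⟨a, ha, rfl⟩ := hm
  rw [bil_smull, bil_smulr, short_self ha] at h
  exact hc (by rw [← h]; norm_num)
theorem not2_of {τ : V2} {c : ℂ} (h : bil τ τ = c) (hc : c ≠ 4) : τ ∉ twoShort := by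
  intro hm
  simp only [twoShort, List.mem_map] at hm
  obtain ⟨a, ha, rfl⟩ := hm
  rw [bil_smull, bil_smulr, short_self ha] at h
  exact hc (by rw [← h]; norm_num)

theorem ny1 (x y : ℂ) : -((y-x)/2) = (x-y)/2 := by ring
theorem ny3 (x y : ℂ) : -((3*y-x)/2) = (x-3*y)/2 := by ring

theorem aD2_4 (m : ℕ) (x y : ℂ) : aD2 m ((4:ℂ) • vβ₁) (pt x y) = A4 m x y := by
  unfold aD2
  rw [if_pos mem4]
  have e : (4⁻¹ : ℂ) • (4 : ℂ) • vβ₁ = vβ₁ := by rw [smul_smul]; norm_num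
  simp only [e, longRoots, shortRoots, List.filter_cons, List.filter_nil, bil_negl, bil_negr, bil_smull, bsα₁, bsα₂, bsα₃, bsβ₁, bsβ₂, bsβ₃,
    bβα₁, bβα₂, bβα₃, bββ₂, bββ₃, bαβ₁, bαα₂, bαα₃, bαβ₂, bαβ₃]
  norm_num
  simp only [bil_negl, bil_negr, neg_neg, zα₁, zα₂, zα₃, zβ₁, zβ₂, zβ₃, bsα₁, bsα₂, bsα₃, bsβ₁, bsβ₂, bsβ₃, neg_mul3, d3a, d3b, d3c]
  simp only [mul_one, ny1, ny3]
  trans 8 * (h2 m ((x+y)/2) * h2 m ((x-y)/2)) * (p22 m ((x+3*y)/2) * p22 m ((x-3*y)/2)) * p4 m x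
  · rfl
  · unfold A4 gA4; ring

theorem aD2_2 (m : ℕ) (x y : ℂ) : aD2 m ((2:ℂ) • vβ₁) (pt x y) = A2 m x y := by
  unfold aD2
  rw [if_neg (not4_of (c := 4) (by rw [bil_smull, bil_smulr, bsβ₁]; norm_num) (by norm_num)), if_pos mem2]
  have e : (2⁻¹ : ℂ) • (2 : ℂ) • vβ₁ = vβ₁ := by rw [smul_smul]; norm_num
  simp only [e, longRoots, shortRoots, List.filter_cons, List.filter_nil, bil_negl, bil_negr, bil_smull, bsα₁, bsα₂, bsα₃, bsβ₁, bsβ₂, bsβ₃,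
    bβα₁, bβα₂, bβα₃, bββ₂, bββ₃, bαβ₁, bαα₂, bαα₃, bαβ₂, bαβ₃]
  norm_num
  simp only [bil_negl, bil_negr, neg_neg, zα₁, zα₂, zα₃, zβ₁, zβ₂, zβ₃, bsα₁, bsα₂, bsα₃, bsβ₁, bsβ₂, bsβ₃, neg_mul3, d3a, d3b, d3c]
  simp only [mul_one, ny1, ny3]
  trans 9 * (m:ℂ) * ((m:ℂ)+1) * h0 y * (h1 m ((x+y)/2) * h1 m ((x-y)/2)) * (p1 m ((x+3*y)/2) * p1 m ((x-3*y)/2)) * p2 m x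
  · rfl
  · unfold A2 gA2; ring

theorem aD2_L (m : ℕ) (x y : ℂ) : aD2 m ((2:ℂ) • vα₁) (pt x y) = AL m x y := by
  unfold aD2
  rw [if_neg (not4_of (c := 12) (by rw [bil_smull, bil_smulr, bsα₁]; norm_num) (by norm_num)),
    if_neg (not2_of (c := 12) (by rw [bil_smull, bil_smulr, bsα₁]; norm_num) (by norm_num))]
  have e : (2⁻¹ : ℂ) • (2 : ℂ) • vα₁ = vα₁ := by rw [smul_smul]; norm_num
  simp only [e, longRoots, shortRoots, List.filter_cons, List.filter_nil, bil_negl, bil_negr, bil_smull, bsα₁, bsα₂, bsα₃, bsβ₁, bsβ₂, bsβ₃,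
    bβα₁, bβα₂, bβα₃, bββ₂, bββ₃, bαβ₁, bαα₂, bαα₃, bαβ₂, bαβ₃]
  norm_num
  simp only [bil_negl, bil_negr, neg_neg, zα₁, zα₂, zα₃, zβ₁, zβ₂, zβ₃, bsα₁, bsα₂, bsα₃, bsβ₁, bsβ₂, bsβ₃, neg_mul3, d3a, d3b, d3c]
  simp only [mul_one, ny1, ny3]
  trans (m:ℂ) * ((m:ℂ)+1) * 3 * (p3 m ((x+3*y)/2) * p3 m ((3*y-x)/2)) * p0 x * (h1 m ((y-x)/2) * h1 m ((x+y)/2)) * h2 m y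
  · rfl
  · unfold AL gAL; ring

theorem rot_pt (X Y : ℂ) : rot (pt X Y) = pt ((X-3*Y)/2) ((X+Y)/2) := by
  have := rt3_sq
  ext i; fin_cases i
  · simp [rot, lin2, pt]; linear_combination (-Y/2) * rt3_sq
  · simp [rot, lin2, pt]; ring
theorem refx_pt (X Y : ℂ) : refx (pt X Y) = pt (-X) Y := by
  ext i; fin_cases i <;> simp [refx, lin2, pt]
theorem refy_pt (X Y : ℂ) : refy (pt X Y) = pt X (-Y) := by
  ext i; fin_cases i <;> simp [refy, lin2, pt]

theorem aD2_rot (m : ℕ) (τ : V2) (x y : ℂ) :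
    aD2 m (rot τ) (pt x y) = aD2 m τ (pt ((x+3*y)/2) ((y-x)/2)) := by
  rw [← aD2_sym rot_sym m τ, rot_pt]
  congr 2 <;> ring
theorem aD2_refx (m : ℕ) (τ : V2) (x y : ℂ) :
    aD2 m (refx τ) (pt x y) = aD2 m τ (pt (-x) y) := by
  rw [← aD2_sym refx_sym m τ, refx_pt, neg_neg]
theorem aD2_refy (m : ℕ) (τ : V2) (x y : ℂ) :
    aD2 m (refy τ) (pt x y) = aD2 m τ (pt x (-y)) := by
  rw [← aD2_sym refy_sym m τ, refy_pt, neg_neg]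

theorem h0_neg (f : ℂ) : h0 (-f) = h0 f := by unfold h0; rw [neg_neg, mul_comm]
theorem p0_neg (f : ℂ) : p0 (-f) = p0 f := by unfold p0; rw [neg_neg, mul_comm]

theorem e1 (x y : ℂ) : ((x+3*y)/2 + (y-x)/2)/2 = y := by ring
theorem e2 (x y : ℂ) : ((x+3*y)/2 - (y-x)/2)/2 = (x+y)/2 := by ring
theorem e3 (x y : ℂ) : ((x+3*y)/2 + 3*((y-x)/2))/2 = (3*y-x)/2 := by ring
theorem e4 (x y : ℂ) : ((x+3*y)/2 - 3*((y-x)/2))/2 = x := by ring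
theorem e5 (x y : ℂ) : (3*((y-x)/2) - (x+3*y)/2)/2 = -x := by ring
theorem e6 (x y : ℂ) : ((y-x)/2 - (x+3*y)/2)/2 = (-x-y)/2 := by ring
theorem e7 (x y : ℂ) : (-x + y)/2 = (y-x)/2 := by ring
theorem e8 (x y : ℂ) : (-x + 3*y)/2 = (3*y-x)/2 := by ring
theorem e9 (x y : ℂ) : (3*y - -x)/2 = (x+3*y)/2 := by ring

theorem aD2_4r (m : ℕ) (x y : ℂ) : aD2 m (rot ((4:ℂ) • vβ₁)) (pt x y) = B4 m x y := by
  rw [aD2_rot, aD2_4]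
  unfold A4 gA4 B4 gB4
  rw [e1, e2, e3, e4]; ring
theorem aD2_2r (m : ℕ) (x y : ℂ) : aD2 m (rot ((2:ℂ) • vβ₁)) (pt x y) = B2 m x y := by
  rw [aD2_rot, aD2_2]
  unfold A2 gA2 B2 gB2
  rw [e1, e2, e3, e4]; ring
theorem aD2_Lr (m : ℕ) (x y : ℂ) : aD2 m (rot ((2:ℂ) • vα₁)) (pt x y) = BL m (-x) y := by
  rw [aD2_rot, aD2_L]
  unfold AL gAL BL gBL
  rw [e1, e3, e5, e6, e7, e8, e9]; ring

theorem Avx : refx vβ₁ = -vβ₁ := by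
  ext i; fin_cases i <;> simp [refx, lin2, vβ₁]
theorem Aβx : refx vβ₂ = vβ₃ := by
  ext i; fin_cases i <;> simp [refx, lin2, vβ₂, vβ₃]
theorem Aβy : refy vβ₂ = -vβ₃ := by
  ext i; fin_cases i <;> simp [refy, lin2, vβ₂, vβ₃]
theorem Aβxy : refx (refy vβ₂) = -vβ₂ := by
  ext i; fin_cases i <;> simp [refy, refx, lin2, vβ₂]
theorem Aαy : refy vα₁ = -vα₁ := by
  ext i; fin_cases i <;> simp [refy, lin2, vα₁]
theorem Aα2x : refx vα₂ = vα₃ := by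
  ext i; fin_cases i <;> simp [refx, lin2, vα₂, vα₃]
theorem Aα2y : refy vα₂ = -vα₃ := by
  ext i; fin_cases i <;> simp [refy, lin2, vα₂, vα₃]
theorem Aα2xy : refx (refy vα₂) = -vα₂ := by
  ext i; fin_cases i <;> simp [refy, refx, lin2, vα₂]

theorem applyD2_pt (m : ℕ) (p : V2 → ℂ) (x y : ℂ) : applyD2 m p (pt x y) =
    ∑ i, cf m i x y * (p (pt (x + dX i) (y + dY i)) - p (pt x y)) := by
  have c12 := aD2_L m x y
  have c13 : aD2 m ((2:ℂ) • -vα₁) (pt x y) = AL m x (-y) := by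
    rw [← Aαy, ← map_smul, aD2_refy, aD2_L]
  have c15 : aD2 m ((2:ℂ) • vα₂) (pt x y) = BL m (-x) y := by
    rw [← rot_α₁, ← map_smul, aD2_Lr]
  have c14 : aD2 m ((2:ℂ) • vα₃) (pt x y) = BL m x y := by
    rw [← Aα2x, ← rot_α₁, ← map_smul, ← map_smul, aD2_refx, aD2_Lr, neg_neg]
  have c17 : aD2 m ((2:ℂ) • -vα₃) (pt x y) = BL m (-x) (-y) := by
    rw [← Aα2y, ← rot_α₁, ← map_smul, ← map_smul, aD2_refy, aD2_Lr]
  have c16 : aD2 m ((2:ℂ) • -vα₂) (pt x y) = BL m x (-y) := by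
    rw [← Aα2xy, ← rot_α₁, ← map_smul, ← map_smul, ← map_smul, aD2_refx, aD2_refy, aD2_Lr, neg_neg]
  have c6 := aD2_2 m x y
  have c7 : aD2 m ((2:ℂ) • -vβ₁) (pt x y) = A2 m (-x) y := by
    rw [← Avx, ← map_smul, aD2_refx, aD2_2]
  have c8 : aD2 m ((2:ℂ) • vβ₂) (pt x y) = B2 m x y := by
    rw [← rot_β₁, ← map_smul, aD2_2r]
  have c9 : aD2 m ((2:ℂ) • vβ₃) (pt x y) = B2 m (-x) y := by
    rw [← Aβx, ← rot_β₁, ← map_smul, ← map_smul, aD2_refx, aD2_2r]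
  have c10 : aD2 m ((2:ℂ) • -vβ₃) (pt x y) = B2 m x (-y) := by
    rw [← Aβy, ← rot_β₁, ← map_smul, ← map_smul, aD2_refy, aD2_2r]
  have c11 : aD2 m ((2:ℂ) • -vβ₂) (pt x y) = B2 m (-x) (-y) := by
    rw [← Aβxy, ← rot_β₁, ← map_smul, ← map_smul, ← map_smul, aD2_refx, aD2_refy, aD2_2r]
  have c0 := aD2_4 m x y
  have c1 : aD2 m ((4:ℂ) • -vβ₁) (pt x y) = A4 m (-x) y := by
    rw [← Avx, ← map_smul, aD2_refx, aD2_4]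
  have c2 : aD2 m ((4:ℂ) • vβ₂) (pt x y) = B4 m x y := by
    rw [← rot_β₁, ← map_smul, aD2_4r]
  have c3 : aD2 m ((4:ℂ) • vβ₃) (pt x y) = B4 m (-x) y := by
    rw [← Aβx, ← rot_β₁, ← map_smul, ← map_smul, aD2_refx, aD2_4r]
  have c4 : aD2 m ((4:ℂ) • -vβ₃) (pt x y) = B4 m x (-y) := by
    rw [← Aβy, ← rot_β₁, ← map_smul, ← map_smul, aD2_refy, aD2_4r]
  have c5 : aD2 m ((4:ℂ) • -vβ₂) (pt x y) = B4 m (-x) (-y) := by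
    rw [← Aβxy, ← rot_β₁, ← map_smul, ← map_smul, ← map_smul, aD2_refx, aD2_refy, aD2_4r]
  have key : ∀ (τ : V2) (a b : ℂ), τ 0 = a → τ 1 = rt3 * b → pt x y + τ = pt (x+a) (y+b) := by
    intro τ a b h1 h2
    ext i; fin_cases i
    · simp [pt, h1]
    · simp [pt, h2]; ring
  have k12 := key ((2:ℂ) • vα₁) 0 2 (by simp [vα₁] <;> ring) (by simp [vα₁] <;> ring)
  have k13 := key ((2:ℂ) • -vα₁) 0 (-2) (by simp [vα₁] <;> ring) (by simp [vα₁] <;> ring)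
  have k14 := key ((2:ℂ) • vα₃) 3 1 (by simp [vα₃] <;> ring) (by simp [vα₃] <;> ring)
  have k15 := key ((2:ℂ) • vα₂) (-3) 1 (by simp [vα₂] <;> ring) (by simp [vα₂] <;> ring)
  have k16 := key ((2:ℂ) • -vα₂) 3 (-1) (by simp [vα₂] <;> ring) (by simp [vα₂] <;> ring)
  have k17 := key ((2:ℂ) • -vα₃) (-3) (-1) (by simp [vα₃] <;> ring) (by simp [vα₃] <;> ring)
  have k6 := key ((2:ℂ) • vβ₁) 2 0 (by simp [vβ₁] <;> ring) (by simp [vβ₁] <;> ring)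
  have k7 := key ((2:ℂ) • -vβ₁) (-2) 0 (by simp [vβ₁] <;> ring) (by simp [vβ₁] <;> ring)
  have k8 := key ((2:ℂ) • vβ₂) 1 1 (by simp [vβ₂] <;> ring) (by simp [vβ₂] <;> ring)
  have k9 := key ((2:ℂ) • vβ₃) (-1) 1 (by simp [vβ₃] <;> ring) (by simp [vβ₃] <;> ring)
  have k10 := key ((2:ℂ) • -vβ₃) 1 (-1) (by simp [vβ₃] <;> ring) (by simp [vβ₃] <;> ring)
  have k11 := key ((2:ℂ) • -vβ₂) (-1) (-1) (by simp [vβ₂] <;> ring) (by simp [vβ₂] <;> ring)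
  have k0 := key ((4:ℂ) • vβ₁) 4 0 (by simp [vβ₁] <;> ring) (by simp [vβ₁] <;> ring)
  have k1 := key ((4:ℂ) • -vβ₁) (-4) 0 (by simp [vβ₁] <;> ring) (by simp [vβ₁] <;> ring)
  have k2 := key ((4:ℂ) • vβ₂) 2 2 (by simp [vβ₂] <;> ring) (by simp [vβ₂] <;> ring)
  have k3 := key ((4:ℂ) • vβ₃) (-2) 2 (by simp [vβ₃] <;> ring) (by simp [vβ₃] <;> ring)
  have k4 := key ((4:ℂ) • -vβ₃) 2 (-2) (by simp [vβ₃] <;> ring) (by simp [vβ₃] <;> ring)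
  have k5 := key ((4:ℂ) • -vβ₂) (-2) (-2) (by simp [vβ₂] <;> ring) (by simp [vβ₂] <;> ring)
  unfold applyD2
  simp only [twoAG2, twoG2, G2all, fourShort, longRoots, shortRoots, List.map_append, List.map_cons, List.map_nil,
    List.cons_append, List.nil_append, List.sum_cons, List.sum_nil, c0, c1, c2, c3, c4, c5, c6, c7, c8, c9, c10, c11, c12,
    c13, c14, c15, c16, c17, k0, k1, k2, k3, k4, k5, k6, k7, k8, k9, k10, k11, k12, k13, k14, k15, k16, k17]
  simp only [Fin.sum_univ_succ, Fin.sum_univ_zero, cf, dX, dY, Matrix.cons_val_zero, Matrix.cons_val_succ]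
  ring
end AG2pf

namespace AG2pf
open Filter Topology

/-- `r` is the residue of `a` at the (at most simple) pole `k`. -/
def Rs (a : ℂ → ℂ) (k r : ℂ) : Prop := Tendsto (fun t => t * a (k+t)) (𝓝[≠] 0) (𝓝 r)

theorem tend_add (k : ℂ) : Tendsto (fun t : ℂ => k + t) (𝓝[≠] 0) (𝓝 k) := by
  have : Tendsto (fun t : ℂ => k + t) (𝓝 0) (𝓝 (k+0)) := (continuous_const.add continuous_id).tendsto 0
  rw [add_zero] at this
  exact this.mono_left nhdsWithin_le_nhds

theorem tend_id0 : Tendsto (fun t : ℂ => t) (𝓝[≠] 0) (𝓝 0) := tendsto_id.mono_left nhdsWithin_le_nhds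

theorem Rs_cont {a : ℂ → ℂ} {k : ℂ} (h : ContinuousAt a k) : Rs a k 0 := by
  have := tend_id0.mul (h.tendsto.comp (tend_add k))
  rw [zero_mul] at this
  exact this

theorem Rs_mul {a g : ℂ → ℂ} {k r : ℂ} (h : Rs a k r) (hg : ContinuousAt g k) :
    Rs (fun x => a x * g x) k (r * g k) := by
  have := Tendsto.mul h (hg.tendsto.comp (tend_add k))
  refine this.congr fun t => ?_
  simp only [Function.comp]; ring

theorem Rs_neg {a : ℂ → ℂ} {k r : ℂ} (h : Rs a (-k) r) : Rs (fun x => a (-x)) k (-r) := by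
  have hn : Tendsto (fun t : ℂ => -t) (𝓝[≠] 0) (𝓝[≠] 0) := by
    refine tendsto_nhdsWithin_iff.2 ⟨?_, ?_⟩
    · have : Tendsto (fun t : ℂ => -t) (𝓝 0) (𝓝 (-0)) := continuous_neg.tendsto 0
      rw [neg_zero] at this
      exact this.mono_left nhdsWithin_le_nhds
    · filter_upwards [self_mem_nhdsWithin] with t ht
      simpa using ht
  have := (Tendsto.comp h hn).neg
  refine this.congr fun t => ?_
  simp only [Function.comp]
  rw [neg_mul, neg_neg, neg_add]

theorem Rs_pole {a H : ℂ → ℂ} (c d k : ℂ) (hk : k + d = 0) (ha : ∀ f, a f = (1 - c/(f+d)) * H f)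
    (hH : ContinuousAt H k) : Rs a k (-c * H k) := by
  have h1 : Tendsto (fun t : ℂ => t - c) (𝓝[≠] 0) (𝓝 (0 - c)) := tend_id0.sub tendsto_const_nhds
  have := h1.mul (hH.tendsto.comp (tend_add k))
  rw [zero_sub] at this
  refine this.congr' ?_
  filter_upwards [self_mem_nhdsWithin] with t ht
  have ht : t ≠ 0 := ht
  have e : k + t + d = t := by linear_combination hk
  simp only [Function.comp]
  rw [ha, e]; field_simp

theorem p4_cont {M f : ℂ} (h0 : f ≠ 0) (h1 : f + 1 ≠ 0) (h2 : f + 2 ≠ 0) (h3 : f + 3 ≠ 0) :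
    ContinuousAt (p4 M) f := by unfold p4; fun_prop (disch := assumption)
theorem p22_cont {M f : ℂ} (h0 : f ≠ 0) (h1 : f + 1 ≠ 0) : ContinuousAt (p22 M) f := by
  unfold p22; fun_prop (disch := assumption)
theorem p2_cont {M f : ℂ} (h0 : f ≠ 0) (h1 : f + 1 ≠ 0) (h2 : f + 3 ≠ 0) (h3 : f - 1 ≠ 0) :
    ContinuousAt (p2 M) f := by unfold p2; fun_prop (disch := assumption)
theorem p1_cont {M f : ℂ} (h0 : f ≠ 0) (h1 : f + 2 ≠ 0) (h2 : f - 1 ≠ 0) :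
    ContinuousAt (p1 M) f := by unfold p1; fun_prop (disch := assumption)
theorem p3_cont {M f : ℂ} (h0 : f ≠ 0) (h1 : f + 1 ≠ 0) (h2 : f + 2 ≠ 0) :
    ContinuousAt (p3 M) f := by unfold p3; fun_prop (disch := assumption)
theorem p0_cont {f : ℂ} (h0 : f - 1 ≠ 0) (h1 : -f - 1 ≠ 0) :
    ContinuousAt p0 f := by unfold p0; fun_prop (disch := assumption)
theorem h2_cont {M f : ℂ} (h0 : f ≠ 0) (h1 : f + 1 ≠ 0) :
    ContinuousAt (h2 M) f := by unfold h2; fun_prop (disch := assumption)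
theorem h1_cont {M f : ℂ} (h0 : f ≠ 0) :
    ContinuousAt (h1 M) f := by unfold h1; fun_prop (disch := assumption)
theorem h0_cont {f : ℂ} (h0 : f - 1 ≠ 0) (h1 : -f - 1 ≠ 0) :
    ContinuousAt AG2pf.h0 f := by unfold AG2pf.h0; fun_prop (disch := assumption)

/-- not an integer -/
def NZ (f : ℂ) : Prop := ∀ n : ℤ, f ≠ n

theorem NZ.add {f : ℂ} (h : NZ f) (n : ℤ) : f + n ≠ 0 := fun e => h (-n) (by push_cast; linear_combination e)
theorem NZ.neg {f : ℂ} (h : NZ f) : NZ (-f) := fun n e => h (-n) (by push_cast; linear_combination -e)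
theorem NZ.a0 {f : ℂ} (h : NZ f) : f ≠ 0 := by simpa using h 0
theorem NZ.a1 {f : ℂ} (h : NZ f) : f + 1 ≠ 0 := by simpa using h.add 1
theorem NZ.a2 {f : ℂ} (h : NZ f) : f + 2 ≠ 0 := by simpa using h.add 2
theorem NZ.a3 {f : ℂ} (h : NZ f) : f + 3 ≠ 0 := by simpa using h.add 3
theorem NZ.m1 {f : ℂ} (h : NZ f) : f - 1 ≠ 0 := by simpa [sub_eq_add_neg] using h.add (-1)
theorem NZ.n1 {f : ℂ} (h : NZ f) : -f - 1 ≠ 0 := h.neg.m1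

theorem NZ.p4 {M f : ℂ} (h : NZ f) : ContinuousAt (p4 M) f := p4_cont h.a0 h.a1 h.a2 h.a3
theorem NZ.p22 {M f : ℂ} (h : NZ f) : ContinuousAt (p22 M) f := p22_cont h.a0 h.a1
theorem NZ.p2 {M f : ℂ} (h : NZ f) : ContinuousAt (p2 M) f := p2_cont h.a0 h.a1 h.a3 h.m1
theorem NZ.p1 {M f : ℂ} (h : NZ f) : ContinuousAt (p1 M) f := p1_cont h.a0 h.a2 h.m1
theorem NZ.p3 {M f : ℂ} (h : NZ f) : ContinuousAt (p3 M) f := p3_cont h.a0 h.a1 h.a2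
theorem NZ.p0 {f : ℂ} (h : NZ f) : ContinuousAt p0 f := p0_cont h.m1 h.n1
theorem NZ.h2 {M f : ℂ} (h : NZ f) : ContinuousAt (h2 M) f := h2_cont h.a0 h.a1
theorem NZ.h1 {M f : ℂ} (h : NZ f) : ContinuousAt (h1 M) f := h1_cont h.a0
theorem NZ.h0 {f : ℂ} (h : NZ f) : ContinuousAt h0 f := h0_cont h.m1 h.n1

/-- half-sum genericity -/
theorem NZ.half {u : ℂ} (h : NZ u) (k : ℤ) : NZ ((k + u)/2) := fun n e =>
  h (2*n-k) (by push_cast; linear_combination 2 * e)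

theorem NZ.of3 {y : ℂ} (h : NZ (3*y)) : NZ y := fun n e => h (3*n) (by push_cast; rw [e])

theorem b1 {y : ℂ} (hy : NZ (3*y)) (k : ℤ) : NZ (((k:ℂ)+y)/2) := hy.of3.half k
theorem b2 {y : ℂ} (hy : NZ (3*y)) (k : ℤ) : NZ (((k:ℂ)-y)/2) := by simpa [sub_eq_add_neg] using hy.of3.neg.half k
theorem b3 {y : ℂ} (hy : NZ (3*y)) (k : ℤ) : NZ (((k:ℂ)+3*y)/2) := hy.half k
theorem b4 {y : ℂ} (hy : NZ (3*y)) (k : ℤ) : NZ (((k:ℂ)-3*y)/2) := by simpa [sub_eq_add_neg] using hy.neg.half k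
theorem b5 {y : ℂ} (hy : NZ (3*y)) (k : ℤ) : NZ ((3*y-(k:ℂ))/2) := by
  have := hy.half (-k); push_cast at this; rwa [neg_add_eq_sub] at this
theorem b6 {y : ℂ} (hy : NZ (3*y)) (k : ℤ) : NZ ((y-(k:ℂ))/2) := by
  have := hy.of3.half (-k); push_cast at this; rwa [neg_add_eq_sub] at this

theorem cc (h : ℂ → ℂ) (u : ℂ → ℂ) (k : ℂ) (hh : ContinuousAt h (u k)) (hu : Continuous u) :
    ContinuousAt (fun x => h (u x)) k := ContinuousAt.comp hh hu.continuousAt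

theorem cm4 {a b c d : ℂ → ℂ} {k : ℂ} (C : ℂ) (h1 : ContinuousAt a k) (h2 : ContinuousAt b k) (h3 : ContinuousAt c k)
    (h4 : ContinuousAt d k) : ContinuousAt (fun x => C * (a x * b x * c x * d x)) k :=
  continuousAt_const.mul (((h1.mul h2).mul h3).mul h4)
theorem cm5 {a b c d e : ℂ → ℂ} {k : ℂ} (C : ℂ) (h1 : ContinuousAt a k) (h2 : ContinuousAt b k) (h3 : ContinuousAt c k)
    (h4 : ContinuousAt d k) (h5 : ContinuousAt e k) : ContinuousAt (fun x => C * (a x * b x * c x * d x * e x)) k :=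
  continuousAt_const.mul ((((h1.mul h2).mul h3).mul h4).mul h5)

theorem gA4_c {M y : ℂ} (hy : NZ (3*y)) (k : ℤ) : ContinuousAt (fun x => gA4 M x y) k := by
  exact cm4 8 (cc (AG2pf.h2 M) (fun x => ((x+y)/2)) k (b1 hy k).h2 (by fun_prop)) (cc (AG2pf.h2 M) (fun x => ((x-y)/2)) k (b2 hy k).h2 (by fun_prop)) (cc (AG2pf.p22 M) (fun x => ((x+3*y)/2)) k (b3 hy k).p22 (by fun_prop)) (cc (AG2pf.p22 M) (fun x => ((x-3*y)/2)) k (b4 hy k).p22 (by fun_prop))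
theorem gB4_c {M y : ℂ} (hy : NZ (3*y)) (k : ℤ) : ContinuousAt (fun x => gB4 M x y) k := by
  exact cm4 8 (cc (AG2pf.p4 M) (fun x => ((x+3*y)/2)) k (b3 hy k).p4 (by fun_prop)) continuousAt_const (cc (AG2pf.h2 M) (fun x => ((x+y)/2)) k (b1 hy k).h2 (by fun_prop)) (cc (AG2pf.p22 M) (fun x => ((3*y-x)/2)) k (b5 hy k).p22 (by fun_prop))
theorem gA2_c {M y : ℂ} (hy : NZ (3*y)) (k : ℤ) : ContinuousAt (fun x => gA2 M x y) k := by
  exact cm5 (9*M*(M+1)) continuousAt_const (cc (AG2pf.h1 M) (fun x => ((x+y)/2)) k (b1 hy k).h1 (by fun_prop)) (cc (AG2pf.h1 M) (fun x => ((x-y)/2)) k (b2 hy k).h1 (by fun_prop)) (cc (AG2pf.p1 M) (fun x => ((x+3*y)/2)) k (b3 hy k).p1 (by fun_prop)) (cc (AG2pf.p1 M) (fun x => ((x-3*y)/2)) k (b4 hy k).p1 (by fun_prop))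
theorem gB2_c {M y : ℂ} (hy : NZ (3*y)) (k : ℤ) : ContinuousAt (fun x => gB2 M x y) k := by
  exact cm5 (9*M*(M+1)) (cc (AG2pf.p2 M) (fun x => ((x+3*y)/2)) k (b3 hy k).p2 (by fun_prop)) (cc AG2pf.h0 (fun x => ((y-x)/2)) k (b6 hy k).h0 (by fun_prop)) continuousAt_const (cc (AG2pf.h1 M) (fun x => ((x+y)/2)) k (b1 hy k).h1 (by fun_prop)) (cc (AG2pf.p1 M) (fun x => ((3*y-x)/2)) k (b5 hy k).p1 (by fun_prop))
theorem gAL_c {M y : ℂ} (hy : NZ (3*y)) (k : ℤ) : ContinuousAt (fun x => gAL M x y) k := by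
  exact cm5 (3*M*(M+1)) continuousAt_const (cc (AG2pf.p3 M) (fun x => ((x+3*y)/2)) k (b3 hy k).p3 (by fun_prop)) (cc (AG2pf.p3 M) (fun x => ((3*y-x)/2)) k (b5 hy k).p3 (by fun_prop)) (cc (AG2pf.h1 M) (fun x => ((x+y)/2)) k (b1 hy k).h1 (by fun_prop)) (cc (AG2pf.h1 M) (fun x => ((y-x)/2)) k (b6 hy k).h1 (by fun_prop))
theorem gBL_c {M y : ℂ} (hy : NZ (3*y)) (k : ℤ) : ContinuousAt (fun x => gBL M x y) k := by
  exact cm5 (3*M*(M+1)) (cc (AG2pf.h2 M) (fun x => ((x+y)/2)) k (b1 hy k).h2 (by fun_prop)) (cc (AG2pf.p3 M) (fun x => ((x+3*y)/2)) k (b3 hy k).p3 (by fun_prop)) (cc AG2pf.p0 (fun x => ((3*y-x)/2)) k (b5 hy k).p0 (by fun_prop)) continuousAt_const (cc (AG2pf.h1 M) (fun x => ((x-y)/2)) k (b2 hy k).h1 (by fun_prop))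
end AG2pf

namespace AG2pf
open Filter Topology

theorem p4_r0 (M : ℂ) : Rs (p4 M) 0 (-(3*M+2) * ((1 - 3*M/(0+1)) * (1 - (3*M+2)/(0+2)) * (1 - 3*M/(0+3)))) :=
  Rs_pole (H := fun f => (1 - 3*M/(f+1)) * (1 - (3*M+2)/(f+2)) * (1 - 3*M/(f+3))) (3*M+2) 0 0 (by norm_num)
    (fun f => by unfold p4; ring) (by fun_prop (disch := norm_num))
theorem p4_r1 (M : ℂ) : Rs (p4 M) (-1) (-(3*M) * ((1 - (3*M+2)/(-1)) * (1 - (3*M+2)/(-1+2)) * (1 - 3*M/(-1+3)))) :=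
  Rs_pole (H := fun f => (1 - (3*M+2)/f) * (1 - (3*M+2)/(f+2)) * (1 - 3*M/(f+3))) (3*M) 1 (-1) (by norm_num)
    (fun f => by unfold p4; ring) (by fun_prop (disch := norm_num))
theorem p4_r2 (M : ℂ) : Rs (p4 M) (-2) (-(3*M+2) * ((1 - (3*M+2)/(-2)) * (1 - 3*M/(-2+1)) * (1 - 3*M/(-2+3)))) :=
  Rs_pole (H := fun f => (1 - (3*M+2)/f) * (1 - 3*M/(f+1)) * (1 - 3*M/(f+3))) (3*M+2) 2 (-2) (by norm_num)
    (fun f => by unfold p4; ring) (by fun_prop (disch := norm_num))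
theorem p4_r3 (M : ℂ) : Rs (p4 M) (-3) (-(3*M) * ((1 - (3*M+2)/(-3)) * (1 - 3*M/(-3+1)) * (1 - (3*M+2)/(-3+2)))) :=
  Rs_pole (H := fun f => (1 - (3*M+2)/f) * (1 - 3*M/(f+1)) * (1 - (3*M+2)/(f+2))) (3*M) 3 (-3) (by norm_num)
    (fun f => by unfold p4; ring) (by fun_prop (disch := norm_num))
theorem p22_r0 (M : ℂ) : Rs (p22 M) 0 (-(3*M+2) * (1 - 3*M/(0+1))) :=
  Rs_pole (H := fun f => (1 - 3*M/(f+1))) (3*M+2) 0 0 (by norm_num)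
    (fun f => by unfold p22; ring) (by fun_prop (disch := norm_num))
theorem p22_r1 (M : ℂ) : Rs (p22 M) (-1) (-(3*M) * (1 - (3*M+2)/(-1))) :=
  Rs_pole (H := fun f => (1 - (3*M+2)/f)) (3*M) 1 (-1) (by norm_num)
    (fun f => by unfold p22; ring) (by fun_prop (disch := norm_num))
theorem p2_r0 (M : ℂ) : Rs (p2 M) 0 (-(3*M+2) * ((1 - 3*M/(0+1)) * (1 + 4/(0+3)) * (1 - 4/(0-1)))) :=
  Rs_pole (H := fun f => (1 - 3*M/(f+1)) * (1 + 4/(f+3)) * (1 - 4/(f-1))) (3*M+2) 0 0 (by norm_num)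
    (fun f => by unfold p2; ring) (by fun_prop (disch := norm_num))
theorem p2_r1 (M : ℂ) : Rs (p2 M) (-1) (-(3*M) * ((1 - (3*M+2)/(-1)) * (1 + 4/(-1+3)) * (1 - 4/(-1-1)))) :=
  Rs_pole (H := fun f => (1 - (3*M+2)/f) * (1 + 4/(f+3)) * (1 - 4/(f-1))) (3*M) 1 (-1) (by norm_num)
    (fun f => by unfold p2; ring) (by fun_prop (disch := norm_num))
theorem p2_r3 (M : ℂ) : Rs (p2 M) (-3) (-(-4) * ((1 - (3*M+2)/(-3)) * (1 - 3*M/(-3+1)) * (1 - 4/(-3-1)))) :=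
  Rs_pole (H := fun f => (1 - (3*M+2)/f) * (1 - 3*M/(f+1)) * (1 - 4/(f-1))) (-4) 3 (-3) (by norm_num)
    (fun f => by unfold p2; ring) (by fun_prop (disch := norm_num))
theorem p2_rp (M : ℂ) : Rs (p2 M) 1 (-4 * ((1 - (3*M+2)/1) * (1 - 3*M/(1+1)) * (1 + 4/(1+3)))) :=
  Rs_pole (H := fun f => (1 - (3*M+2)/f) * (1 - 3*M/(f+1)) * (1 + 4/(f+3))) 4 (-1) 1 (by norm_num)
    (fun f => by unfold p2; rw [← sub_eq_add_neg]; ring) (by fun_prop (disch := norm_num))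
theorem p1_r0 (M : ℂ) : Rs (p1 M) 0 (-(3*M+2) * ((1 + 3*M/(0+2)) * (1 - (3*M-1)/(0-1)))) :=
  Rs_pole (H := fun f => (1 + 3*M/(f+2)) * (1 - (3*M-1)/(f-1))) (3*M+2) 0 0 (by norm_num)
    (fun f => by unfold p1; ring) (by fun_prop (disch := norm_num))
theorem p1_r2 (M : ℂ) : Rs (p1 M) (-2) (-(-(3*M)) * ((1 - (3*M+2)/(-2)) * (1 - (3*M-1)/(-2-1)))) :=
  Rs_pole (H := fun f => (1 - (3*M+2)/f) * (1 - (3*M-1)/(f-1))) (-(3*M)) 2 (-2) (by norm_num)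
    (fun f => by unfold p1; ring) (by fun_prop (disch := norm_num))
theorem p1_rp (M : ℂ) : Rs (p1 M) 1 (-(3*M-1) * ((1 - (3*M+2)/1) * (1 + 3*M/(1+2)))) :=
  Rs_pole (H := fun f => (1 - (3*M+2)/f) * (1 + 3*M/(f+2))) (3*M-1) (-1) 1 (by norm_num)
    (fun f => by unfold p1; rw [← sub_eq_add_neg]; ring) (by fun_prop (disch := norm_num))
theorem p3_r0 (M : ℂ) : Rs (p3 M) 0 (-(3*M+2) * ((1 - (3*M+1)/(0+1)) * (1 - 3*M/(0+2)))) :=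
  Rs_pole (H := fun f => (1 - (3*M+1)/(f+1)) * (1 - 3*M/(f+2))) (3*M+2) 0 0 (by norm_num)
    (fun f => by unfold p3; ring) (by fun_prop (disch := norm_num))
theorem p3_r1 (M : ℂ) : Rs (p3 M) (-1) (-(3*M+1) * ((1 - (3*M+2)/(-1)) * (1 - 3*M/(-1+2)))) :=
  Rs_pole (H := fun f => (1 - (3*M+2)/f) * (1 - 3*M/(f+2))) (3*M+1) 1 (-1) (by norm_num)
    (fun f => by unfold p3; ring) (by fun_prop (disch := norm_num))
theorem p3_r2 (M : ℂ) : Rs (p3 M) (-2) (-(3*M) * ((1 - (3*M+2)/(-2)) * (1 - (3*M+1)/(-2+1)))) :=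
  Rs_pole (H := fun f => (1 - (3*M+2)/f) * (1 - (3*M+1)/(f+1))) (3*M) 2 (-2) (by norm_num)
    (fun f => by unfold p3; ring) (by fun_prop (disch := norm_num))
theorem p0_rp : Rs p0 1 (-6 * (1 - 6/(-1-1))) :=
  Rs_pole (H := fun f => (1 - 6/(-f-1))) 6 (-1) 1 (by norm_num)
    (fun f => by unfold p0; rw [← sub_eq_add_neg]) (by fun_prop (disch := norm_num))
theorem h2_r0 (M : ℂ) : Rs (h2 M) 0 (-M * (1 - M/(0+1))) :=
  Rs_pole (H := fun f => (1 - M/(f+1))) M 0 0 (by norm_num)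
    (fun f => by unfold h2; rw [add_zero]) (by fun_prop (disch := norm_num))
theorem h2_r1 (M : ℂ) : Rs (h2 M) (-1) (-M * (1 - M/(-1))) :=
  Rs_pole (H := fun f => (1 - M/f)) M 1 (-1) (by norm_num)
    (fun f => by unfold h2; ring) (by fun_prop (disch := norm_num))
theorem h1_r0 (M : ℂ) : Rs (h1 M) 0 (-M * 1) :=
  Rs_pole (H := fun f => 1) M 0 0 (by norm_num)
    (fun f => by unfold h1; rw [add_zero, mul_one]) (by fun_prop)
theorem h0_rp : Rs h0 1 (-(2/3) * (1 - (2/3)/(-1-1))) :=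
  Rs_pole (H := fun f => (1 - (2/3)/(-f-1))) (2/3) (-1) 1 (by norm_num)
    (fun f => by unfold h0; rw [← sub_eq_add_neg]) (by fun_prop (disch := norm_num))

/-- all the residues at `x = k` -/
theorem Rs_all {M y : ℂ} (hy : NZ (3*y)) (k : ℤ) {a4 b4 a22 b22 a2 b2 a1 b1 a3 b3 a0 : ℂ}
    (A4 : Rs (p4 M) k a4) (B4 : Rs (p4 M) (-k) b4) (A22 : Rs (p22 M) k a22) (B22 : Rs (p22 M) (-k) b22)
    (A2 : Rs (p2 M) k a2) (B2 : Rs (p2 M) (-k) b2) (A1 : Rs (p1 M) k a1) (B1 : Rs (p1 M) (-k) b1)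
    (A3 : Rs (p3 M) k a3) (B3 : Rs (p3 M) (-k) b3) (A0 : Rs p0 k a0) (i : Fin 18) :
    Rs (fun x => cf M i x y) k
    ((![a4 * gA4 M k y, -(b4 * gA4 M (-k) y), a22 * gB4 M k y, -(b22 * gB4 M (-k) y), a22 * gB4 M k (-y), -(b22 * gB4 M (-k) (-y)),
    a2 * gA2 M k y, -(b2 * gA2 M (-k) y), a1 * gB2 M k y, -(b1 * gB2 M (-k) y), a1 * gB2 M k (-y), -(b1 * gB2 M (-k) (-y)),
    a0 * gAL M k y, a0 * gAL M k (-y), a3 * gBL M k y, -(b3 * gBL M (-k) y), a3 * gBL M k (-y), -(b3 * gBL M (-k) (-y))] : Fin 18 → ℂ) i) := by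
  have hy' : NZ (3 * (-y)) := by rw [mul_neg]; exact hy.neg
  have nk : ((-k : ℤ) : ℂ) = -(k:ℂ) := by push_cast; rfl
  have q1 := gA4_c (M := M) hy (-k)
  have q2 := gB4_c (M := M) hy (-k)
  have q3 := gB4_c (M := M) hy' (-k)
  have q4 := gA2_c (M := M) hy (-k)
  have q5 := gB2_c (M := M) hy (-k)
  have q6 := gB2_c (M := M) hy' (-k)
  have q7 := gBL_c (M := M) hy (-k)
  have q8 := gBL_c (M := M) hy' (-k)
  rw [nk] at q1 q2 q3 q4 q5 q6 q7 q8
  have r0 : Rs (fun x => AG2pf.A4 M x y) k (a4 * gA4 M k y) := Rs_mul (g := fun x => gA4 M x y) A4 (gA4_c hy k)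
  have r1 : Rs (fun x => AG2pf.A4 M (-x) y) k (-(b4 * gA4 M (-k) y)) :=
    Rs_neg (a := fun x => AG2pf.A4 M x y) (Rs_mul (g := fun x => gA4 M x y) B4 q1)
  have r2 : Rs (fun x => AG2pf.B4 M x y) k (a22 * gB4 M k y) := Rs_mul (g := fun x => gB4 M x y) A22 (gB4_c hy k)
  have r3 : Rs (fun x => AG2pf.B4 M (-x) y) k (-(b22 * gB4 M (-k) y)) :=
    Rs_neg (a := fun x => AG2pf.B4 M x y) (Rs_mul (g := fun x => gB4 M x y) B22 q2)
  have r4 : Rs (fun x => AG2pf.B4 M x (-y)) k (a22 * gB4 M k (-y)) := Rs_mul (g := fun x => gB4 M x (-y)) A22 (gB4_c hy' k)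
  have r5 : Rs (fun x => AG2pf.B4 M (-x) (-y)) k (-(b22 * gB4 M (-k) (-y))) :=
    Rs_neg (a := fun x => AG2pf.B4 M x (-y)) (Rs_mul (g := fun x => gB4 M x (-y)) B22 q3)
  have r6 : Rs (fun x => AG2pf.A2 M x y) k (a2 * gA2 M k y) := Rs_mul (g := fun x => gA2 M x y) A2 (gA2_c hy k)
  have r7 : Rs (fun x => AG2pf.A2 M (-x) y) k (-(b2 * gA2 M (-k) y)) :=
    Rs_neg (a := fun x => AG2pf.A2 M x y) (Rs_mul (g := fun x => gA2 M x y) B2 q4)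
  have r8 : Rs (fun x => AG2pf.B2 M x y) k (a1 * gB2 M k y) := Rs_mul (g := fun x => gB2 M x y) A1 (gB2_c hy k)
  have r9 : Rs (fun x => AG2pf.B2 M (-x) y) k (-(b1 * gB2 M (-k) y)) :=
    Rs_neg (a := fun x => AG2pf.B2 M x y) (Rs_mul (g := fun x => gB2 M x y) B1 q5)
  have r10 : Rs (fun x => AG2pf.B2 M x (-y)) k (a1 * gB2 M k (-y)) := Rs_mul (g := fun x => gB2 M x (-y)) A1 (gB2_c hy' k)
  have r11 : Rs (fun x => AG2pf.B2 M (-x) (-y)) k (-(b1 * gB2 M (-k) (-y))) :=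
    Rs_neg (a := fun x => AG2pf.B2 M x (-y)) (Rs_mul (g := fun x => gB2 M x (-y)) B1 q6)
  have r12 : Rs (fun x => AG2pf.AL M x y) k (a0 * gAL M k y) := Rs_mul (g := fun x => gAL M x y) A0 (gAL_c hy k)
  have r13 : Rs (fun x => AG2pf.AL M x (-y)) k (a0 * gAL M k (-y)) := Rs_mul (g := fun x => gAL M x (-y)) A0 (gAL_c hy' k)
  have r14 : Rs (fun x => AG2pf.BL M x y) k (a3 * gBL M k y) := Rs_mul (g := fun x => gBL M x y) A3 (gBL_c hy k)
  have r15 : Rs (fun x => AG2pf.BL M (-x) y) k (-(b3 * gBL M (-k) y)) :=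
    Rs_neg (a := fun x => AG2pf.BL M x y) (Rs_mul (g := fun x => gBL M x y) B3 q7)
  have r16 : Rs (fun x => AG2pf.BL M x (-y)) k (a3 * gBL M k (-y)) := Rs_mul (g := fun x => gBL M x (-y)) A3 (gBL_c hy' k)
  have r17 : Rs (fun x => AG2pf.BL M (-x) (-y)) k (-(b3 * gBL M (-k) (-y))) :=
    Rs_neg (a := fun x => AG2pf.BL M x (-y)) (Rs_mul (g := fun x => gBL M x (-y)) B3 q8)
  fin_cases i
  exacts [r0, r1, r2, r3, r4, r5, r6, r7, r8, r9, r10, r11, r12, r13, r14, r15, r16, r17]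
end AG2pf

namespace AG2pf
open Filter Topology
theorem NZ.y3 {y : ℂ} (h : NZ (3*y)) (n : ℤ) : 3*y + n ≠ 0 := h.add n

theorem fr {c d : ℂ} (h : d ≠ 0) : 1 - c/d = (d - c)/d := by field_simp
theorem fr' {c d : ℂ} (h : d ≠ 0) : 1 + c/d = (d + c)/d := by field_simp

theorem p4_e {M f : ℂ} (h : NZ f) : p4 M f = (f-3*M-2)*(f+1-3*M)*(f-3*M)*(f+3-3*M)/(f*(f+1)*(f+2)*(f+3)) := by
  unfold p4; rw [fr h.a0, fr h.a1, fr h.a2, fr h.a3]; have := h.a0; have := h.a1; have := h.a2; have := h.a3; field_simp; ring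
theorem p22_e {M f : ℂ} (h : NZ f) : p22 M f = (f-3*M-2)*(f+1-3*M)/(f*(f+1)) := by
  unfold p22; rw [fr h.a0, fr h.a1]; have := h.a0; have := h.a1; field_simp; ring
theorem p2_e {M f : ℂ} (h : NZ f) : p2 M f = (f-3*M-2)*(f+1-3*M)*(f+7)*(f-5)/(f*(f+1)*(f+3)*(f-1)) := by
  unfold p2; rw [fr h.a0, fr h.a1, fr' h.a3, fr h.m1]; have := h.a0; have := h.a1; have := h.m1; have := h.a3; field_simp; ring
theorem p1_e {M f : ℂ} (h : NZ f) : p1 M f = (f-3*M-2)*(f+2+3*M)*(f-3*M)/(f*(f+2)*(f-1)) := by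
  unfold p1; rw [fr h.a0, fr' h.a2, fr h.m1]; have := h.a0; have := h.a2; have := h.m1; field_simp; ring
theorem p3_e {M f : ℂ} (h : NZ f) : p3 M f = (f-3*M-2)*(f-3*M)*(f+2-3*M)/(f*(f+1)*(f+2)) := by
  unfold p3; rw [fr h.a0, fr h.a1, fr h.a2]; have := h.a0; have := h.a1; have := h.a2; field_simp; ring
theorem p0_e {f : ℂ} (h : NZ f) : p0 f = (f-7)*(f+7)/((f-1)*(f+1)) := by
  unfold p0; rw [fr h.m1, fr h.n1]; have := h.m1; have := h.a1; have := h.n1; field_simp; ring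
theorem h2_e {M f : ℂ} (h : NZ f) : h2 M f = (f-M)*(f+1-M)/(f*(f+1)) := by
  unfold h2; rw [fr h.a0, fr h.a1]; have := h.a0; have := h.a1; field_simp
theorem h1_e {M f : ℂ} (h : NZ f) : h1 M f = (f-M)/f := by
  unfold h1; rw [fr h.a0]
theorem h0_e {f : ℂ} (h : NZ f) : h0 f = (f-5/3)*(f+5/3)/((f-1)*(f+1)) := by
  unfold h0; rw [fr h.m1, fr h.n1]; have := h.m1; have := h.a1; have := h.n1; field_simp; ring

theorem I1 {M y : ℂ} (hy : NZ (3*y)) : -((-(3*M) * ((1 - (3*M+2)/(-1)) * (1 - (3*M+2)/(-1+2)) * (1 - 3*M/(-1+3)))) * gA4 M (-1) y) + (-4 * ((1 - (3*M+2)/1) * (1 - 3*M/(1+1)) * (1 + 4/(1+3)))) * gA2 M 1 y = 0 := by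
  have u19 : y + -1 ≠ 0 := by have := hy.of3.add (-1); push_cast at this; simpa using this
  have u21 : y + 1 ≠ 0 := by have := hy.of3.add (1); push_cast at this; simpa using this
  have v15 : 3*y + -5 ≠ 0 := by have := hy.y3 (-5); push_cast at this; simpa using this
  have v19 : 3*y + -1 ≠ 0 := by have := hy.y3 (-1); push_cast at this; simpa using this
  have v21 : 3*y + 1 ≠ 0 := by have := hy.y3 (1); push_cast at this; simpa using this
  have v25 : 3*y + 5 ≠ 0 := by have := hy.y3 (5); push_cast at this; simpa using this
  have q1 : NZ ((-1+y)/2) := by have := b1 hy (-1); push_cast at this; exact this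
  have r1 : ((-1+y)/2)*(((-1+y)/2)+1) = (y + -1)*(y + 1)/4 := by ring
  have q2 : NZ ((-1-y)/2) := by have := b2 hy (-1); push_cast at this; exact this
  have r2 : ((-1-y)/2)*(((-1-y)/2)+1) = (y + 1)*(y + -1)/4 := by ring
  have q3 : NZ ((-1+3*y)/2) := by have := b3 hy (-1); push_cast at this; exact this
  have r3 : ((-1+3*y)/2)*(((-1+3*y)/2)+1) = (3*y + -1)*(3*y + 1)/4 := by ring
  have q4 : NZ ((-1-3*y)/2) := by have := b4 hy (-1); push_cast at this; exact this
  have r4 : ((-1-3*y)/2)*(((-1-3*y)/2)+1) = (3*y + 1)*(3*y + -1)/4 := by ring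
  have q5 : NZ ((1+y)/2) := by have := b1 hy (1); push_cast at this; exact this
  have r5 : ((1+y)/2) = (y + 1)/2 := by ring
  have q6 : NZ ((1-y)/2) := by have := b2 hy (1); push_cast at this; exact this
  have r6 : ((1-y)/2) = -((y + -1)/2) := by ring
  have q7 : NZ ((1+3*y)/2) := by have := b3 hy (1); push_cast at this; exact this
  have r7 : ((1+3*y)/2)*(((1+3*y)/2)+2)*(((1+3*y)/2)-1) = (3*y + 1)*(3*y + 5)*(3*y + -1)/8 := by ring
  have q8 : NZ ((1-3*y)/2) := by have := b4 hy (1); push_cast at this; exact this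
  have r8 : ((1-3*y)/2)*(((1-3*y)/2)+2)*(((1-3*y)/2)-1) = -((3*y + -1)*(3*y + -5)*(3*y + 1)/8) := by ring
  have hm1 := hy.of3.m1
  have hp1 := hy.of3.a1
  unfold gA4 gA2
  rw [h2_e q1, h2_e q2, p22_e q3, p22_e q4, h1_e q5, h1_e q6, p1_e q7, p1_e q8, h0_e hy.of3]
  rw [r1, r2, r3, r4, r7, r8, r5, r6]
  field_simp
  ring

theorem I2 {M y : ℂ} (hy : NZ (3*y)) : -((-(3*M) * (1 - (3*M+2)/(-1))) * gB4 M (-1) y) + (-6 * (1 - 6/(-1-1))) * gAL M 1 y = 0 := by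
  have u19 : y + -1 ≠ 0 := by have := hy.of3.add (-1); push_cast at this; simpa using this
  have u21 : y + 1 ≠ 0 := by have := hy.of3.add (1); push_cast at this; simpa using this
  have v19 : 3*y + -1 ≠ 0 := by have := hy.y3 (-1); push_cast at this; simpa using this
  have v21 : 3*y + 1 ≠ 0 := by have := hy.y3 (1); push_cast at this; simpa using this
  have v23 : 3*y + 3 ≠ 0 := by have := hy.y3 (3); push_cast at this; simpa using this
  have v25 : 3*y + 5 ≠ 0 := by have := hy.y3 (5); push_cast at this; simpa using this
  have q1 : NZ ((-1+3*y)/2) := by have := b3 hy (-1); push_cast at this; exact this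
  have r1 : ((-1+3*y)/2)*(((-1+3*y)/2)+1)*(((-1+3*y)/2)+2)*(((-1+3*y)/2)+3) = (3*y + -1)*(3*y + 1)*(3*y + 3)*(3*y + 5)/16 := by ring
  have q2 : NZ ((-1+y)/2) := by have := b1 hy (-1); push_cast at this; exact this
  have r2 : ((-1+y)/2)*(((-1+y)/2)+1) = (y + -1)*(y + 1)/4 := by ring
  have q3 : NZ ((3*y - -1)/2) := by have := b5 hy (-1); push_cast at this; exact this
  have r3 : ((3*y - -1)/2)*(((3*y - -1)/2)+1) = (3*y + 1)*(3*y + 3)/4 := by ring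
  have q4 : NZ ((1+3*y)/2) := by have := b3 hy (1); push_cast at this; exact this
  have r4 : ((1+3*y)/2)*(((1+3*y)/2)+1)*(((1+3*y)/2)+2) = (3*y + 1)*(3*y + 3)*(3*y + 5)/8 := by ring
  have q5 : NZ ((3*y - 1)/2) := by have := b5 hy (1); push_cast at this; exact this
  have r5 : ((3*y - 1)/2)*(((3*y - 1)/2)+1)*(((3*y - 1)/2)+2) = (3*y + -1)*(3*y + 1)*(3*y + 3)/8 := by ring
  have q6 : NZ ((1+y)/2) := by have := b1 hy (1); push_cast at this; exact this
  have r6 : ((1+y)/2) = (y + 1)/2 := by ring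
  have q7 : NZ ((y - 1)/2) := by have := b6 hy (1); push_cast at this; exact this
  have r7 : ((y - 1)/2) = (y + -1)/2 := by ring
  unfold gB4 gAL
  rw [p4_e q1, h2_e q2, p22_e q3, p3_e q4, p3_e q5, h1_e q6, h1_e q7]
  rw [r1, r2, r3, r4, r5, r6, r7]
  field_simp
  ring

theorem I3 {M y : ℂ} (hy : NZ (3*y)) : (-(3*M-1) * ((1 - (3*M+2)/1) * (1 + 3*M/(1+2)))) * gB2 M 1 y + -((-(3*M+1) * ((1 - (3*M+2)/(-1)) * (1 - 3*M/(-1+2)))) * gBL M (-1) y) = 0 := by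
  have u17 : y + -3 ≠ 0 := by have := hy.of3.add (-3); push_cast at this; simpa using this
  have u19 : y + -1 ≠ 0 := by have := hy.of3.add (-1); push_cast at this; simpa using this
  have u21 : y + 1 ≠ 0 := by have := hy.of3.add (1); push_cast at this; simpa using this
  have v17 : 3*y + -3 ≠ 0 := by have := hy.y3 (-3); push_cast at this; simpa using this
  have v19 : 3*y + -1 ≠ 0 := by have := hy.y3 (-1); push_cast at this; simpa using this
  have v21 : 3*y + 1 ≠ 0 := by have := hy.y3 (1); push_cast at this; simpa using this
  have v23 : 3*y + 3 ≠ 0 := by have := hy.y3 (3); push_cast at this; simpa using this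
  have v27 : 3*y + 7 ≠ 0 := by have := hy.y3 (7); push_cast at this; simpa using this
  have q1 : NZ ((1+3*y)/2) := by have := b3 hy (1); push_cast at this; exact this
  have r1 : ((1+3*y)/2)*(((1+3*y)/2)+1)*(((1+3*y)/2)+3)*(((1+3*y)/2)-1) = (3*y + 1)*(3*y + 3)*(3*y + 7)*(3*y + -1)/16 := by ring
  have q2 : NZ ((y - 1)/2) := by have := b6 hy (1); push_cast at this; exact this
  have r2 : (((y - 1)/2)-1)*(((y - 1)/2)+1) = (y + -3)*(y + 1)/4 := by ring
  have q3 : NZ ((1+y)/2) := by have := b1 hy (1); push_cast at this; exact this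
  have r3 : ((1+y)/2) = (y + 1)/2 := by ring
  have q4 : NZ ((3*y - 1)/2) := by have := b5 hy (1); push_cast at this; exact this
  have r4 : ((3*y - 1)/2)*(((3*y - 1)/2)+2)*(((3*y - 1)/2)-1) = (3*y + -1)*(3*y + 3)*(3*y + -3)/8 := by ring
  have q5 : NZ ((-1+y)/2) := by have := b1 hy (-1); push_cast at this; exact this
  have r5 : ((-1+y)/2)*(((-1+y)/2)+1) = (y + -1)*(y + 1)/4 := by ring
  have q6 : NZ ((-1+3*y)/2) := by have := b3 hy (-1); push_cast at this; exact this
  have r6 : ((-1+3*y)/2)*(((-1+3*y)/2)+1)*(((-1+3*y)/2)+2) = (3*y + -1)*(3*y + 1)*(3*y + 3)/8 := by ring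
  have q7 : NZ ((3*y - -1)/2) := by have := b5 hy (-1); push_cast at this; exact this
  have r7 : (((3*y - -1)/2)-1)*(((3*y - -1)/2)+1) = (3*y + -1)*(3*y + 3)/4 := by ring
  have q8 : NZ ((-1-y)/2) := by have := b2 hy (-1); push_cast at this; exact this
  have r8 : ((-1-y)/2) = -((y + 1)/2) := by ring
  unfold gB2 gBL
  rw [p2_e q1, h0_e q2, h1_e q3, p1_e q4, h2_e q5, p3_e q6, p0_e q7, h1_e q8]
  rw [r1, r2, r4, r5, r6, r7, r3, r8]
  field_simp
  ring

theorem I4 {M y : ℂ} (hy : NZ (3*y)) : -((-(-(3*M)) * ((1 - (3*M+2)/(-2)) * (1 - (3*M-1)/(-2-1)))) * gB2 M (-2) y) + -((-(3*M) * ((1 - (3*M+2)/(-2)) * (1 - (3*M+1)/(-2+1)))) * gBL M (-2) y) = 0 := by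
  have u18 : y + -2 ≠ 0 := by have := hy.of3.add (-2); push_cast at this; simpa using this
  have u20 : y + 0 ≠ 0 := by have := hy.of3.add (0); push_cast at this; simpa using this
  have u22 : y + 2 ≠ 0 := by have := hy.of3.add (2); push_cast at this; simpa using this
  have u24 : y + 4 ≠ 0 := by have := hy.of3.add (4); push_cast at this; simpa using this
  have v16 : 3*y + -4 ≠ 0 := by have := hy.y3 (-4); push_cast at this; simpa using this
  have v18 : 3*y + -2 ≠ 0 := by have := hy.y3 (-2); push_cast at this; simpa using this
  have v20 : 3*y + 0 ≠ 0 := by have := hy.y3 (0); push_cast at this; simpa using this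
  have v22 : 3*y + 2 ≠ 0 := by have := hy.y3 (2); push_cast at this; simpa using this
  have v24 : 3*y + 4 ≠ 0 := by have := hy.y3 (4); push_cast at this; simpa using this
  have v26 : 3*y + 6 ≠ 0 := by have := hy.y3 (6); push_cast at this; simpa using this
  have q1 : NZ ((-2+3*y)/2) := by have := b3 hy (-2); push_cast at this; exact this
  have r1 : ((-2+3*y)/2)*(((-2+3*y)/2)+1)*(((-2+3*y)/2)+3)*(((-2+3*y)/2)-1) = (3*y + -2)*(3*y + 0)*(3*y + 4)*(3*y + -4)/16 := by ring
  have q2 : NZ ((y - -2)/2) := by have := b6 hy (-2); push_cast at this; exact this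
  have r2 : (((y - -2)/2)-1)*(((y - -2)/2)+1) = (y + 0)*(y + 4)/4 := by ring
  have q3 : NZ ((-2+y)/2) := by have := b1 hy (-2); push_cast at this; exact this
  have r3 : ((-2+y)/2) = (y + -2)/2 := by ring
  have q4 : NZ ((3*y - -2)/2) := by have := b5 hy (-2); push_cast at this; exact this
  have r4 : ((3*y - -2)/2)*(((3*y - -2)/2)+2)*(((3*y - -2)/2)-1) = (3*y + 2)*(3*y + 6)*(3*y + 0)/8 := by ring
  have q5 : NZ ((-2+y)/2) := by have := b1 hy (-2); push_cast at this; exact this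
  have r5 : ((-2+y)/2)*(((-2+y)/2)+1) = (y + -2)*(y + 0)/4 := by ring
  have q6 : NZ ((-2+3*y)/2) := by have := b3 hy (-2); push_cast at this; exact this
  have r6 : ((-2+3*y)/2)*(((-2+3*y)/2)+1)*(((-2+3*y)/2)+2) = (3*y + -2)*(3*y + 0)*(3*y + 2)/8 := by ring
  have q7 : NZ ((3*y - -2)/2) := by have := b5 hy (-2); push_cast at this; exact this
  have r7 : (((3*y - -2)/2)-1)*(((3*y - -2)/2)+1) = (3*y + 0)*(3*y + 4)/4 := by ring
  have q8 : NZ ((-2-y)/2) := by have := b2 hy (-2); push_cast at this; exact this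
  have r8 : ((-2-y)/2) = -((y + 2)/2) := by ring
  unfold gB2 gBL
  rw [p2_e q1, h0_e q2, h1_e q3, p1_e q4, h2_e q5, p3_e q6, p0_e q7, h1_e q8]
  rw [r1, r2, r4, r5, r6, r7, r3, r8]
  field_simp
  ring

theorem I5 {M y : ℂ} (hy : NZ (3*y)) : -((-(3*M) * ((1 - (3*M+2)/(-3)) * (1 - 3*M/(-3+1)) * (1 - (3*M+2)/(-3+2)))) * gA4 M (-3) y) + -((-(-4) * ((1 - (3*M+2)/(-3)) * (1 - 3*M/(-3+1)) * (1 - 4/(-3-1)))) * gA2 M (-3) y) = 0 := by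
  have u17 : y + -3 ≠ 0 := by have := hy.of3.add (-3); push_cast at this; simpa using this
  have u19 : y + -1 ≠ 0 := by have := hy.of3.add (-1); push_cast at this; simpa using this
  have u21 : y + 1 ≠ 0 := by have := hy.of3.add (1); push_cast at this; simpa using this
  have u23 : y + 3 ≠ 0 := by have := hy.of3.add (3); push_cast at this; simpa using this
  have v15 : 3*y + -5 ≠ 0 := by have := hy.y3 (-5); push_cast at this; simpa using this
  have v17 : 3*y + -3 ≠ 0 := by have := hy.y3 (-3); push_cast at this; simpa using this
  have v19 : 3*y + -1 ≠ 0 := by have := hy.y3 (-1); push_cast at this; simpa using this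
  have v21 : 3*y + 1 ≠ 0 := by have := hy.y3 (1); push_cast at this; simpa using this
  have v23 : 3*y + 3 ≠ 0 := by have := hy.y3 (3); push_cast at this; simpa using this
  have v25 : 3*y + 5 ≠ 0 := by have := hy.y3 (5); push_cast at this; simpa using this
  have q1 : NZ ((-3+y)/2) := by have := b1 hy (-3); push_cast at this; exact this
  have r1 : ((-3+y)/2)*(((-3+y)/2)+1) = (y + -3)*(y + -1)/4 := by ring
  have q2 : NZ ((-3-y)/2) := by have := b2 hy (-3); push_cast at this; exact this
  have r2 : ((-3-y)/2)*(((-3-y)/2)+1) = (y + 3)*(y + 1)/4 := by ring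
  have q3 : NZ ((-3+3*y)/2) := by have := b3 hy (-3); push_cast at this; exact this
  have r3 : ((-3+3*y)/2)*(((-3+3*y)/2)+1) = (3*y + -3)*(3*y + -1)/4 := by ring
  have q4 : NZ ((-3-3*y)/2) := by have := b4 hy (-3); push_cast at this; exact this
  have r4 : ((-3-3*y)/2)*(((-3-3*y)/2)+1) = (3*y + 3)*(3*y + 1)/4 := by ring
  have q5 : NZ ((-3+y)/2) := by have := b1 hy (-3); push_cast at this; exact this
  have r5 : ((-3+y)/2) = (y + -3)/2 := by ring
  have q6 : NZ ((-3-y)/2) := by have := b2 hy (-3); push_cast at this; exact this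
  have r6 : ((-3-y)/2) = -((y + 3)/2) := by ring
  have q7 : NZ ((-3+3*y)/2) := by have := b3 hy (-3); push_cast at this; exact this
  have r7 : ((-3+3*y)/2)*(((-3+3*y)/2)+2)*(((-3+3*y)/2)-1) = (3*y + -3)*(3*y + 1)*(3*y + -5)/8 := by ring
  have q8 : NZ ((-3-3*y)/2) := by have := b4 hy (-3); push_cast at this; exact this
  have r8 : ((-3-3*y)/2)*(((-3-3*y)/2)+2)*(((-3-3*y)/2)-1) = -((3*y + 3)*(3*y + -1)*(3*y + 5)/8) := by ring
  have hm1 := hy.of3.m1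
  have hp1 := hy.of3.a1
  unfold gA4 gA2
  rw [h2_e q1, h2_e q2, p22_e q3, p22_e q4, h1_e q5, h1_e q6, p1_e q7, p1_e q8, h0_e hy.of3]
  rw [r1, r2, r3, r4, r7, r8, r5, r6]
  field_simp
  ring

end AG2pf

namespace AG2pf
open Filter Topology
def kB4 (M x y : ℂ) : ℂ := (p22 M x * (8)) * (1 * p4 M ((x+3*y)/2) * h2 M ((x+y)/2) * p22 M ((3*y-x)/2))
theorem B4_k (M x y : ℂ) : B4 M x y = h2 M y * kB4 M x y := by unfold B4 gB4 kB4; ring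
def kA2 (M x y : ℂ) : ℂ := (p2 M x * (9*M*(M+1))) * (1 * h1 M ((x+y)/2) * h1 M ((x-y)/2) * p1 M ((x+3*y)/2) * p1 M ((x-3*y)/2))
theorem A2_k (M x y : ℂ) : A2 M x y = h0 y * kA2 M x y := by unfold A2 gA2 kA2; ring
def kB2 (M x y : ℂ) : ℂ := (p1 M x * (9*M*(M+1))) * (1 * p2 M ((x+3*y)/2) * h0 ((y-x)/2) * h1 M ((x+y)/2) * p1 M ((3*y-x)/2))
theorem B2_k (M x y : ℂ) : B2 M x y = h1 M y * kB2 M x y := by unfold B2 gB2 kB2; ring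
def kAL (M x y : ℂ) : ℂ := (p0 x * (3*M*(M+1))) * (1 * p3 M ((x+3*y)/2) * p3 M ((3*y-x)/2) * h1 M ((x+y)/2) * h1 M ((y-x)/2))
theorem AL_k (M x y : ℂ) : AL M x y = h2 M y * kAL M x y := by unfold AL gAL kAL; ring
def kBL (M x y : ℂ) : ℂ := (p3 M x * (3*M*(M+1))) * (1 * h2 M ((x+y)/2) * p3 M ((x+3*y)/2) * p0 ((3*y-x)/2) * h1 M ((x-y)/2))
theorem BL_k (M x y : ℂ) : BL M x y = h1 M y * kBL M x y := by unfold BL gBL kBL; ring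

theorem NZ.half2 {x : ℂ} (hx : NZ x) (k : ℤ) : NZ ((x + k)/2) := by rw [add_comm]; exact hx.half k
theorem c1 {x : ℂ} (hx : NZ x) (k : ℤ) : NZ ((x+(k:ℂ))/2) := hx.half2 k
theorem c2 {x : ℂ} (hx : NZ x) (k : ℤ) : NZ ((x-(k:ℂ))/2) := by simpa [sub_eq_add_neg] using hx.half2 (-k)
theorem c3 {x : ℂ} (hx : NZ x) (k : ℤ) : NZ ((x+3*(k:ℂ))/2) := by simpa using c1 hx (3*k)
theorem c4 {x : ℂ} (hx : NZ x) (k : ℤ) : NZ ((x-3*(k:ℂ))/2) := by simpa using c2 hx (3*k)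
theorem c6 {x : ℂ} (hx : NZ x) (k : ℤ) : NZ (((k:ℂ)-x)/2) := by simpa [sub_eq_add_neg] using hx.neg.half k
theorem c5 {x : ℂ} (hx : NZ x) (k : ℤ) : NZ ((3*(k:ℂ)-x)/2) := by simpa using c6 hx (3*k)

theorem A4_kc {M x : ℂ} (hx : NZ x) (k : ℤ) : ContinuousAt (fun y => A4 M x y) k := by
  refine ContinuousAt.mul continuousAt_const (?_ : ContinuousAt (fun y => gA4 M x y) k)
  exact cm4 8 (cc (AG2pf.h2 M) (fun y => ((x+y)/2)) k (c1 hx k).h2 (by fun_prop)) (cc (AG2pf.h2 M) (fun y => ((x-y)/2)) k (c2 hx k).h2 (by fun_prop)) (cc (AG2pf.p22 M) (fun y => ((x+3*y)/2)) k (c3 hx k).p22 (by fun_prop)) (cc (AG2pf.p22 M) (fun y => ((x-3*y)/2)) k (c4 hx k).p22 (by fun_prop))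
theorem kB4_c {M x : ℂ} (hx : NZ x) (k : ℤ) : ContinuousAt (fun y => kB4 M x y) k := by
  exact cm4 (p22 M x * (8)) continuousAt_const (cc (AG2pf.p4 M) (fun y => ((x+3*y)/2)) k (c3 hx k).p4 (by fun_prop)) (cc (AG2pf.h2 M) (fun y => ((x+y)/2)) k (c1 hx k).h2 (by fun_prop)) (cc (AG2pf.p22 M) (fun y => ((3*y-x)/2)) k (c5 hx k).p22 (by fun_prop))
theorem kA2_c {M x : ℂ} (hx : NZ x) (k : ℤ) : ContinuousAt (fun y => kA2 M x y) k := by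
  exact cm5 (p2 M x * (9*M*(M+1))) continuousAt_const (cc (AG2pf.h1 M) (fun y => ((x+y)/2)) k (c1 hx k).h1 (by fun_prop)) (cc (AG2pf.h1 M) (fun y => ((x-y)/2)) k (c2 hx k).h1 (by fun_prop)) (cc (AG2pf.p1 M) (fun y => ((x+3*y)/2)) k (c3 hx k).p1 (by fun_prop)) (cc (AG2pf.p1 M) (fun y => ((x-3*y)/2)) k (c4 hx k).p1 (by fun_prop))
theorem kB2_c {M x : ℂ} (hx : NZ x) (k : ℤ) : ContinuousAt (fun y => kB2 M x y) k := by
  exact cm5 (p1 M x * (9*M*(M+1))) continuousAt_const (cc (AG2pf.p2 M) (fun y => ((x+3*y)/2)) k (c3 hx k).p2 (by fun_prop)) (cc (AG2pf.h0) (fun y => ((y-x)/2)) k (c6 hx k).h0 (by fun_prop)) (cc (AG2pf.h1 M) (fun y => ((x+y)/2)) k (c1 hx k).h1 (by fun_prop)) (cc (AG2pf.p1 M) (fun y => ((3*y-x)/2)) k (c5 hx k).p1 (by fun_prop))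
theorem kAL_c {M x : ℂ} (hx : NZ x) (k : ℤ) : ContinuousAt (fun y => kAL M x y) k := by
  exact cm5 (p0 x * (3*M*(M+1))) continuousAt_const (cc (AG2pf.p3 M) (fun y => ((x+3*y)/2)) k (c3 hx k).p3 (by fun_prop)) (cc (AG2pf.p3 M) (fun y => ((3*y-x)/2)) k (c5 hx k).p3 (by fun_prop)) (cc (AG2pf.h1 M) (fun y => ((x+y)/2)) k (c1 hx k).h1 (by fun_prop)) (cc (AG2pf.h1 M) (fun y => ((y-x)/2)) k (c6 hx k).h1 (by fun_prop))
theorem kBL_c {M x : ℂ} (hx : NZ x) (k : ℤ) : ContinuousAt (fun y => kBL M x y) k := by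
  exact cm5 (p3 M x * (3*M*(M+1))) continuousAt_const (cc (AG2pf.h2 M) (fun y => ((x+y)/2)) k (c1 hx k).h2 (by fun_prop)) (cc (AG2pf.p3 M) (fun y => ((x+3*y)/2)) k (c3 hx k).p3 (by fun_prop)) (cc (AG2pf.p0) (fun y => ((3*y-x)/2)) k (c5 hx k).p0 (by fun_prop)) (cc (AG2pf.h1 M) (fun y => ((x-y)/2)) k (c2 hx k).h1 (by fun_prop))
end AG2pf

namespace AG2pf
open Filter Topology

theorem I6 {M x : ℂ} (hx : NZ x) : -((-M * (1 - M/(-1))) * kB4 M x (-1)) + (-(2/3) * (1 - (2/3)/(-1-1))) * kA2 M x 1 = 0 := by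
  have v0 := hx.a0; have v1 := hx.a1; have v3 := hx.a3; have m1 := hx.m1
  have m3 : x + -3 ≠ 0 := by have := hx.add (-3); push_cast at this; exact this
  have m5 : x + -5 ≠ 0 := by have := hx.add (-5); push_cast at this; exact this
  have v7 : x + 7 ≠ 0 := by have := hx.add 7; push_cast at this; exact this
  have q1 : NZ ((x+3*(-1))/2) := by have := c3 hx (-1); push_cast at this; exact this
  have q2 : NZ ((x+(-1))/2) := by have := c1 hx (-1); push_cast at this; exact this
  have q3 : NZ ((3*(-1)-x)/2) := by have := c5 hx (-1); push_cast at this; exact this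
  have w1 : NZ ((x+1)/2) := by have := c1 hx 1; push_cast at this; exact this
  have w2 : NZ ((x-1)/2) := by have := c2 hx 1; push_cast at this; exact this
  have w3 : NZ ((x+3*1)/2) := by have := c3 hx 1; push_cast at this; exact this
  have w4 : NZ ((x-3*1)/2) := by have := c4 hx 1; push_cast at this; exact this
  unfold kB4 kA2
  rw [p22_e hx, p4_e q1, h2_e q2, p22_e q3, p2_e hx, h1_e w1, h1_e w2, p1_e w3, p1_e w4]
  have r1 : (x+3*(-1))/2 * ((x+3*(-1))/2+1) * ((x+3*(-1))/2+2) * ((x+3*(-1))/2+3) = (x+ -3)*(x-1)*(x+1)*(x+3)/16 := by ring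
  have r2 : (x+(-1))/2 * ((x+(-1))/2+1) = (x-1)*(x+1)/4 := by ring
  have r3 : (3*(-1)-x)/2 * ((3*(-1)-x)/2+1) = (x+3)*(x+1)/4 := by ring
  have r4 : (x+3*1)/2 * ((x+3*1)/2+2) * ((x+3*1)/2-1) = (x+3)*(x+7)*(x+1)/8 := by ring
  have r5 : (x-3*1)/2 * ((x-3*1)/2+2) * ((x-3*1)/2-1) = (x+ -3)*(x+1)*(x+ -5)/8 := by ring
  rw [r1, r2, r3, r4, r5]
  field_simp
  ring

theorem Rs_mull {a g : ℂ → ℂ} {k r : ℂ} (h : Rs a k r) (hg : ContinuousAt g k) : Rs (fun x => a x * g x) k (r * g k) := Rs_mul h hg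

theorem Rs_alla {M x : ℂ} (hx : NZ x) (k : ℤ) {a2 b2 a1 b1 a0 : ℂ}
    (A2' : Rs (h2 M) k a2) (B2' : Rs (h2 M) (-k) b2) 
    (A1' : Rs (h1 M) k a1) (B1' : Rs (h1 M) (-k) b1)
    (A0' : Rs h0 k a0) (i : Fin 18) :
    Rs (fun y => cf M i x y) k
    ((![0, 0, a2 * kB4 M x k, a2 * kB4 M (-x) k, -(b2 * kB4 M x (-k)), -(b2 * kB4 M (-x) (-k)),
    a0 * kA2 M x k, a0 * kA2 M (-x) k, a1 * kB2 M x k, a1 * kB2 M (-x) k, -(b1 * kB2 M x (-k)), -(b1 * kB2 M (-x) (-k)),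
    a2 * kAL M x k, -(b2 * kAL M x (-k)), a1 * kBL M x k, a1 * kBL M (-x) k, -(b1 * kBL M x (-k)), -(b1 * kBL M (-x) (-k))] : Fin 18 → ℂ) i) := by
  have hx' : NZ (-x) := hx.neg
  have nk : ((-k : ℤ) : ℂ) = -(k:ℂ) := by push_cast; rfl
  have B (x : ℂ) (hx : NZ x) : Rs (fun y => B4 M x y) k (a2 * kB4 M x k) := by
    simp only [B4_k]; exact Rs_mul (g := fun y => kB4 M x y) A2' (kB4_c hx k)
  have B' (x : ℂ) (hx : NZ x) : Rs (fun y => B4 M x (-y)) k (-(b2 * kB4 M x (-k))) := by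
    have q := kB4_c (M := M) hx (-k); rw [nk] at q
    refine Rs_neg (a := fun y => B4 M x y) ?_
    simp only [B4_k]; exact Rs_mul (g := fun y => kB4 M x y) B2' q
  have A (x : ℂ) (hx : NZ x) : Rs (fun y => A2 M x y) k (a0 * kA2 M x k) := by
    simp only [A2_k]; exact Rs_mul (g := fun y => kA2 M x y) A0' (kA2_c hx k)
  have C (x : ℂ) (hx : NZ x) : Rs (fun y => B2 M x y) k (a1 * kB2 M x k) := by
    simp only [B2_k]; exact Rs_mul (g := fun y => kB2 M x y) A1' (kB2_c hx k)
  have C' (x : ℂ) (hx : NZ x) : Rs (fun y => B2 M x (-y)) k (-(b1 * kB2 M x (-k))) := by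
    have q := kB2_c (M := M) hx (-k); rw [nk] at q
    refine Rs_neg (a := fun y => B2 M x y) ?_
    simp only [B2_k]; exact Rs_mul (g := fun y => kB2 M x y) B1' q
  have L (x : ℂ) (hx : NZ x) : Rs (fun y => AL M x y) k (a2 * kAL M x k) := by
    simp only [AL_k]; exact Rs_mul (g := fun y => kAL M x y) A2' (kAL_c hx k)
  have L' (x : ℂ) (hx : NZ x) : Rs (fun y => AL M x (-y)) k (-(b2 * kAL M x (-k))) := by
    have q := kAL_c (M := M) hx (-k); rw [nk] at q
    refine Rs_neg (a := fun y => AL M x y) ?_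
    simp only [AL_k]; exact Rs_mul (g := fun y => kAL M x y) B2' q
  have K (x : ℂ) (hx : NZ x) : Rs (fun y => BL M x y) k (a1 * kBL M x k) := by
    simp only [BL_k]; exact Rs_mul (g := fun y => kBL M x y) A1' (kBL_c hx k)
  have K' (x : ℂ) (hx : NZ x) : Rs (fun y => BL M x (-y)) k (-(b1 * kBL M x (-k))) := by
    have q := kBL_c (M := M) hx (-k); rw [nk] at q
    refine Rs_neg (a := fun y => BL M x y) ?_
    simp only [BL_k]; exact Rs_mul (g := fun y => kBL M x y) B1' q
  have Z (x : ℂ) (hx : NZ x) : Rs (fun y => A4 M x y) k 0 := Rs_cont (A4_kc hx k)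
  fin_cases i
  exacts [Z x hx, Z (-x) hx', B x hx, B (-x) hx', B' x hx, B' (-x) hx', A x hx, A (-x) hx', C x hx, C (-x) hx', C' x hx, C' (-x) hx',
    L x hx, L' x hx, K x hx, K (-x) hx', K' x hx, K' (-x) hx']
end AG2pf

namespace AG2pf
open Filter Topology

def Res (a : Fin 18 → ℂ → ℂ) (d e : Fin 18 → ℂ) (S : ℕ → Prop) (k y : ℂ) : Prop :=
  ∃ R : Fin 18 → ℂ, (∀ i, Rs (a i) k (R i)) ∧ ∀ P : ℂ → ℂ → ℂ, (∀ j : ℕ, S j → ∀ y, P j y = P (-j) y) →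
    ∑ i, R i * (P (k + d i) (y + e i) - P k y) = 0

def SB (m : ℕ) (j : ℕ) : Prop := (1 ≤ j ∧ j ≤ 3*m) ∨ j = 3*m+2
def SA (m : ℕ) (j : ℕ) : Prop := 1 ≤ j ∧ j ≤ m

theorem sum18 (f : Fin 18 → ℂ) : ∑ i, f i = f 0 + f 1 + f 2 + f 3 + f 4 + f 5 + f 6 + f 7 + f 8 + f 9 + f 10 + f 11 + f 12 + f 13
    + f 14 + f 15 + f 16 + f 17 := by
  simp only [Fin.sum_univ_castSucc, Fin.sum_univ_zero, zero_add]; rfl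

theorem sumB (r0 r1 r2 r3 r4 r5 r6 r7 r8 r9 r10 r11 r12 r13 r14 r15 r16 r17 : ℂ) (P : ℂ → ℂ → ℂ) (k y : ℂ)
   {c4 d4 c2 d2 c1 d1 c3 d3 : ℂ} (h4 : c4 = k + 4) (g4 : d4 = k + -4) (h2 : c2 = k + 2) (g2 : d2 = k + -2) (h1 : c1 = k + 1) (g1 : d1 = k + -1)
   (h3 : c3 = k + 3) (g3 : d3 = k + -3) :
    ∑ i, (![r0, r1, r2, r3, r4, r5, r6, r7, r8, r9, r10, r11, r12, r13, r14, r15, r16, r17] : Fin 18 → ℂ) i *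
      (P (k + dX i) (y + dY i) - P k y)
   = r0 * (P c4 y - P k y) + r1 * (P d4 y - P k y) + r2 * (P c2 (y+2) - P k y) + r3 * (P d2 (y+2) - P k y)
   + r4 * (P c2 (y+ -2) - P k y) + r5 * (P d2 (y+ -2) - P k y) + r6 * (P c2 y - P k y) + r7 * (P d2 y - P k y)
   + r8 * (P c1 (y+1) - P k y) + r9 * (P d1 (y+1) - P k y) + r10 * (P c1 (y+ -1) - P k y) + r11 * (P d1 (y+ -1) - P k y)
   + r12 * (P k (y+2) - P k y) + r13 * (P k (y+ -2) - P k y)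
   + r14 * (P c3 (y+1) - P k y) + r15 * (P d3 (y+1) - P k y) + r16 * (P c3 (y+ -1) - P k y) + r17 * (P d3 (y+ -1) - P k y) := by
  subst h4 g4 h2 g2 h1 g1 h3 g3
  rw [sum18]
  change r0 * (P (k+4) (y+0) - P k y) + r1 * (P (k+ -4) (y+0) - P k y) + r2 * (P (k+2) (y+2) - P k y) + r3 * (P (k+ -2) (y+2) - P k y)
   + r4 * (P (k+2) (y+ -2) - P k y) + r5 * (P (k+ -2) (y+ -2) - P k y) + r6 * (P (k+2) (y+0) - P k y) + r7 * (P (k+ -2) (y+0) - P k y)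
   + r8 * (P (k+1) (y+1) - P k y) + r9 * (P (k+ -1) (y+1) - P k y) + r10 * (P (k+1) (y+ -1) - P k y) + r11 * (P (k+ -1) (y+ -1) - P k y)
   + r12 * (P (k+0) (y+2) - P k y) + r13 * (P (k+0) (y+ -2) - P k y)
   + r14 * (P (k+3) (y+1) - P k y) + r15 * (P (k+ -3) (y+1) - P k y) + r16 * (P (k+3) (y+ -1) - P k y) + r17 * (P (k+ -3) (y+ -1) - P k y) = _
  simp only [add_zero]

theorem Rs_all' {M y κ κ' : ℂ} (hy : NZ (3*y)) (k : ℤ) (hk : κ = k) (hk' : κ' = -κ) {a4 b4 a22 b22 a2 b2 a1 b1 a3 b3 a0 : ℂ}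
    (A4 : Rs (p4 M) κ a4) (B4 : Rs (p4 M) κ' b4) (A22 : Rs (p22 M) κ a22) (B22 : Rs (p22 M) κ' b22)
    (A2 : Rs (p2 M) κ a2) (B2 : Rs (p2 M) κ' b2) (A1 : Rs (p1 M) κ a1) (B1 : Rs (p1 M) κ' b1)
    (A3 : Rs (p3 M) κ a3) (B3 : Rs (p3 M) κ' b3) (A0 : Rs p0 κ a0) (i : Fin 18) :
    Rs (fun x => cf M i x y) κ
    ((![a4 * gA4 M κ y, -(b4 * gA4 M κ' y), a22 * gB4 M κ y, -(b22 * gB4 M κ' y), a22 * gB4 M κ (-y), -(b22 * gB4 M κ' (-y)),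
    a2 * gA2 M κ y, -(b2 * gA2 M κ' y), a1 * gB2 M κ y, -(b1 * gB2 M κ' y), a1 * gB2 M κ (-y), -(b1 * gB2 M κ' (-y)),
    a0 * gAL M κ y, a0 * gAL M κ (-y), a3 * gBL M κ y, -(b3 * gBL M κ' y), a3 * gBL M κ (-y), -(b3 * gBL M κ' (-y))] : Fin 18 → ℂ) i) := by
  subst hk'; subst hk
  exact Rs_all hy k A4 B4 A22 B22 A2 B2 A1 B1 A3 B3 A0 i

theorem neg3 {y : ℂ} (hy : NZ (3*y)) : NZ (3 * (-y)) := by rw [mul_neg]; exact hy.neg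

theorem ResB0 {m : ℕ} (hm : 1 ≤ m) {y : ℂ} (hy : NZ (3*y)) : Res (fun i x => cf m i x y) dX dY (SB m) 0 y := by
  refine ⟨_, Rs_all' (κ' := 0) hy 0 (by norm_num) (by norm_num) (p4_r0 m) (p4_r0 m) (p22_r0 m) (p22_r0 m) (p2_r0 m) (p2_r0 m) (p1_r0 m) (p1_r0 m)
    (p3_r0 m) (p3_r0 m) (Rs_cont (p0_cont (by norm_num) (by norm_num))), ?_⟩
  intro P hP
  have h1 := hP 1 (Or.inl (by omega))
  have h2 := hP 2 (Or.inl (by omega))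
  have h3 := hP 3 (Or.inl (by omega))
  push_cast at h1 h2 h3
  have h4 : (1 - 3*(m:ℂ)/(0+3)) * (P 4 y - P (-4) y) = 0 := by
    rcases Nat.lt_or_ge 1 m with h | h
    · have := hP 4 (Or.inl (by omega)) y
      push_cast at this; rw [this]; ring
    · have : m = 1 := by omega
      subst this; norm_num
  rw [sumB _ _ _ _ _ _ _ _ _ _ _ _ _ _ _ _ _ _ P 0 y (c4 := 4) (d4 := -4) (c2 := 2) (d2 := -2) (c1 := 1) (d1 := -1) (c3 := 3) (d3 := -3) 
    (by norm_num) (by norm_num) (by norm_num) (by norm_num) (by norm_num) (by norm_num) (by norm_num) (by norm_num)]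
  rw [h1, h2, h3, h1, h2, h3, h2]
  linear_combination (-(3*(m:ℂ)+2) * ((1 - 3*(m:ℂ)/(0+1)) * (1 - (3*(m:ℂ)+2)/(0+2)))) * gA4 m 0 y * h4

theorem ResB1 {m : ℕ} (hm : 1 ≤ m) {y : ℂ} (hy : NZ (3*y)) : Res (fun i x => cf m i x y) dX dY (SB m) 1 y := by
  refine ⟨_, Rs_all' (κ' := -1) hy 1 (by norm_num) (by norm_num)
    (Rs_cont (p4_cont (by norm_num) (by norm_num) (by norm_num) (by norm_num))) (p4_r1 m)
    (Rs_cont (p22_cont (by norm_num) (by norm_num))) (p22_r1 m) (p2_rp m) (p2_r1 m)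
    (p1_rp m) (Rs_cont (p1_cont (by norm_num) (by norm_num) (by norm_num)))
    (Rs_cont (p3_cont (by norm_num) (by norm_num) (by norm_num))) (p3_r1 m) p0_rp, ?_⟩
  intro P hP
  have h1 := hP 1 (Or.inl (by omega))
  have h2 := hP 2 (Or.inl (by omega))
  have h3 := hP 3 (Or.inl (by omega))
  push_cast at h1 h2 h3
  rw [sumB _ _ _ _ _ _ _ _ _ _ _ _ _ _ _ _ _ _ P 1 y (c4 := 5) (d4 := -3) (c2 := 3) (d2 := -1) (c1 := 2) (d1 := 0) (c3 := 4) (d3 := -2) 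
    (by norm_num) (by norm_num) (by norm_num) (by norm_num) (by norm_num) (by norm_num) (by norm_num) (by norm_num)]
  simp only [← h1, ← h2, ← h3]
  linear_combination (P 3 y - P 1 y) * I1 (M := m) hy + (P 1 (y+2) - P 1 y) * I2 (M := m) hy + (P 1 (y+ -2) - P 1 y) * I2 (M := m) (neg3 hy)
    + (P 2 (y+1) - P 1 y) * I3 (M := m) hy + (P 2 (y+ -1) - P 1 y) * I3 (M := m) (neg3 hy)

theorem ResB2 {m : ℕ} (hm : 1 ≤ m) {y : ℂ} (hy : NZ (3*y)) : Res (fun i x => cf m i x y) dX dY (SB m) 2 y := by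
  refine ⟨_, Rs_all' (κ' := -2) hy 2 (by norm_num) (by norm_num)
    (Rs_cont (p4_cont (by norm_num) (by norm_num) (by norm_num) (by norm_num))) (p4_r2 m)
    (Rs_cont (p22_cont (by norm_num) (by norm_num))) (Rs_cont (p22_cont (by norm_num) (by norm_num)))
    (Rs_cont (p2_cont (by norm_num) (by norm_num) (by norm_num) (by norm_num))) (Rs_cont (p2_cont (by norm_num) (by norm_num) (by norm_num) (by norm_num)))
    (Rs_cont (p1_cont (by norm_num) (by norm_num) (by norm_num))) (p1_r2 m)
    (Rs_cont (p3_cont (by norm_num) (by norm_num) (by norm_num))) (p3_r2 m) (Rs_cont (p0_cont (by norm_num) (by norm_num))), ?_⟩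
  intro P hP
  have h1 := hP 1 (Or.inl (by omega))
  have h2 := hP 2 (Or.inl (by omega))
  push_cast at h1 h2
  rw [sumB _ _ _ _ _ _ _ _ _ _ _ _ _ _ _ _ _ _ P 2 y (c4 := 6) (d4 := -2) (c2 := 4) (d2 := 0) (c1 := 3) (d1 := 1) (c3 := 5) (d3 := -1) 
    (by norm_num) (by norm_num) (by norm_num) (by norm_num) (by norm_num) (by norm_num) (by norm_num) (by norm_num)]
  simp only [← h1, ← h2]
  linear_combination (P 1 (y+1) - P 2 y) * I4 (M := m) hy + (P 1 (y+ -1) - P 2 y) * I4 (M := m) (neg3 hy)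

theorem ResB3 {m : ℕ} (hm : 1 ≤ m) {y : ℂ} (hy : NZ (3*y)) : Res (fun i x => cf m i x y) dX dY (SB m) 3 y := by
  refine ⟨_, Rs_all' (κ' := -3) hy 3 (by norm_num) (by norm_num)
    (Rs_cont (p4_cont (by norm_num) (by norm_num) (by norm_num) (by norm_num))) (p4_r3 m)
    (Rs_cont (p22_cont (by norm_num) (by norm_num))) (Rs_cont (p22_cont (by norm_num) (by norm_num)))
    (Rs_cont (p2_cont (by norm_num) (by norm_num) (by norm_num) (by norm_num))) (p2_r3 m)
    (Rs_cont (p1_cont (by norm_num) (by norm_num) (by norm_num))) (Rs_cont (p1_cont (by norm_num) (by norm_num) (by norm_num)))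
    (Rs_cont (p3_cont (by norm_num) (by norm_num) (by norm_num))) (Rs_cont (p3_cont (by norm_num) (by norm_num) (by norm_num)))
    (Rs_cont (p0_cont (by norm_num) (by norm_num))), ?_⟩
  intro P hP
  have h1 := hP 1 (Or.inl (by omega))
  push_cast at h1
  rw [sumB _ _ _ _ _ _ _ _ _ _ _ _ _ _ _ _ _ _ P 3 y (c4 := 7) (d4 := -1) (c2 := 5) (d2 := 1) (c1 := 4) (d1 := 2) (c3 := 6) (d3 := 0) 
    (by norm_num) (by norm_num) (by norm_num) (by norm_num) (by norm_num) (by norm_num) (by norm_num) (by norm_num)]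
  simp only [← h1]
  linear_combination (P 1 y - P 3 y) * I5 (M := m) hy

/-- integer nonvanishing -/
theorem zne {z : ℂ} (n : ℤ) (h : z = n) (hn : n ≠ 0) : z ≠ 0 := by rw [h]; exact_mod_cast hn

theorem ResB4 {m : ℕ} {y : ℂ} (hy : NZ (3*y)) (n : ℕ) (hn : 4 ≤ n) : Res (fun i x => cf m i x y) dX dY (SB m) n y := by
  have hp (j : ℤ) (hj : -4 < j) : (n:ℂ) + j ≠ 0 := zne (n + j) (by push_cast; ring) (by omega)
  have hq (j : ℤ) (hj : j < 4) : -(n:ℂ) + j ≠ 0 := zne (-n + j) (by push_cast; ring) (by omega)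
  have a0 : (n:ℂ) ≠ 0 := by simpa using hp 0 (by norm_num)
  have a1 : (n:ℂ) + 1 ≠ 0 := by simpa using hp 1 (by norm_num)
  have a2 : (n:ℂ) + 2 ≠ 0 := by simpa using hp 2 (by norm_num)
  have a3 : (n:ℂ) + 3 ≠ 0 := by simpa using hp 3 (by norm_num)
  have a4 : (n:ℂ) - 1 ≠ 0 := by simpa [sub_eq_add_neg] using hp (-1) (by norm_num)
  have b0 : -(n:ℂ) ≠ 0 := by simpa using hq 0 (by norm_num)
  have b1 : -(n:ℂ) + 1 ≠ 0 := by simpa using hq 1 (by norm_num)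
  have b2 : -(n:ℂ) + 2 ≠ 0 := by simpa using hq 2 (by norm_num)
  have b3 : -(n:ℂ) + 3 ≠ 0 := by simpa using hq 3 (by norm_num)
  have b4 : -(n:ℂ) - 1 ≠ 0 := by simpa [sub_eq_add_neg] using hq (-1) (by norm_num)
  refine ⟨_, Rs_all' (κ' := -n) hy n (by norm_num) (by norm_num)
    (Rs_cont (p4_cont a0 a1 a2 a3)) (Rs_cont (p4_cont b0 b1 b2 b3))
    (Rs_cont (p22_cont a0 a1)) (Rs_cont (p22_cont b0 b1)) (Rs_cont (p2_cont a0 a1 a3 a4)) (Rs_cont (p2_cont b0 b1 b3 b4))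
    (Rs_cont (p1_cont a0 a2 a4)) (Rs_cont (p1_cont b0 b2 b4)) (Rs_cont (p3_cont a0 a1 a2)) (Rs_cont (p3_cont b0 b1 b2))
    (Rs_cont (p0_cont a4 b4)), ?_⟩
  intro P hP
  rw [sumB _ _ _ _ _ _ _ _ _ _ _ _ _ _ _ _ _ _ P n y rfl rfl rfl rfl rfl rfl rfl rfl]
  ring

theorem ResB {m : ℕ} (hm : 1 ≤ m) {y : ℂ} (hy : NZ (3*y)) (n : ℕ) : Res (fun i x => cf m i x y) dX dY (SB m) n y := by
  rcases Nat.lt_or_ge n 4 with h | h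
  · interval_cases n
    · simpa using ResB0 hm hy
    · simpa using ResB1 hm hy
    · simpa using ResB2 hm hy
    · simpa using ResB3 hm hy
  · exact ResB4 hy n h
end AG2pf

namespace AG2pf
open Filter Topology

theorem sumA (r0 r1 r2 r3 r4 r5 r6 r7 r8 r9 r10 r11 r12 r13 r14 r15 r16 r17 : ℂ) (P : ℂ → ℂ → ℂ) (k y : ℂ)
   {c2 d2 c1 d1 : ℂ} (h2 : c2 = k + 2) (g2 : d2 = k + -2) (h1 : c1 = k + 1) (g1 : d1 = k + -1) :
    ∑ i, (![r0, r1, r2, r3, r4, r5, r6, r7, r8, r9, r10, r11, r12, r13, r14, r15, r16, r17] : Fin 18 → ℂ) i *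
      (P (k + dY i) (y + dX i) - P k y)
   = r0 * (P k (y+4) - P k y) + r1 * (P k (y+ -4) - P k y) + r2 * (P c2 (y+2) - P k y) + r3 * (P c2 (y+ -2) - P k y)
   + r4 * (P d2 (y+2) - P k y) + r5 * (P d2 (y+ -2) - P k y) + r6 * (P k (y+2) - P k y) + r7 * (P k (y+ -2) - P k y)
   + r8 * (P c1 (y+1) - P k y) + r9 * (P c1 (y+ -1) - P k y) + r10 * (P d1 (y+1) - P k y) + r11 * (P d1 (y+ -1) - P k y)
   + r12 * (P c2 y - P k y) + r13 * (P d2 y - P k y)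
   + r14 * (P c1 (y+3) - P k y) + r15 * (P c1 (y+ -3) - P k y) + r16 * (P d1 (y+3) - P k y) + r17 * (P d1 (y+ -3) - P k y) := by
  subst h2 g2 h1 g1
  rw [sum18]
  change r0 * (P (k+0) (y+4) - P k y) + r1 * (P (k+0) (y+ -4) - P k y) + r2 * (P (k+2) (y+2) - P k y) + r3 * (P (k+2) (y+ -2) - P k y)
   + r4 * (P (k+ -2) (y+2) - P k y) + r5 * (P (k+ -2) (y+ -2) - P k y) + r6 * (P (k+0) (y+2) - P k y) + r7 * (P (k+0) (y+ -2) - P k y)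
   + r8 * (P (k+1) (y+1) - P k y) + r9 * (P (k+1) (y+ -1) - P k y) + r10 * (P (k+ -1) (y+1) - P k y) + r11 * (P (k+ -1) (y+ -1) - P k y)
   + r12 * (P (k+2) (y+0) - P k y) + r13 * (P (k+ -2) (y+0) - P k y)
   + r14 * (P (k+1) (y+3) - P k y) + r15 * (P (k+1) (y+ -3) - P k y) + r16 * (P (k+ -1) (y+3) - P k y) + r17 * (P (k+ -1) (y+ -3) - P k y) = _
  simp only [add_zero]

theorem Rs_alla' {M x κ κ' : ℂ} (hx : NZ x) (k : ℤ) (hk : κ = k) (hk' : κ' = -κ) {a2 b2 a1 b1 a0 : ℂ}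
    (A2' : Rs (h2 M) κ a2) (B2' : Rs (h2 M) κ' b2) 
    (A1' : Rs (h1 M) κ a1) (B1' : Rs (h1 M) κ' b1)
    (A0' : Rs h0 κ a0) (i : Fin 18) :
    Rs (fun y => cf M i x y) κ
    ((![0, 0, a2 * kB4 M x κ, a2 * kB4 M (-x) κ, -(b2 * kB4 M x κ'), -(b2 * kB4 M (-x) κ'),
    a0 * kA2 M x κ, a0 * kA2 M (-x) κ, a1 * kB2 M x κ, a1 * kB2 M (-x) κ, -(b1 * kB2 M x κ'), -(b1 * kB2 M (-x) κ'),
    a2 * kAL M x κ, -(b2 * kAL M x κ'), a1 * kBL M x κ, a1 * kBL M (-x) κ, -(b1 * kBL M x κ'), -(b1 * kBL M (-x) κ')] : Fin 18 → ℂ) i) := by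
  subst hk'; subst hk
  exact Rs_alla hx k A2' B2' A1' B1' A0' i

theorem ResA0 {m : ℕ} (hm : 1 ≤ m) {x : ℂ} (hx : NZ x) : Res (fun i y => cf m i x y) dY dX (SA m) 0 x := by
  refine ⟨_, Rs_alla' (κ' := 0) hx 0 (by norm_num) (by norm_num) (h2_r0 m) (h2_r0 m) (h1_r0 m) (h1_r0 m)
    (Rs_cont (h0_cont (by norm_num) (by norm_num))), ?_⟩
  intro P hP
  have h1 := hP 1 (by unfold SA; omega)
  push_cast at h1
  have h4 (u : ℂ) : (1 - (m:ℂ)/(0+1)) * (P 2 u - P (-2) u) = 0 := by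
    rcases Nat.lt_or_ge 1 m with h | h
    · have := hP 2 (by unfold SA; omega) u
      push_cast at this; rw [this]; ring
    · have : m = 1 := by omega
      subst this; norm_num
  rw [sumA _ _ _ _ _ _ _ _ _ _ _ _ _ _ _ _ _ _ P 0 x (c2 := 2) (d2 := -2) (c1 := 1) (d1 := -1)
    (by norm_num) (by norm_num) (by norm_num) (by norm_num)]
  simp only [← h1]
  linear_combination (-(m:ℂ)) * kB4 m x 0 * h4 (x+2) + (-(m:ℂ)) * kB4 m (-x) 0 * h4 (x+ -2) + (-(m:ℂ)) * kAL m x 0 * h4 x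

theorem ResA1 {m : ℕ} (hm : 1 ≤ m) {x : ℂ} (hx : NZ x) : Res (fun i y => cf m i x y) dY dX (SA m) 1 x := by
  refine ⟨_, Rs_alla' (κ' := -1) hx 1 (by norm_num) (by norm_num) (Rs_cont (h2_cont (by norm_num) (by norm_num))) (h2_r1 m)
    (Rs_cont (h1_cont (by norm_num))) (Rs_cont (h1_cont (by norm_num))) h0_rp, ?_⟩
  intro P hP
  have h1 := hP 1 (by unfold SA; omega)
  push_cast at h1
  rw [sumA _ _ _ _ _ _ _ _ _ _ _ _ _ _ _ _ _ _ P 1 x (c2 := 3) (d2 := -1) (c1 := 2) (d1 := 0)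
    (by norm_num) (by norm_num) (by norm_num) (by norm_num)]
  simp only [← h1]
  linear_combination (P 1 (x+2) - P 1 x) * I6 (M := m) hx + (P 1 (x+ -2) - P 1 x) * I6 (M := m) hx.neg

theorem ResA2 {m : ℕ} {x : ℂ} (hx : NZ x) (n : ℕ) (hn : 2 ≤ n) : Res (fun i y => cf m i x y) dY dX (SA m) n x := by
  have hp (j : ℤ) (hj : -2 < j) : (n:ℂ) + j ≠ 0 := zne (n + j) (by push_cast; ring) (by omega)
  have hq (j : ℤ) (hj : j < 2) : -(n:ℂ) + j ≠ 0 := zne (-n + j) (by push_cast; ring) (by omega)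
  have a0 : (n:ℂ) ≠ 0 := by simpa using hp 0 (by norm_num)
  have a1 : (n:ℂ) + 1 ≠ 0 := by simpa using hp 1 (by norm_num)
  have a4 : (n:ℂ) - 1 ≠ 0 := by simpa [sub_eq_add_neg] using hp (-1) (by norm_num)
  have b0 : -(n:ℂ) ≠ 0 := by simpa using hq 0 (by norm_num)
  have b1 : -(n:ℂ) + 1 ≠ 0 := by simpa using hq 1 (by norm_num)
  have b4 : -(n:ℂ) - 1 ≠ 0 := by simpa [sub_eq_add_neg] using hq (-1) (by norm_num)
  refine ⟨_, Rs_alla' (κ' := -n) hx n (by norm_num) (by norm_num)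
    (Rs_cont (h2_cont a0 a1)) (Rs_cont (h2_cont b0 b1))
    (Rs_cont (h1_cont a0)) (Rs_cont (h1_cont b0)) 
    (Rs_cont (h0_cont a4 b4)), ?_⟩
  intro P hP
  rw [sumA _ _ _ _ _ _ _ _ _ _ _ _ _ _ _ _ _ _ P n x rfl rfl rfl rfl]
  ring

theorem ResA {m : ℕ} (hm : 1 ≤ m) {x : ℂ} (hx : NZ x) (n : ℕ) : Res (fun i y => cf m i x y) dY dX (SA m) n x := by
  rcases Nat.lt_or_ge n 2 with h | h
  · interval_cases n
    · simpa using ResA0 hm hx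
    · simpa using ResA1 hm hx
  · exact ResA2 hx n h
end AG2pf

namespace AG2pf
open Filter Topology

def Hit (S : ℕ → Prop) (s d : ℂ) : Prop := ∃ j : ℕ, (j = 0 ∨ S j) ∧ (s + d = j ∨ s + d = -j)

def Zr (a : Fin 18 → ℂ → ℂ) (d : Fin 18 → ℂ) (S : ℕ → Prop) (s : ℂ) : Prop :=
  ∀ i, Hit S s (d i) ∨ (ContinuousAt (a i) s ∧ a i s = 0)

theorem hit_of {S : ℕ → Prop} {s : ℕ} (d : ℤ) {D : ℂ} (hD : D = d) (h : (s + d).natAbs = 0 ∨ S (s+d).natAbs) :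
    Hit S s D := by
  refine ⟨_, h, ?_⟩
  subst hD
  rcases Int.natAbs_eq ((s:ℤ) + d) with h | h
  · left
    have : (((s:ℤ) + d : ℤ) : ℂ) = (((((s:ℤ) + d).natAbs : ℕ) : ℤ) : ℂ) := by rw [← h]
    rw [Int.cast_natCast] at this; push_cast [-Int.natCast_natAbs] at this; exact this
  · right
    have : (((s:ℤ) + d : ℤ) : ℂ) = ((-(((s:ℤ) + d).natAbs : ℤ) : ℤ) : ℂ) := by rw [← h]
    rw [Int.cast_neg, Int.cast_natCast] at this; push_cast [-Int.natCast_natAbs] at this; exact this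

theorem oz {c f : ℂ} (h : c = f) (hf : f ≠ 0) : 1 - c / f = 0 := by subst h; rw [div_self hf, sub_self]

theorem prodz {a g : ℂ → ℂ} {s : ℂ} (ha : ContinuousAt a s) (h0 : a s = 0) (hg : ContinuousAt g s) :
    ContinuousAt (fun x => a x * g x) s ∧ a s * g s = 0 := ⟨ha.mul hg, by rw [h0, zero_mul]⟩

theorem ZrB {m : ℕ} (hm : 1 ≤ m) {y : ℂ} (hy : NZ (3*y)) (s : ℕ) (hs : SB m s) : Zr (fun i x => cf m i x y) dX (SB m) s := by
  have s1 : 1 ≤ s := by unfold SB at hs; omega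
  have hp (j : ℤ) (hj : -1 < j) : (s:ℂ) + j ≠ 0 := zne (s + j) (by push_cast; ring) (by omega)
  have a0 : (s:ℂ) ≠ 0 := by simpa using hp 0 (by norm_num)
  have a1 : (s:ℂ) + 1 ≠ 0 := by simpa using hp 1 (by norm_num)
  have a2 : (s:ℂ) + 2 ≠ 0 := by simpa using hp 2 (by norm_num)
  have a3 : (s:ℂ) + 3 ≠ 0 := by simpa using hp 3 (by norm_num)
  have cs (n : ℕ) (t : ℕ) (h : s + t = 3*m + n) : 3*(m:ℂ) + n = s + t := by exact_mod_cast h.symm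
  -- p4
  have z4 : Hit (SB m) s (4) ∨ (ContinuousAt (p4 m) s ∧ p4 m s = 0) := by
    by_cases h : ((s:ℤ) + 4).natAbs = 0 ∨ SB m ((s:ℤ) + 4).natAbs
    · exact Or.inl (hit_of 4 (by norm_num) h)
    · right
      refine ⟨p4_cont a0 a1 a2 a3, ?_⟩
      unfold SB at h hs
      have : s = 3*m+2 ∨ s + 1 = 3*m ∨ s + 2 = 3*m+2 ∨ s + 3 = 3*m := by omega
      unfold p4
      rcases this with h | h | h | h
      · rw [oz (by have := cs 2 0 h; push_cast at this; linear_combination this) a0]; ring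
      · rw [oz (f := (s:ℂ)+1) (by have := cs 0 1 h; push_cast at this; linear_combination this) a1]; ring
      · rw [oz (f := (s:ℂ)+2) (by have := cs 2 2 h; push_cast at this; linear_combination this) a2]; ring
      · rw [oz (f := (s:ℂ)+3) (by have := cs 0 3 h; push_cast at this; linear_combination this) a3]; ring
  have z2 : Hit (SB m) s (2) ∨
      ((ContinuousAt (p22 m) s ∧ p22 m s = 0) ∧ (ContinuousAt (p2 m) s ∧ p2 m s = 0)) := by
    by_cases h : ((s:ℤ) + 2).natAbs = 0 ∨ SB m ((s:ℤ) + 2).natAbs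
    · exact Or.inl (hit_of 2 (by norm_num) h)
    · right
      unfold SB at h hs
      have : s = 3*m+2 ∨ s + 1 = 3*m := by omega
      have a4 : (s:ℂ) - 1 ≠ 0 := zne (s - 1) (by push_cast; ring) (by omega)
      refine ⟨⟨p22_cont a0 a1, ?_⟩, p2_cont a0 a1 a3 a4, ?_⟩
      · unfold p22
        rcases this with h | h
        · rw [oz (by have := cs 2 0 h; push_cast at this; linear_combination this) a0]; ring
        · rw [oz (f := (s:ℂ)+1) (by have := cs 0 1 h; push_cast at this; linear_combination this) a1]; ring
      · unfold p2
        rcases this with h | h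
        · rw [oz (by have := cs 2 0 h; push_cast at this; linear_combination this) a0]; ring
        · rw [oz (f := (s:ℂ)+1) (by have := cs 0 1 h; push_cast at this; linear_combination this) a1]; ring
  have z1 : Hit (SB m) s (1) ∨ (ContinuousAt (p1 m) s ∧ p1 m s = 0) := by
    by_cases h : ((s:ℤ) + 1).natAbs = 0 ∨ SB m ((s:ℤ) + 1).natAbs
    · exact Or.inl (hit_of 1 (by norm_num) h)
    · right
      unfold SB at h hs
      have : s = 3*m+2 ∨ s = 3*m := by omega
      have a4 : (s:ℂ) - 1 ≠ 0 := zne (s - 1) (by push_cast; ring) (by omega)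
      refine ⟨p1_cont a0 a2 a4, ?_⟩
      unfold p1
      rcases this with h | h
      · rw [oz (by have := cs 2 0 h; push_cast at this; linear_combination this) a0]; ring
      · rw [oz (f := (s:ℂ)-1) (by have := cs 0 0 h; push_cast at this; linear_combination this) a4]; ring
  have y1 : Hit (SB m) s (-1) ∨ 
      (ContinuousAt (fun x => p1 m (-x)) s ∧ p1 m (-s) = 0) := by
    by_cases h : ((s:ℤ) + -1).natAbs = 0 ∨ SB m ((s:ℤ) + -1).natAbs
    · exact Or.inl (hit_of (-1) (by norm_num) h)
    · right
      unfold SB at h hs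
      have : s = 3*m+2 := by omega
      have b0 : -(s:ℂ) ≠ 0 := neg_ne_zero.2 a0
      have b2 : -(s:ℂ) + 2 ≠ 0 := zne (-s + 2) (by push_cast; ring) (by omega)
      have b4 : -(s:ℂ) - 1 ≠ 0 := zne (-s - 1) (by push_cast; ring) (by omega)
      refine ⟨cc (p1 m) (fun x => -x) s (p1_cont b0 b2 b4) (by fun_prop), ?_⟩
      unfold p1
      have e : 1 + 3*(m:ℂ)/(-(s:ℂ)+2) = 0 := by
        have e1 : -(s:ℂ)+2 = -(3*(m:ℂ)) := by subst this; push_cast; ring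
        rw [e1] at b2 ⊢
        rw [div_neg, div_self (by simpa using b2)]; ring
      rw [e]; ring
  have z3 : Hit (SB m) s (3) ∨ (ContinuousAt (p3 m) s ∧ p3 m s = 0) := by
    by_cases h : ((s:ℤ) + 3).natAbs = 0 ∨ SB m ((s:ℤ) + 3).natAbs
    · exact Or.inl (hit_of 3 (by norm_num) h)
    · right
      unfold SB at h hs
      have : s = 3*m+2 ∨ s + 1 = 3*m + 1 ∨ s + 2 = 3*m := by omega
      refine ⟨p3_cont a0 a1 a2, ?_⟩
      unfold p3
      rcases this with h | h | h
      · rw [oz (by have := cs 2 0 h; push_cast at this; linear_combination this) a0]; ring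
      · rw [oz (f := (s:ℂ)+1) (by have := cs 1 1 h; push_cast at this; linear_combination this) a1]; ring
      · rw [oz (f := (s:ℂ)+2) (by have := cs 0 2 h; push_cast at this; linear_combination this) a2]; ring
  have n4 := hit_of (S := SB m) (s := s) (-4) (D := -4) (by norm_num) (by unfold SB at hs ⊢; omega)
  have n3 := hit_of (S := SB m) (s := s) (-3) (D := -3) (by norm_num) (by unfold SB at hs ⊢; omega)
  have n2 := hit_of (S := SB m) (s := s) (-2) (D := -2) (by norm_num) (by unfold SB at hs ⊢; omega)
  have n0 := hit_of (S := SB m) (s := s) 0 (D := 0) (by norm_num) (by unfold SB at hs ⊢; omega)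
  have hy' := neg3 hy
  have nn : (((-(s:ℤ)) : ℤ) : ℂ) = -(s:ℂ) := by push_cast; rfl
  have nc (y : ℂ) (hy : NZ (3*y)) : ContinuousAt (fun x => gB2 m (-x) y) s := by
    have q := gB2_c (M := m) hy (-(s:ℤ)); rw [nn] at q
    exact cc (fun x => gB2 m x y) (fun x => -x) s q (by fun_prop)
  have q1 := gA4_c (M := m) hy s
  have q2 := gB4_c (M := m) hy s
  have q3 := gB4_c (M := m) hy' s
  have q4 := gA2_c (M := m) hy s
  have q5 := gB2_c (M := m) hy s
  have q6 := gB2_c (M := m) hy' s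
  have q7 := gBL_c (M := m) hy s
  have q8 := gBL_c (M := m) hy' s
  rw [Int.cast_natCast] at q1 q2 q3 q4 q5 q6 q7 q8
  intro i
  fin_cases i
  · exact z4.imp id fun h => prodz (g := fun x => gA4 m x y) h.1 h.2 q1
  · exact Or.inl n4
  · exact z2.imp id fun h => prodz (g := fun x => gB4 m x y) h.1.1 h.1.2 q2
  · exact Or.inl n2
  · exact z2.imp id fun h => prodz (g := fun x => gB4 m x (-y)) h.1.1 h.1.2 q3
  · exact Or.inl n2
  · exact z2.imp id fun h => prodz (g := fun x => gA2 m x y) h.2.1 h.2.2 q4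
  · exact Or.inl n2
  · exact z1.imp id fun h => prodz (g := fun x => gB2 m x y) h.1 h.2 q5
  · exact y1.imp id fun h => prodz (g := fun x => gB2 m (-x) y) h.1 h.2 (nc _ hy)
  · exact z1.imp id fun h => prodz (g := fun x => gB2 m x (-y)) h.1 h.2 q6
  · exact y1.imp id fun h => prodz (g := fun x => gB2 m (-x) (-y)) h.1 h.2 (nc _ hy')
  · exact Or.inl n0
  · exact Or.inl n0
  · exact z3.imp id fun h => prodz (g := fun x => gBL m x y) h.1 h.2 q7
  · exact Or.inl n3
  · exact z3.imp id fun h => prodz (g := fun x => gBL m x (-y)) h.1 h.2 q8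
  · exact Or.inl n3

theorem ZrA {m : ℕ} {x : ℂ} (hx : NZ x) (s : ℕ) (hs : SA m s) : Zr (fun i y => cf m i x y) dY (SA m) s := by
  have s1 : 1 ≤ s := hs.1
  have a0 : (s:ℂ) ≠ 0 := zne s (by push_cast; ring) (by omega)
  have a1 : (s:ℂ) + 1 ≠ 0 := zne (s+1) (by push_cast; ring) (by omega)
  have z2 : Hit (SA m) s (2) ∨ (ContinuousAt (h2 m) s ∧ h2 m s = 0) := by
    by_cases h : ((s:ℤ) + 2).natAbs = 0 ∨ SA m ((s:ℤ) + 2).natAbs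
    · exact Or.inl (hit_of 2 (by norm_num) h)
    · right
      unfold SA at h hs
      have : m = s ∨ m = s + 1 := by omega
      refine ⟨h2_cont a0 a1, ?_⟩
      unfold h2
      rcases this with h | h
      · rw [oz (by rw [h]) a0]; ring
      · rw [oz (f := (s:ℂ)+1) (by rw [h]; push_cast; ring) a1]; ring
  have z1 : Hit (SA m) s (1) ∨ (ContinuousAt (h1 m) s ∧ h1 m s = 0) := by
    by_cases h : ((s:ℤ) + 1).natAbs = 0 ∨ SA m ((s:ℤ) + 1).natAbs
    · exact Or.inl (hit_of 1 (by norm_num) h)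
    · right
      unfold SA at h hs
      have : m = s := by omega
      refine ⟨h1_cont a0, ?_⟩
      unfold h1
      rw [oz (by rw [this]) a0]
  have n1 := hit_of (S := SA m) (s := s) (-1) (D := -1) (by norm_num) (by unfold SA at hs ⊢; omega)
  have n2 := hit_of (S := SA m) (s := s) (-2) (D := -2) (by norm_num) (by unfold SA at hs ⊢; omega)
  have n0 := hit_of (S := SA m) (s := s) 0 (D := 0) (by norm_num) (by unfold SA at hs ⊢; omega)
  have B (x : ℂ) (hx : NZ x) (h : ContinuousAt (h2 m) s ∧ h2 m s = 0) : ContinuousAt (fun y => B4 m x y) s ∧ B4 m x s = 0 := by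
    have q := kB4_c (M := m) hx s; rw [Int.cast_natCast] at q
    simp only [B4_k]; exact prodz (g := fun y => kB4 m x y) h.1 h.2 q
  have L (x : ℂ) (hx : NZ x) (h : ContinuousAt (h2 m) s ∧ h2 m s = 0) : ContinuousAt (fun y => AL m x y) s ∧ AL m x s = 0 := by
    have q := kAL_c (M := m) hx s; rw [Int.cast_natCast] at q
    simp only [AL_k]; exact prodz (g := fun y => kAL m x y) h.1 h.2 q
  have C (x : ℂ) (hx : NZ x) (h : ContinuousAt (h1 m) s ∧ h1 m s = 0) : ContinuousAt (fun y => B2 m x y) s ∧ B2 m x s = 0 := by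
    have q := kB2_c (M := m) hx s; rw [Int.cast_natCast] at q
    simp only [B2_k]; exact prodz (g := fun y => kB2 m x y) h.1 h.2 q
  have K (x : ℂ) (hx : NZ x) (h : ContinuousAt (h1 m) s ∧ h1 m s = 0) : ContinuousAt (fun y => BL m x y) s ∧ BL m x s = 0 := by
    have q := kBL_c (M := m) hx s; rw [Int.cast_natCast] at q
    simp only [BL_k]; exact prodz (g := fun y => kBL m x y) h.1 h.2 q
  intro i
  fin_cases i
  · exact Or.inl n0
  · exact Or.inl n0
  · exact z2.imp id (B x hx)
  · exact z2.imp id (B (-x) hx.neg)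
  · exact Or.inl n2
  · exact Or.inl n2
  · exact Or.inl n0
  · exact Or.inl n0
  · exact z1.imp id (C x hx)
  · exact z1.imp id (C (-x) hx.neg)
  · exact Or.inl n1
  · exact Or.inl n1
  · exact z2.imp id (L x hx)
  · exact Or.inl n2
  · exact z1.imp id (K x hx)
  · exact z1.imp id (K (-x) hx.neg)
  · exact Or.inl n1
  · exact Or.inl n1
end AG2pf

namespace AG2pf
open Filter Topology

theorem T1 {a : Fin 18 → ℂ → ℂ} {d e : Fin 18 → ℂ} {S : ℕ → Prop} {k y : ℂ} (hR : Res a d e S k y) (P : ℂ → ℂ → ℂ)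
    (hc : ∀ y, Continuous (fun x => P x y)) (hP : ∀ j : ℕ, S j → ∀ y, P j y = P (-j) y) :
    Tendsto (fun t => t * ∑ i, a i (k+t) * (P (k+t+d i) (y+e i) - P (k+t) y)) (𝓝[≠] 0) (𝓝 0) := by
  obtain ⟨R, h1, h2⟩ := hR
  have E := h2 P hP
  suffices H : Tendsto (fun t => t * ∑ i, a i (k+t) * (P (k+t+d i) (y+e i) - P (k+t) y)) (𝓝[≠] 0)
      (𝓝 (∑ i, R i * (P (k + d i) (y + e i) - P k y))) by rwa [E] at H
  have : (fun t => t * ∑ i, a i (k+t) * (P (k+t+d i) (y+e i) - P (k+t) y)) =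
      fun t => ∑ i, (t * a i (k+t)) * (P (k+t+d i) (y+e i) - P (k+t) y) := by
    funext t; rw [Finset.mul_sum]; exact Finset.sum_congr rfl fun i _ => by ring
  rw [this]
  refine tendsto_finsetSum _ fun i _ => (h1 i).mul ?_
  refine tendsto_nhdsWithin_of_tendsto_nhds ?_
  have c1 : Continuous (fun t => P (k+t+d i) (y+e i) - P (k+t) y) :=
    ((hc (y+e i)).comp (g := fun x => P x (y + e i)) (f := fun t => k+t+d i) (by fun_prop)).sub
     ((hc y).comp (g := fun x => P x y) (f := fun t => k+t) (by fun_prop))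
  have := c1.tendsto 0
  simpa using this

theorem odd_deriv {f : ℂ → ℂ} (hf : ∀ x, f (-x) = - f x) (x : ℂ) : deriv f x = deriv f (-x) := by
  have h := deriv_comp_neg f x
  have e : (fun x => f (-x)) = fun x => - f x := funext hf
  rw [e, deriv.fun_neg] at h
  exact neg_injective h

theorem T2 {a : Fin 18 → ℂ → ℂ} {d e : Fin 18 → ℂ} {S : ℕ → Prop} {s : ℕ} {y : ℂ} (hR : Res a d e S s y) (hZ : Zr a d S s) (hs : S s)
    (P : ℂ → ℂ → ℂ) (hodd : ∀ x y, P (-x) y = - P x y)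
    (hd : ∀ y, Differentiable ℂ (fun x => P x y)) (hP : ∀ j : ℕ, S j → ∀ y, P j y = 0) :
    Tendsto (fun t => ∑ i, a i (s+t) * (P (s+t+d i) (y+e i) - P (s+t) y)) (𝓝[≠] 0) (𝓝 0) := by
  obtain ⟨R, h1, h2⟩ := hR
  have h0 (y : ℂ) : P 0 y = 0 := by
    have := hodd 0 y
    rw [neg_zero] at this
    linear_combination (1/2) * this
  have E := h2 (fun x y => deriv (fun x => P x y) x) (fun j _ y => odd_deriv (fun x => hodd x y) j)
  suffices H : Tendsto (fun t => ∑ i, a i (s+t) * (P (s+t+d i) (y+e i) - P (s+t) y)) (𝓝[≠] 0)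
      (𝓝 (∑ i, R i * (deriv (fun x => P x (y+e i)) (s + d i) - deriv (fun x => P x y) s))) by rwa [E] at H
  refine tendsto_finsetSum _ fun i _ => ?_
  have hder : HasDerivAt (fun t => P (s+t+d i) (y+e i) - P (s+t) y)
      (deriv (fun x => P x (y+e i)) (s + d i) - deriv (fun x => P x y) s) 0 := by
    have e1 : HasDerivAt (fun x => P x (y+e i)) (deriv (fun x => P x (y+e i)) (s + d i)) (0 + (s + d i)) := by
      rw [zero_add]; exact (hd _ _).hasDerivAt
    have e2 : HasDerivAt (fun x => P x y) (deriv (fun x => P x y) s) (0 + s) := by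
      rw [zero_add]; exact (hd _ _).hasDerivAt
    have f1 := e1.comp_add_const 0 (s + d i)
    have f2 := e2.comp_add_const (0:ℂ) (s:ℂ)
    have := f1.sub f2
    refine this.congr_of_eventuallyEq (Eventually.of_forall fun t => ?_)
    change P (s+t+d i) (y+e i) - P (s+t) y = P (t + (s + d i)) (y + e i) - P (t + s) y
    rw [add_comm t (s:ℂ), show t + (s + d i) = s + t + d i by ring]
  rcases hZ i with ⟨j, hj, hj'⟩ | ⟨hc, hz⟩
  · have g1 : P (s + d i) (y + e i) = 0 := by
      have hj0 : P j (y + e i) = 0 := by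
        rcases hj with rfl | hj
        · simpa using h0 _
        · exact hP j hj _
      rcases hj' with h | h
      · rw [h, hj0]
      · rw [h, hodd, hj0, neg_zero]
    have g2 : P s y = 0 := hP s hs y
    have sl := hasDerivAt_iff_tendsto_slope.1 hder
    have := (h1 i).mul sl
    refine this.congr' ?_
    filter_upwards [self_mem_nhdsWithin] with t ht
    have ht : t ≠ 0 := ht
    rw [slope_def_field]
    simp only [add_zero, g1, g2, sub_zero]
    field_simp
  · have hR0 : R i = 0 := tendsto_nhds_unique (h1 i) (Rs_cont hc)
    rw [hR0, zero_mul]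
    have c1 : Tendsto (fun t => a i (s + t)) (𝓝[≠] 0) (𝓝 0) := by
      have := hc.tendsto
      rw [hz] at this
      refine this.comp ?_
      refine tendsto_nhdsWithin_of_tendsto_nhds ?_
      have : Continuous (fun t : ℂ => (s:ℂ) + t) := by fun_prop
      simpa using this.tendsto 0
    have c2 := (hder.continuousAt.tendsto).mono_left (nhdsWithin_le_nhds (s := {0}ᶜ))
    simpa using c1.mul c2
end AG2pf

namespace AG2pf
open Filter Topology

theorem pt_split (x y u v : ℂ) : pt x y + pt u v = pt (x+u) (y+v) := by
  ext i; fin_cases i <;> simp [pt]; ring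
theorem smul_β₁ (s : ℂ) : s • vβ₁ = pt s 0 := by
  ext i; fin_cases i <;> simp [pt, vβ₁]
theorem smul_α₁ (s : ℂ) : s • vα₁ = pt 0 s := by
  ext i; fin_cases i <;> simp [pt, vα₁]; ring

theorem pt_analytic (z : ℂ × ℂ) : AnalyticAt ℂ (fun z : ℂ × ℂ => pt z.1 z.2) z := by
  have hL : ∃ L : ℂ × ℂ →ₗ[ℂ] V2, ∀ z, L z = pt z.1 z.2 :=
    ⟨{ toFun := fun z => pt z.1 z.2
       map_add' := fun a b => (pt_split _ _ _ _).symm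
       map_smul' := fun c a => by ext i; fin_cases i <;> simp [pt]; ring }, fun z => rfl⟩
  obtain ⟨L, hL⟩ := hL
  have := L.toContinuousLinearMap.analyticAt z
  exact this.congr (Eventually.of_forall fun z => hL z)

theorem pt_diff_x {p : V2 → ℂ} (hp : ∀ z, AnalyticAt ℂ p z) (y : ℂ) : Differentiable ℂ (fun x => p (pt x y)) := by
  intro x
  have h1 : AnalyticAt ℂ (fun x : ℂ => (x, y)) x := AnalyticAt.prod analyticAt_id analyticAt_const
  have h2 : AnalyticAt ℂ (fun z : ℂ × ℂ => p (pt z.1 z.2)) (x, y) := (hp _).comp (f := fun z : ℂ × ℂ => pt z.1 z.2) (pt_analytic _)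
  exact (h2.comp (f := fun x : ℂ => (x, y)) h1).differentiableAt
theorem pt_diff_y {p : V2 → ℂ} (hp : ∀ z, AnalyticAt ℂ p z) (x : ℂ) : Differentiable ℂ (fun y => p (pt x y)) := by
  intro y
  have h1 : AnalyticAt ℂ (fun y : ℂ => (x, y)) y := AnalyticAt.prod analyticAt_const analyticAt_id
  have h2 : AnalyticAt ℂ (fun z : ℂ × ℂ => p (pt z.1 z.2)) (x, y) := (hp _).comp (f := fun z : ℂ × ℂ => pt z.1 z.2) (pt_analytic _)
  exact (h2.comp (f := fun y : ℂ => (x, y)) h1).differentiableAt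

theorem QI_pt_x {m : ℕ} {p : V2 → ℂ} (h : QuasiInvAG2 m p) (j : ℕ) (hj : SB m j) (y : ℂ) : p (pt j y) = p (pt (-j) y) := by
  have := h.2 vβ₁ (by simp) j hj (pt 0 y) (by rw [zβ₁])
  rw [sub_eq_add_neg, ← neg_smul, smul_β₁, smul_β₁, pt_split, pt_split] at this
  simpa using this
theorem QI_pt_y {m : ℕ} {p : V2 → ℂ} (h : QuasiInvAG2 m p) (j : ℕ) (hj : SA m j) (x : ℂ) : p (pt x j) = p (pt x (-j)) := by
  have := h.1 vα₁ (by simp) j hj.1 hj.2 (pt x 0) (by rw [zα₁, zero_mul])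
  rw [sub_eq_add_neg, ← neg_smul, smul_α₁, smul_α₁, pt_split, pt_split] at this
  simpa using this

theorem LB {m : ℕ} (hm : 1 ≤ m) {p : V2 → ℂ} (hp : RaAG2 m p) {y : ℂ} (hy : NZ (3*y)) (n : ℕ) :
    Tendsto (fun t => t * applyD2 m p (pt (n+t) y)) (𝓝[≠] 0) (𝓝 0) := by
  have := T1 (ResB hm hy n) (fun x y => p (pt x y)) (fun y => (pt_diff_x hp.1 y).continuous) (fun j hj y => QI_pt_x hp.2 j hj y)
  refine this.congr fun t => ?_
  rw [applyD2_pt]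
theorem LA {m : ℕ} (hm : 1 ≤ m) {p : V2 → ℂ} (hp : RaAG2 m p) {x : ℂ} (hx : NZ x) (n : ℕ) :
    Tendsto (fun t => t * applyD2 m p (pt x (n+t))) (𝓝[≠] 0) (𝓝 0) := by
  have := T1 (ResA hm hx n) (fun y x => p (pt x y)) (fun y => (pt_diff_y hp.1 y).continuous) (fun j hj y => QI_pt_y hp.2 j hj y)
  refine this.congr fun t => ?_
  rw [applyD2_pt]

theorem half_zero {a b : ℂ} (h : a = b) (h' : b = -a) : a = 0 := by linear_combination (1/2) * h + (1/2) * h'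

theorem QB {m : ℕ} (hm : 1 ≤ m) {p : V2 → ℂ} (hp : RaAG2 m p) (hodd : ∀ z, p (refx z) = - p z) {y : ℂ} (hy : NZ (3*y)) (s : ℕ) (hs : SB m s) :
    Tendsto (fun t => applyD2 m p (pt (s+t) y)) (𝓝[≠] 0) (𝓝 0) := by
  have ho : ∀ x y, p (pt (-x) y) = - p (pt x y) := fun x y => by rw [← refx_pt, hodd]
  have := T2 (ResB hm hy s) (ZrB hm hy s hs) hs (fun x y => p (pt x y)) ho (fun y => pt_diff_x hp.1 y)
    (fun j hj y => half_zero (QI_pt_x hp.2 j hj y) (ho _ _))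
  refine this.congr fun t => ?_
  rw [applyD2_pt]
theorem QA {m : ℕ} (hm : 1 ≤ m) {p : V2 → ℂ} (hp : RaAG2 m p) (hodd : ∀ z, p (refy z) = - p z) {x : ℂ} (hx : NZ x) (s : ℕ) (hs : SA m s) :
    Tendsto (fun t => applyD2 m p (pt x (s+t))) (𝓝[≠] 0) (𝓝 0) := by
  have ho : ∀ y x, p (pt x (-y)) = - p (pt x y) := fun y x => by rw [← refy_pt, hodd]
  have := T2 (ResA hm hx s) (ZrA hx s hs) hs (fun y x => p (pt x y)) ho (fun y => pt_diff_y hp.1 y)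
    (fun j hj y => half_zero (QI_pt_y hp.2 j hj y) (ho _ _))
  refine this.congr fun t => ?_
  rw [applyD2_pt]

/-! regular points -/
theorem affine_ev (a b : ℂ) (h : b ≠ 0 ∨ a ≠ 0) : ∀ᶠ t in 𝓝[≠] (0:ℂ), a + b * t ≠ 0 := by
  by_cases ha : a = 0
  · subst ha
    have hb : b ≠ 0 := by tauto
    filter_upwards [self_mem_nhdsWithin] with t ht
    rw [zero_add]; exact mul_ne_zero hb ht
  · have : ContinuousAt (fun t : ℂ => a + b * t) 0 := by fun_prop
    exact (this.eventually_ne (by simpa using ha)).filter_mono nhdsWithin_le_nhds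

theorem reg_of_ev {f : ℂ → V2} (h : ∀ γ ∈ G2plus, ∃ a b : ℂ, (∀ t, bil γ (f t) = a + b * t) ∧
    (b ≠ 0 ∨ ∀ j : ℤ, a ≠ j * bil γ γ)) : ∀ᶠ t in 𝓝[≠] (0:ℂ), D2Reg (f t) := by
  have key (γ) (hγ : γ ∈ G2plus) (j : ℤ) : ∀ᶠ t in 𝓝[≠] (0:ℂ), bil γ (f t) ≠ j * bil γ γ := by
    obtain ⟨a, b, h1, h2⟩ := h γ hγ
    have := affine_ev (a - j * bil γ γ) b (h2.imp id fun h => sub_ne_zero.2 (h j))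
    filter_upwards [this] with t ht
    intro e
    apply ht
    rw [h1] at e
    linear_combination e
  have k2 (γ) (hγ : γ ∈ G2plus) : ∀ᶠ t in 𝓝[≠] (0:ℂ), bil γ (f t) ≠ 0 ∧ bil γ (f t) ≠ bil γ γ ∧ bil γ (f t) ≠ -bil γ γ ∧
    bil γ (f t) ≠ 2 * bil γ γ ∧ bil γ (f t) ≠ -(2 * bil γ γ) ∧
    bil γ (f t) ≠ 3 * bil γ γ ∧ bil γ (f t) ≠ -(3 * bil γ γ) := by
    filter_upwards [key γ hγ 0, key γ hγ 1, key γ hγ (-1), key γ hγ 2, key γ hγ (-2), key γ hγ 3, key γ hγ (-3)] with t h0 h1 h2 h3 h4 h5 h6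
    push_cast at h0 h1 h2 h3 h4 h5 h6
    simp only [zero_mul, one_mul, neg_mul] at h0 h1 h2 h3 h4 h5 h6
    exact ⟨h0, h1, h2, h3, h4, h5, h6⟩
  simp only [G2plus, List.forall_mem_cons] at k2
  obtain ⟨a1, a2, a3, b1, b2, b3, -⟩ := k2
  filter_upwards [a1, a2, a3, b1, b2, b3] with t h1 h2 h3 h4 h5 h6
  unfold D2Reg G2plus
  simp only [List.forall_mem_cons]
  exact ⟨h1, h2, h3, h4, h5, h6, by simp⟩

theorem reg_x (k : ℂ) {y : ℂ} (hy : NZ (3*y)) : ∀ᶠ t in 𝓝[≠] (0:ℂ), D2Reg (pt (k+t) y) := by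
  apply reg_of_ev
  simp only [G2plus, List.forall_mem_cons]
  refine ⟨⟨y*3, 0, ?_, Or.inr fun j => ?_⟩, ⟨(y-k)/2*3, -(3/2), ?_, Or.inl (by norm_num)⟩, ⟨(k+y)/2*3, 3/2, ?_, Or.inl (by norm_num)⟩,
    ⟨k, 1, ?_, Or.inl (by norm_num)⟩, ⟨(k+3*y)/2, 1/2, ?_, Or.inl (by norm_num)⟩, ⟨(3*y-k)/2, -(1/2), ?_, Or.inl (by norm_num)⟩, by simp⟩
  · intro t; rw [zα₁]; ring
  · rw [bsα₁]; intro e; exact hy (3*j) (by push_cast; linear_combination e)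
  · intro t; rw [zα₂]; ring
  · intro t; rw [zα₃]; ring
  · intro t; rw [zβ₁]; ring
  · intro t; rw [zβ₂]; ring
  · intro t; rw [zβ₃]; ring

theorem reg_y (k : ℂ) {x : ℂ} (hx : NZ x) : ∀ᶠ t in 𝓝[≠] (0:ℂ), D2Reg (pt x (k+t)) := by
  apply reg_of_ev
  simp only [G2plus, List.forall_mem_cons]
  refine ⟨⟨k*3, 3, ?_, Or.inl (by norm_num)⟩, ⟨(k-x)/2*3, 3/2, ?_, Or.inl (by norm_num)⟩, ⟨(x+k)/2*3, 3/2, ?_, Or.inl (by norm_num)⟩,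
    ⟨x, 0, ?_, Or.inr fun j => ?_⟩, ⟨(x+3*k)/2, 3/2, ?_, Or.inl (by norm_num)⟩, ⟨(3*k-x)/2, 3/2, ?_, Or.inl (by norm_num)⟩, by simp⟩
  · intro t; rw [zα₁]; ring
  · intro t; rw [zα₂]; ring
  · intro t; rw [zα₃]; ring
  · intro t; rw [zβ₁]; ring
  · rw [bsβ₁, mul_one]; exact hx j
  · intro t; rw [zβ₂]; ring
  · intro t; rw [zβ₃]; ring

theorem NZ_dense : Dense {y : ℂ | NZ y} := by
  have : {y : ℂ | NZ y} = (Set.range (fun n : ℤ => (n:ℂ)))ᶜ := by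
    ext y; simp [NZ, eq_comm]
  rw [this]
  exact (Set.countable_range _).dense_compl ℂ
theorem NZ3_dense : Dense {y : ℂ | NZ (3*y)} := by
  have : {y : ℂ | NZ (3*y)} = (Set.range (fun n : ℤ => (n:ℂ)/3))ᶜ := by
    ext y
    simp only [NZ, Set.mem_ofPred_eq, Set.mem_compl_iff, Set.mem_range, not_exists]
    refine forall_congr' fun n => not_congr ⟨fun h => by rw [← h]; ring, fun h => by rw [← h]; ring⟩
  rw [this]
  exact (Set.countable_range _).dense_compl ℂ
end AG2pf

namespace AG2pf
open Filter Topology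

theorem Sym.one : Sym (1 : Module.End ℂ V2) := ⟨fun _ _ => rfl, by
  show (shortRoots.map id).Perm _
  rw [List.map_id], by
  show (longRoots.map id).Perm _
  rw [List.map_id]⟩
theorem Sym.mul {v w : Module.End ℂ V2} (hv : Sym v) (hw : Sym w) : Sym (v * w) := by
  refine ⟨fun a b => ?_, ?_, ?_⟩
  · rw [Module.End.mul_apply, Module.End.mul_apply, hv.bil, hw.bil]
  · refine List.Perm.trans (List.Perm.of_eq ?_) ((hw.sh.map v).trans hv.sh)
    rw [List.map_map]; rfl
  · refine List.Perm.trans (List.Perm.of_eq ?_) ((hw.lg.map v).trans hv.lg)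
    rw [List.map_map]; rfl
abbrev rotE : Module.End ℂ V2 := rot
theorem rot_pow_sym (k : ℕ) : Sym (rotE ^ k) := by
  induction k with
  | zero => rw [pow_zero]; exact Sym.one
  | succ k ih => rw [pow_succ]; exact ih.mul rot_sym

theorem rot3 (z : V2) : rot (rot (rot z)) = -z := by
  have h := rt3_sq
  ext i; fin_cases i <;> simp [rot, lin2]
  · linear_combination (-(3/8) * z 0 + rt3 / 8 * z 1) * h
  · linear_combination (-(3/8) * z 1 - rt3 / 8 * z 0) * h
theorem rot6 : rotE ^ 6 = 1 := by
  apply LinearMap.ext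
  intro z
  show rot (rot (rot (rot (rot (rot z))))) = z
  rw [rot3, rot3, neg_neg]

structure Pair (w w' : V2 →ₗ[ℂ] V2) : Prop where
  s : Sym w
  s' : Sym w'
  l : ∀ z, w (w' z) = z
  r : ∀ z, w' (w z) = z

theorem pair_rot (k : ℕ) (hk : k ≤ 6) : Pair (rotE ^ (6-k)) (rotE ^ k) := by
  refine ⟨rot_pow_sym _, rot_pow_sym _, fun z => ?_, fun z => ?_⟩
  · rw [← Module.End.mul_apply, ← pow_add, Nat.sub_add_cancel hk, rot6]; rfl
  · rw [← Module.End.mul_apply, ← pow_add, Nat.add_sub_cancel' hk, rot6]; rfl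

theorem short_pair {γ : V2} (h : γ ∈ shortRoots) : ∃ w w', Pair w w' ∧ w' vβ₁ = γ := by
  have main : ∃ k ≤ 6, (rotE ^ k) vβ₁ = γ := by
    simp only [shortRoots, List.mem_cons, List.not_mem_nil, or_false] at h
    rcases h with rfl | rfl | rfl | rfl | rfl | rfl
    · exact ⟨0, by norm_num, rfl⟩
    · exact ⟨1, by norm_num, by show rot vβ₁ = _; rw [rot_β₁]⟩
    · exact ⟨2, by norm_num, by show rot (rot vβ₁) = _; rw [rot_β₁, rot_β₂]⟩
    · exact ⟨3, by norm_num, by show rot (rot (rot vβ₁)) = _; rw [rot3]⟩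
    · exact ⟨4, by norm_num, by show rot (rot (rot (rot vβ₁))) = _; rw [rot_β₁, rot3]⟩
    · exact ⟨5, by norm_num, by show rot (rot (rot (rot (rot vβ₁)))) = _; rw [rot_β₁, rot_β₂, rot3]⟩
  obtain ⟨k, hk, e⟩ := main
  exact ⟨_, _, pair_rot k hk, e⟩

theorem long_pair {γ : V2} (h : γ ∈ longRoots) : ∃ w w', Pair w w' ∧ w' vα₁ = γ := by
  have main : ∃ k ≤ 6, (rotE ^ k) vα₁ = γ := by
    simp only [longRoots, List.mem_cons, List.not_mem_nil, or_false] at h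
    rcases h with rfl | rfl | rfl | rfl | rfl | rfl
    · exact ⟨0, by norm_num, rfl⟩
    · exact ⟨1, by norm_num, by show rot vα₁ = _; rw [rot_α₁]⟩
    · exact ⟨5, by norm_num, by show rot (rot (rot (rot (rot vα₁)))) = _; rw [rot_α₁, rot_α₂, rot3, neg_neg]⟩
    · exact ⟨3, by norm_num, by show rot (rot (rot vα₁)) = _; rw [rot3]⟩
    · exact ⟨4, by norm_num, by show rot (rot (rot (rot vα₁))) = _; rw [rot_α₁, rot3]⟩
    · exact ⟨2, by norm_num, by show rot (rot vα₁) = _; rw [rot_α₁, rot_α₂]⟩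
  obtain ⟨k, hk, e⟩ := main
  exact ⟨_, _, pair_rot k hk, e⟩

theorem Pair.bil_eq {w w' : V2 →ₗ[ℂ] V2} (h : Pair w w') (a z : V2) : bil (w' a) z = bil a (w z) := by
  rw [← h.s.bil, h.l]
theorem bil_β₁ (z : V2) : bil vβ₁ z = z 0 := by simp [bil, vβ₁]
theorem bil_α₁ (z : V2) : bil vα₁ z = 3 * (z 1 / rt3) := by
  have h := rt3_sq
  have h0 := rt3_ne
  simp [bil, vα₁]; field_simp; linear_combination z 1 * h
theorem pt_coords (z : V2) : pt (z 0) (z 1 / rt3) = z := by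
  have h0 := rt3_ne
  ext i; fin_cases i <;> simp [pt]; field_simp

theorem reg_iff (z : V2) : D2Reg z ↔ ∀ γ ∈ G2all, ∀ j : ℕ, j ≤ 3 → bil γ z ≠ j * bil γ γ := by
  have hl : ∀ γ ∈ G2all, γ ∈ G2plus ∨ -γ ∈ G2plus := by
    simp only [G2all, longRoots, shortRoots, G2plus, List.mem_append, List.mem_cons, List.not_mem_nil, or_false]
    rintro γ ((rfl | rfl | rfl | rfl | rfl | rfl) | (rfl | rfl | rfl | rfl | rfl | rfl)) <;> simp
  have hl' : ∀ γ ∈ G2plus, γ ∈ G2all ∧ -γ ∈ G2all := by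
    simp only [G2all, longRoots, shortRoots, G2plus, List.mem_append, List.mem_cons, List.not_mem_nil, or_false]
    rintro γ (rfl | rfl | rfl | rfl | rfl | rfl) <;> simp
  constructor
  · intro h γ hγ j hj
    rcases hl γ hγ with hγ | hγ
    · have := h γ hγ
      interval_cases j <;> simp <;> tauto
    · have := h (-γ) hγ
      simp only [bil_negl, bil_negr, neg_neg, neg_zero, ne_eq, neg_eq_iff_eq_neg] at this
      interval_cases j <;> simp <;> tauto
  · intro h γ hγ
    have h1 := h γ (hl' γ hγ).1
    have h2 := h (-γ) (hl' γ hγ).2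
    simp only [bil_negl, bil_negr, neg_neg] at h2
    have a0 := h1 0 (by norm_num)
    have a1 := h1 1 (by norm_num)
    have a2 := h1 2 (by norm_num)
    have a3 := h1 3 (by norm_num)
    have b1 := h2 1 (by norm_num)
    have b2 := h2 2 (by norm_num)
    have b3 := h2 3 (by norm_num)
    push_cast at a0 a1 a2 a3 b1 b2 b3
    simp only [zero_mul, one_mul] at a0 a1 b1
    refine ⟨a0, a1, fun e => b1 (by rw [e, neg_neg]), a2, fun e => b2 (by rw [e, neg_neg]), a3, fun e => b3 (by rw [e, neg_neg])⟩

theorem reg_sym {w : V2 →ₗ[ℂ] V2} (h : Sym w) {z : V2} (hz : D2Reg z) : D2Reg (w z) := by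
  rw [reg_iff] at hz ⊢
  have hp : (G2all.map w).Perm G2all := by
    unfold G2all; rw [List.map_append]; exact h.lg.append h.sh
  intro γ hγ j hj
  rw [← hp.mem_iff, List.mem_map] at hγ
  obtain ⟨γ', h', rfl⟩ := hγ
  rw [h.bil, h.bil]
  exact hz γ' h' j hj
end AG2pf

namespace AG2pf
open Filter Topology


theorem neg_mem_G2all {γ : V2} (h : γ ∈ G2all) : -γ ∈ G2all := by
  simp only [G2all, longRoots, shortRoots, List.mem_append, List.mem_cons, List.not_mem_nil, or_false] at h ⊢
  rcases h with (rfl | rfl | rfl | rfl | rfl | rfl) | (rfl | rfl | rfl | rfl | rfl | rfl) <;> simp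

def ALn (l : V2 × ℂ) : Prop := l.1 ∈ G2all ∧ ∃ j : ℕ, j ≤ 3 ∧ l.2 = j * bil l.1 l.1
theorem ALn.ne {l : V2 × ℂ} (h : ALn l) {z : V2} (hz : D2Reg z) : bil l.1 z - l.2 ≠ 0 := by
  obtain ⟨h1, j, hj, e⟩ := h
  rw [e]
  exact sub_ne_zero.2 ((reg_iff z).1 hz _ h1 j hj)

def lp (L : List (V2 × ℂ)) (z : V2) : ℂ := (L.map (fun l => bil l.1 z - l.2)).prod
theorem lp_nil (z : V2) : lp [] z = 1 := by simp [lp]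
theorem lp_cons (l : V2 × ℂ) (L : List (V2 × ℂ)) (z : V2) : lp (l :: L) z = (bil l.1 z - l.2) * lp L z := by simp [lp]
theorem lp_append (L M : List (V2 × ℂ)) (z : V2) : lp (L ++ M) z = lp L z * lp M z := by simp [lp]
theorem bil_analytic (γ z : V2) : AnalyticAt ℂ (fun z => bil γ z) z := by
  unfold bil
  have h (i : Fin 2) : AnalyticAt ℂ (fun z : V2 => z i) z := (ContinuousLinearMap.proj (R := ℂ) (φ := fun _ : Fin 2 => ℂ) i).analyticAt z
  exact (analyticAt_const.mul (h 0)).add (analyticAt_const.mul (h 1))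
theorem lp_analytic (L : List (V2 × ℂ)) (z : V2) : AnalyticAt ℂ (lp L) z := by
  induction L with
  | nil => exact (analyticAt_const (v := (1:ℂ))).congr (Eventually.of_forall fun z => (lp_nil z).symm)
  | cons l L ih =>
    exact (((bil_analytic l.1 z).sub analyticAt_const).mul ih).congr (Eventually.of_forall fun z => (lp_cons l L z).symm)

def Mer (f : V2 → ℂ) : Prop := ∃ L, (∀ l ∈ L, ALn l) ∧ ∃ N : V2 → ℂ, (∀ z, AnalyticAt ℂ N z) ∧
  ∀ z, D2Reg z → N z = lp L z * f z

theorem Mer_an {f : V2 → ℂ} (h : ∀ z, AnalyticAt ℂ f z) : Mer f :=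
  ⟨[], by simp, f, h, fun z _ => by rw [lp_nil, one_mul]⟩
theorem Mer_const (c : ℂ) : Mer (fun _ => c) := Mer_an fun _ => analyticAt_const
theorem Mer.add {f g : V2 → ℂ} (hf : Mer f) (hg : Mer g) : Mer (fun z => f z + g z) := by
  obtain ⟨L, hL, N, hN, h1⟩ := hf
  obtain ⟨M, hM, K, hK, h2⟩ := hg
  refine ⟨L ++ M, fun l hl => (List.mem_append.1 hl).elim (hL l) (hM l), fun z => lp M z * N z + lp L z * K z,
    fun z => ((lp_analytic M z).mul (hN z)).add ((lp_analytic L z).mul (hK z)), fun z hz => ?_⟩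
  simp only [h1 z hz, h2 z hz, lp_append]
  ring
theorem Mer.mul {f g : V2 → ℂ} (hf : Mer f) (hg : Mer g) : Mer (fun z => f z * g z) := by
  obtain ⟨L, hL, N, hN, h1⟩ := hf
  obtain ⟨M, hM, K, hK, h2⟩ := hg
  refine ⟨L ++ M, fun l hl => (List.mem_append.1 hl).elim (hL l) (hM l), fun z => N z * K z,
    fun z => (hN z).mul (hK z), fun z hz => ?_⟩
  simp only [h1 z hz, h2 z hz, lp_append]
  ring
theorem Mer.congr {f g : V2 → ℂ} (hf : Mer f) (h : ∀ z, f z = g z) : Mer g := (funext h : f = g) ▸ hf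
theorem Mer_prod {ι : Type*} (L : List ι) (f : ι → V2 → ℂ) (h : ∀ γ ∈ L, Mer (f γ)) : Mer (fun z => (L.map (fun γ => f γ z)).prod) := by
  induction L with
  | nil => exact (Mer_const 1).congr fun z => by simp
  | cons a L ih =>
    rw [List.forall_mem_cons] at h
    exact (h.1.mul (ih h.2)).congr fun z => by simp
theorem Mer_sum {ι : Type*} (L : List ι) (f : ι → V2 → ℂ) (h : ∀ γ ∈ L, Mer (f γ)) : Mer (fun z => (L.map (fun γ => f γ z)).sum) := by
  induction L with
  | nil => exact (Mer_const 0).congr fun z => by simp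
  | cons a L ih =>
    rw [List.forall_mem_cons] at h
    exact (h.1.add (ih h.2)).congr fun z => by simp

theorem Mer_inv_sub {γ : V2} (h : γ ∈ G2all) (j : ℕ) (hj : j ≤ 3) : Mer (fun z => 1 / (bil γ z - j * bil γ γ)) := by
  have ha : ALn (γ, j * bil γ γ) := ⟨h, j, hj, rfl⟩
  refine ⟨[(γ, j * bil γ γ)], by simpa using ha, fun _ => 1, fun _ => analyticAt_const, fun z hz => ?_⟩
  rw [lp_cons, lp_nil, mul_one]
  exact (mul_one_div_cancel (ha.ne hz)).symm
theorem Mer_inv_add {γ : V2} (h : γ ∈ G2all) (j : ℕ) (hj : j ≤ 3) : Mer (fun z => 1 / (bil γ z + j * bil γ γ)) := by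
  refine ((Mer_const (-1)).mul (Mer_inv_sub (neg_mem_G2all h) j hj)).congr fun z => ?_
  rw [bil_negl, bil_negl, bil_negr, neg_neg, ← neg_add', one_div_neg_eq_neg_one_div]; ring

theorem Mer_f0 {γ : V2} (h : γ ∈ G2all) (A : ℂ) : Mer (fun z => 1 - A / bil γ z) :=
  ((Mer_const 1).add ((Mer_const (-A)).mul (Mer_inv_add h 0 (by norm_num)))).congr fun z => by push_cast; ring
theorem Mer_f1 {γ : V2} (h : γ ∈ G2all) (A : ℂ) : Mer (fun z => 1 - A / (bil γ z + bil γ γ)) :=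
  ((Mer_const 1).add ((Mer_const (-A)).mul (Mer_inv_add h 1 (by norm_num)))).congr fun z => by push_cast; ring
theorem Mer_f2 {γ : V2} (h : γ ∈ G2all) (A : ℂ) : Mer (fun z => 1 - A / (bil γ z + 2 * bil γ γ)) :=
  ((Mer_const 1).add ((Mer_const (-A)).mul (Mer_inv_add h 2 (by norm_num)))).congr fun z => by push_cast; ring
theorem Mer_f3 {γ : V2} (h : γ ∈ G2all) (A : ℂ) : Mer (fun z => 1 - A / (bil γ z + 3 * bil γ γ)) :=
  ((Mer_const 1).add ((Mer_const (-A)).mul (Mer_inv_add h 3 (by norm_num)))).congr fun z => by push_cast; ring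
theorem Mer_fm {γ : V2} (h : γ ∈ G2all) (A : ℂ) : Mer (fun z => 1 - A / (bil γ z - bil γ γ)) :=
  ((Mer_const 1).add ((Mer_const (-A)).mul (Mer_inv_sub h 1 (by norm_num)))).congr fun z => by push_cast; ring
theorem Mer_g2 {γ : V2} (h : γ ∈ G2all) (A : ℂ) : Mer (fun z => 1 + A / (bil γ z + 2 * bil γ γ)) :=
  (Mer_f2 h (-A)).congr fun z => by ring
theorem Mer_g3 {γ : V2} (h : γ ∈ G2all) (A : ℂ) : Mer (fun z => 1 + A / (bil γ z + 3 * bil γ γ)) :=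
  (Mer_f3 h (-A)).congr fun z => by ring

theorem sh_all {γ : V2} (h : γ ∈ shortRoots) : γ ∈ G2all := List.mem_append_right _ h
theorem lg_all {γ : V2} (h : γ ∈ longRoots) : γ ∈ G2all := List.mem_append_left _ h

theorem Mer_aD2 (m : ℕ) {τ : V2} (hτ : τ ∈ twoAG2) : Mer (aD2 m τ) := by
  unfold aD2
  by_cases h4 : τ ∈ fourShort
  · simp only [if_pos h4]
    obtain ⟨h, hh, rfl⟩ := List.mem_map.1 h4
    have e : (4⁻¹:ℂ) • (4:ℂ) • h = h := by rw [smul_smul]; norm_num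
    simp only [e]
    have H := sh_all hh
    refine (((Mer_const _).mul (Mer_prod _ _ fun γ hγ => ?_)).mul (Mer_prod _ _ fun γ hγ => ?_)).mul
      ((((Mer_f0 H _).mul (Mer_f1 H _)).mul (Mer_f2 H _)).mul (Mer_f3 H _))
    · have G := lg_all (List.mem_of_mem_filter hγ)
      exact (Mer_f0 G _).mul (Mer_f1 G _)
    · have G := sh_all (List.mem_of_mem_filter hγ)
      exact (Mer_f0 G _).mul (Mer_f1 G _)
  by_cases h2 : τ ∈ twoShort
  · simp only [if_neg h4, if_pos h2]
    obtain ⟨h, hh, rfl⟩ := List.mem_map.1 h2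
    have e : (2⁻¹:ℂ) • (2:ℂ) • h = h := by rw [smul_smul]; norm_num
    simp only [e]
    have H := sh_all hh
    refine ((((Mer_const _).mul (Mer_prod _ _ fun γ hγ => ?_)).mul (Mer_prod _ _ fun γ hγ => ?_)).mul (Mer_prod _ _ fun γ hγ => ?_)).mul
      ((((Mer_f0 H _).mul (Mer_f1 H _)).mul (Mer_g3 H _)).mul (Mer_fm H _))
    · have G := lg_all (List.mem_of_mem_filter hγ)
      exact Mer_fm G _
    · have G := lg_all (List.mem_of_mem_filter hγ)
      exact Mer_f0 G _
    · have G := sh_all (List.mem_of_mem_filter hγ)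
      exact ((Mer_f0 G _).mul (Mer_g2 G _)).mul (Mer_fm G _)
  · simp only [if_neg h4, if_neg h2]
    have hl : τ ∈ twoLong := by
      unfold twoAG2 twoG2 G2all at hτ
      rw [List.mem_append, List.map_append, List.mem_append] at hτ
      exact (hτ.resolve_right h4).resolve_right h2
    obtain ⟨h, hh, rfl⟩ := List.mem_map.1 hl
    have e : (2⁻¹:ℂ) • (2:ℂ) • h = h := by rw [smul_smul]; norm_num
    simp only [e]
    have H := lg_all hh
    refine ((((Mer_const _).mul (Mer_prod _ _ fun γ hγ => ?_)).mul (Mer_prod _ _ fun γ hγ => ?_)).mul (Mer_prod _ _ fun γ hγ => ?_)).mul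
      ((Mer_f0 H _).mul (Mer_f1 H _))
    · have G := sh_all (List.mem_of_mem_filter hγ)
      exact ((Mer_f0 G _).mul (Mer_f1 G _)).mul (Mer_f2 G _)
    · have G := sh_all (List.mem_of_mem_filter hγ)
      exact Mer_fm G _
    · have G := lg_all (List.mem_of_mem_filter hγ)
      exact Mer_f0 G _

theorem Mer_applyD2 (m : ℕ) {p : V2 → ℂ} (hp : ∀ z, AnalyticAt ℂ p z) : Mer (applyD2 m p) := by
  unfold applyD2
  refine Mer_sum _ _ fun τ hτ => (Mer_aD2 m hτ).mul (Mer_an fun z => ?_)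
  have h1 : AnalyticAt ℂ (fun z => p (z + τ)) z := (hp (z + τ)).comp (f := fun z => z + τ) (analyticAt_id.add analyticAt_const)
  exact h1.sub (hp z)
end AG2pf

namespace AG2pf
open Filter Topology



structure Chart (m : ℕ) (p : V2 → ℂ) (l : V2 × ℂ) where
  Φ : ℂ × ℂ → V2
  Ψ : V2 → ℂ × ℂ
  hΦ : ∀ z, AnalyticAt ℂ Φ z
  hΨ : ∀ z, AnalyticAt ℂ Ψ z
  inv : ∀ z, Φ (Ψ z) = z
  inv' : ∀ z, Ψ (Φ z) = z
  κ : ℂ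
  hκ : κ ≠ 0
  eq : ∀ z, bil l.1 z - l.2 = κ * (Ψ z).1
  S : Set ℂ
  hS : Dense S
  lim : ∀ y ∈ S, Tendsto (fun t => t * applyD2 m p (Φ (t, y))) (𝓝[≠] 0) (𝓝 0)
  reg : ∀ y ∈ S, ∀ᶠ t in 𝓝[≠] (0:ℂ), D2Reg (Φ (t, y))

theorem coord_analytic (i : Fin 2) (z : V2) : AnalyticAt ℂ (fun z : V2 => z i) z :=
  (ContinuousLinearMap.proj (R := ℂ) (φ := fun _ : Fin 2 => ℂ) i).analyticAt z

theorem pt_0 (x y : ℂ) : (pt x y) 0 = x := by simp [pt]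
theorem pt_1 (x y : ℂ) : (pt x y) 1 / rt3 = y := by
  have := rt3_ne
  simp [pt]; field_simp

theorem chart_short {m : ℕ} (hm : 1 ≤ m) {p : V2 → ℂ} (hp : RaAG2 m p) {γ : V2} (hγ : γ ∈ shortRoots) (j : ℕ) :
    Nonempty (Chart m p (γ, j * bil γ γ)) := by
  obtain ⟨w, w', P, rfl⟩ := short_pair hγ
  have c0 (z) : AnalyticAt ℂ (fun z => (w z) 0) z := (coord_analytic 0 (w z)).comp (lin_analytic w z)
  have c1 (z) : AnalyticAt ℂ (fun z => (w z) 1) z := (coord_analytic 1 (w z)).comp (lin_analytic w z)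
  refine ⟨⟨fun z => w' (pt (j + z.1) z.2), fun z => ((w z) 0 - j, (w z) 1 / rt3), ?_, ?_, ?_, ?_, 1, one_ne_zero, ?_,
    {y | NZ (3*y)}, NZ3_dense, ?_, ?_⟩⟩
  · intro z
    have h1 : AnalyticAt ℂ (fun z : ℂ × ℂ => ((j : ℂ) + z.1, z.2)) z := (analyticAt_const.add analyticAt_fst).prod analyticAt_snd
    have h2 := (pt_analytic ((j : ℂ) + z.1, z.2)).comp (f := fun z : ℂ × ℂ => ((j : ℂ) + z.1, z.2)) h1
    exact (lin_analytic w' _).comp h2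
  · intro z
    exact ((c0 z).sub analyticAt_const).prod ((c1 z).div_const)
  · intro z
    simp only [add_sub_cancel, pt_coords, P.r]
  · intro z
    simp only [P.l, pt_0, pt_1, add_sub_cancel_left]
  · intro z
    simp only [P.bil_eq, P.l, bil_β₁, one_mul]
    simp [vβ₁]
  · intro y hy
    refine (LB hm (Ra_sym P.s' hp) hy j).congr fun t => ?_
    rw [applyD2_sym P.s']
  · intro y hy
    filter_upwards [reg_x j hy] with t ht
    exact reg_sym P.s' ht

theorem chart_long {m : ℕ} (hm : 1 ≤ m) {p : V2 → ℂ} (hp : RaAG2 m p) {γ : V2} (hγ : γ ∈ longRoots) (j : ℕ) :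
    Nonempty (Chart m p (γ, j * bil γ γ)) := by
  have hself := long_self hγ
  obtain ⟨w, w', P, rfl⟩ := long_pair hγ
  have c0 (z) : AnalyticAt ℂ (fun z => (w z) 0) z := (coord_analytic 0 (w z)).comp (lin_analytic w z)
  have c1 (z) : AnalyticAt ℂ (fun z => (w z) 1) z := (coord_analytic 1 (w z)).comp (lin_analytic w z)
  refine ⟨⟨fun z => w' (pt z.2 (j + z.1)), fun z => ((w z) 1 / rt3 - j, (w z) 0), ?_, ?_, ?_, ?_, 3, three_ne_zero, ?_,
    {y | NZ y}, NZ_dense, ?_, ?_⟩⟩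
  · intro z
    have h1 : AnalyticAt ℂ (fun z : ℂ × ℂ => (z.2, (j : ℂ) + z.1)) z := analyticAt_snd.prod (analyticAt_const.add analyticAt_fst)
    have h2 := (pt_analytic (z.2, (j : ℂ) + z.1)).comp (f := fun z : ℂ × ℂ => (z.2, (j : ℂ) + z.1)) h1
    exact (lin_analytic w' _).comp h2
  · intro z
    exact ((c1 z).div_const.sub analyticAt_const).prod (c0 z)
  · intro z
    simp only [add_sub_cancel, pt_coords, P.r]
  · intro z
    simp only [P.l, pt_0, pt_1, add_sub_cancel_left]
  · intro z
    simp only [hself]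
    simp only [P.bil_eq, bil_α₁]
    ring
  · intro y hy
    refine (LA hm (Ra_sym P.s' hp) hy j).congr fun t => ?_
    rw [applyD2_sym P.s']
  · intro y hy
    filter_upwards [reg_y j hy] with t ht
    exact reg_sym P.s' ht

theorem chart_ALn {m : ℕ} (hm : 1 ≤ m) {p : V2 → ℂ} (hp : RaAG2 m p) {l : V2 × ℂ} (hl : ALn l) : Nonempty (Chart m p l) := by
  obtain ⟨γ, c⟩ := l
  obtain ⟨h1, j, -, e⟩ := hl
  simp only at h1 e
  subst e
  rcases List.mem_append.1 h1 with h | h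
  · exact chart_long hm hp h j
  · exact chart_short hm hp h j

theorem step {m : ℕ} {p : V2 → ℂ} {l : V2 × ℂ} (c : Chart m p l) (hl : ALn l) (L : List (V2 × ℂ)) (N : V2 → ℂ) (hN : ∀ z, AnalyticAt ℂ N z)
    (h : ∀ z, D2Reg z → N z = lp (l :: L) z * applyD2 m p z) :
    ∃ N' : V2 → ℂ, (∀ z, AnalyticAt ℂ N' z) ∧ ∀ z, D2Reg z → N' z = lp L z * applyD2 m p z := by
  have hF : ∀ z, AnalyticAt ℂ (fun z => N (c.Φ z)) z := fun z => (hN _).comp (c.hΦ z)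
  have hFc : Continuous (fun z => N (c.Φ z)) := continuous_iff_continuousAt.2 fun z => (hF z).continuousAt
  have hΦc : Continuous c.Φ := continuous_iff_continuousAt.2 fun z => (c.hΦ z).continuousAt
  have hLc : Continuous (lp L) := continuous_iff_continuousAt.2 fun z => (lp_analytic L z).continuousAt
  have hS0 : ∀ y ∈ c.S, N (c.Φ (0, y)) = 0 := by
    intro y hy
    have t1 : Tendsto (fun t : ℂ => N (c.Φ (t, y))) (𝓝[≠] 0) (𝓝 (N (c.Φ (0, y)))) := by
      have : Continuous (fun t : ℂ => N (c.Φ (t, y))) := hFc.comp (by fun_prop)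
      exact this.continuousAt.tendsto.mono_left nhdsWithin_le_nhds
    have t2 : Tendsto (fun t : ℂ => lp L (c.Φ (t, y))) (𝓝[≠] 0) (𝓝 (lp L (c.Φ (0, y)))) := by
      have : Continuous (fun t : ℂ => lp L (c.Φ (t, y))) := hLc.comp (hΦc.comp (by fun_prop))
      exact this.continuousAt.tendsto.mono_left nhdsWithin_le_nhds
    have t3 := (t2.const_mul c.κ).mul (c.lim y hy)
    rw [mul_zero] at t3
    refine tendsto_nhds_unique t1 (t3.congr' ?_)
    filter_upwards [c.reg y hy] with t ht
    rw [h _ ht, lp_cons, c.eq, c.inv']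
    ring
  have h0 : ∀ y, N (c.Φ (0, y)) = 0 := by
    have e : (fun y : ℂ => N (c.Φ (0, y))) = fun _ => 0 :=
      Continuous.ext_on c.hS (hFc.comp (by fun_prop : Continuous fun y : ℂ => ((0:ℂ), y))) continuous_const hS0
    exact fun y => congrFun e y
  obtain ⟨G, hG, hGe⟩ := div_prod _ hF h0
  refine ⟨fun z => G (c.Ψ z) / c.κ, fun z => ((hG _).comp (c.hΨ z)).div_const, fun z hz => ?_⟩
  have e1 := hGe (c.Ψ z).1 (c.Ψ z).2
  have e2 := h z hz
  have e3 := hl.ne hz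
  rw [c.eq] at e3
  simp only [Prod.mk.eta, c.inv] at e1
  rw [lp_cons, c.eq, e1] at e2
  have hκ := c.hκ
  have h4 : (c.Ψ z).1 ≠ 0 := right_ne_zero_of_mul e3
  rw [div_eq_iff hκ]
  apply mul_left_cancel₀ h4
  rw [e2]; ring

theorem entire {m : ℕ} (hm : 1 ≤ m) {p : V2 → ℂ} (hp : RaAG2 m p) :
    ∃ q : V2 → ℂ, (∀ z, AnalyticAt ℂ q z) ∧ ∀ z, D2Reg z → q z = applyD2 m p z := by
  obtain ⟨L, hL, N, hN, h⟩ := Mer_applyD2 m hp.1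
  induction L generalizing N with
  | nil => exact ⟨N, hN, fun z hz => by rw [h z hz, lp_nil, one_mul]⟩
  | cons l L ih =>
    rw [List.forall_mem_cons] at hL
    obtain ⟨c⟩ := chart_ALn hm hp hL.1
    obtain ⟨N', hN', h'⟩ := step c hL.1 L N hN h
    exact ih hL.2 N' hN' h'
end AG2pf

namespace AG2pf
open Filter Topology



theorem applyD2_sub (m : ℕ) (p q : V2 → ℂ) (z : V2) :
    applyD2 m (fun z => p z - q z) z = applyD2 m p z - applyD2 m q z := by
  unfold applyD2
  generalize twoAG2 = L
  induction L with
  | nil => simp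
  | cons a L ih =>
    simp only [List.map_cons, List.sum_cons, ih]; ring

theorem Ra_sub {m : ℕ} {p q : V2 → ℂ} (hp : RaAG2 m p) (hq : RaAG2 m q) : RaAG2 m (fun z => p z - q z) := by
  refine ⟨fun z => (hp.1 z).sub (hq.1 z), ?_, ?_⟩
  · intro α hα s h1 h2 z hz
    simp only
    rw [hp.2.1 α hα s h1 h2 z hz, hq.2.1 α hα s h1 h2 z hz]
  · intro α hα s h1 z hz
    simp only
    rw [hp.2.2 α hα s h1 z hz, hq.2.2 α hα s h1 z hz]

theorem refx_refx (z : V2) : refx (refx z) = z := by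
  ext i; fin_cases i <;> simp [refx, lin2]
theorem refy_refy (z : V2) : refy (refy z) = z := by
  ext i; fin_cases i <;> simp [refy, lin2]

theorem qinv_x {m : ℕ} (hm : 1 ≤ m) {p q : V2 → ℂ} (hp : RaAG2 m p) (hq : ∀ z, AnalyticAt ℂ q z)
    (h : ∀ z, D2Reg z → q z = applyD2 m p z) (s : ℕ) (hs : SB m s) (y : ℂ) : q (pt s y) = q (pt (-s) y) := by
  have hP := Ra_sub hp (Ra_sym refx_sym hp)
  have hodd : ∀ z, (fun z => p z - p (refx z)) (refx z) = -(fun z => p z - p (refx z)) z := by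
    intro z; simp only [refx_refx]; ring
  have hqx : ∀ z, AnalyticAt ℂ (fun z => q z - q (refx z)) z := fun z => (hq z).sub ((hq _).comp (lin_analytic refx z))
  have hreg : ∀ z, D2Reg z → q z - q (refx z) = applyD2 m (fun z => p z - p (refx z)) z := by
    intro z hz
    rw [applyD2_sub, h z hz, h _ (reg_sym refx_sym hz), applyD2_sym refx_sym]
  have hc : Continuous (fun z => q z - q (refx z)) := continuous_iff_continuousAt.2 fun z => (hqx z).continuousAt
  have hpc : Continuous (fun z : ℂ × ℂ => pt z.1 z.2) := continuous_iff_continuousAt.2 fun z => (pt_analytic z).continuousAt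
  have key : (fun y : ℂ => q (pt s y) - q (refx (pt s y))) = fun _ => 0 := by
    refine Continuous.ext_on NZ3_dense ((hc.comp hpc).comp (by fun_prop : Continuous fun y : ℂ => ((s:ℂ), y))) continuous_const ?_
    intro y hy
    have t1 : Tendsto (fun t : ℂ => q (pt (s+t) y) - q (refx (pt (s+t) y))) (𝓝[≠] 0) (𝓝 (q (pt (s+0) y) - q (refx (pt (s+0) y)))) := by
      have := (hc.comp hpc).comp (by fun_prop : Continuous fun t : ℂ => ((s:ℂ) + t, y))
      exact (this.continuousAt (x := 0)).tendsto.mono_left nhdsWithin_le_nhds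
    rw [add_zero] at t1
    refine tendsto_nhds_unique t1 ((QB hm hP hodd hy s hs).congr' ?_)
    filter_upwards [reg_x s hy] with t ht
    exact (hreg _ ht).symm
  have := congrFun key y
  simp only [refx_pt] at this
  exact sub_eq_zero.1 this

theorem qinv_y {m : ℕ} (hm : 1 ≤ m) {p q : V2 → ℂ} (hp : RaAG2 m p) (hq : ∀ z, AnalyticAt ℂ q z)
    (h : ∀ z, D2Reg z → q z = applyD2 m p z) (s : ℕ) (hs : SA m s) (x : ℂ) : q (pt x s) = q (pt x (-s)) := by
  have hP := Ra_sub hp (Ra_sym refy_sym hp)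
  have hodd : ∀ z, (fun z => p z - p (refy z)) (refy z) = -(fun z => p z - p (refy z)) z := by
    intro z; simp only [refy_refy]; ring
  have hqx : ∀ z, AnalyticAt ℂ (fun z => q z - q (refy z)) z := fun z => (hq z).sub ((hq _).comp (lin_analytic refy z))
  have hreg : ∀ z, D2Reg z → q z - q (refy z) = applyD2 m (fun z => p z - p (refy z)) z := by
    intro z hz
    rw [applyD2_sub, h z hz, h _ (reg_sym refy_sym hz), applyD2_sym refy_sym]
  have hc : Continuous (fun z => q z - q (refy z)) := continuous_iff_continuousAt.2 fun z => (hqx z).continuousAt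
  have hpc : Continuous (fun z : ℂ × ℂ => pt z.1 z.2) := continuous_iff_continuousAt.2 fun z => (pt_analytic z).continuousAt
  have key : (fun x : ℂ => q (pt x s) - q (refy (pt x s))) = fun _ => 0 := by
    refine Continuous.ext_on NZ_dense ((hc.comp hpc).comp (by fun_prop : Continuous fun y : ℂ => (y, (s:ℂ)))) continuous_const ?_
    intro x hx
    have t1 : Tendsto (fun t : ℂ => q (pt x (s+t)) - q (refy (pt x (s+t)))) (𝓝[≠] 0) (𝓝 (q (pt x (s+0)) - q (refy (pt x (s+0))))) := by
      have := (hc.comp hpc).comp (by fun_prop : Continuous fun t : ℂ => (x, (s:ℂ) + t))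
      exact (this.continuousAt (x := 0)).tendsto.mono_left nhdsWithin_le_nhds
    rw [add_zero] at t1
    refine tendsto_nhds_unique t1 ((QA hm hP hodd hx s hs).congr' ?_)
    filter_upwards [reg_y s hx] with t ht
    exact (hreg _ ht).symm
  have := congrFun key x
  simp only [refy_pt] at this
  exact sub_eq_zero.1 this

theorem qinv_short {m : ℕ} (hm : 1 ≤ m) {p q : V2 → ℂ} (hp : RaAG2 m p) (hq : ∀ z, AnalyticAt ℂ q z)
    (h : ∀ z, D2Reg z → q z = applyD2 m p z) {β : V2} (hβ : β ∈ shortRoots) (s : ℕ) (hs : SB m s) (z : V2) (hz : bil β z = 0) :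
    q (z + (s:ℂ) • β) = q (z - (s:ℂ) • β) := by
  obtain ⟨w, w', P, rfl⟩ := short_pair hβ
  have := qinv_x hm (Ra_sym P.s' hp) (q := fun z => q (w' z)) (fun z => (hq _).comp (lin_analytic w' z))
    (fun z hz => by rw [← applyD2_sym P.s']; exact h _ (reg_sym P.s' hz)) s hs ((w z) 1 / rt3)
  have h0 : (w z) 0 = 0 := by rw [← bil_β₁ (w z), ← P.bil_eq, hz]
  have hw : pt 0 ((w z) 1 / rt3) = w z := by
    have := pt_coords (w z); rwa [h0] at this
  have e (s : ℂ) : w' (pt s ((w z) 1 / rt3)) = z + s • w' vβ₁ := by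
    have : pt s ((w z) 1 / rt3) = w z + s • vβ₁ := by
      rw [smul_β₁, ← hw, pt_split, zero_add, pt_1, add_zero]
    rw [this, map_add, P.r, map_smul]
  simp only [e] at this
  rw [this, neg_smul, sub_eq_add_neg]

theorem qinv_long {m : ℕ} (hm : 1 ≤ m) {p q : V2 → ℂ} (hp : RaAG2 m p) (hq : ∀ z, AnalyticAt ℂ q z)
    (h : ∀ z, D2Reg z → q z = applyD2 m p z) {α : V2} (hα : α ∈ longRoots) (s : ℕ) (hs : SA m s) (z : V2) (hz : bil α z = 0) :
    q (z + (s:ℂ) • α) = q (z - (s:ℂ) • α) := by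
  obtain ⟨w, w', P, rfl⟩ := long_pair hα
  have := qinv_y hm (Ra_sym P.s' hp) (q := fun z => q (w' z)) (fun z => (hq _).comp (lin_analytic w' z))
    (fun z hz => by rw [← applyD2_sym P.s']; exact h _ (reg_sym P.s' hz)) s hs ((w z) 0)
  have h0 : (w z) 1 / rt3 = 0 := by
    have : 3 * ((w z) 1 / rt3) = 0 := by rw [← bil_α₁, ← P.bil_eq, hz]
    exact (mul_eq_zero.1 this).resolve_left three_ne_zero
  have hw : pt ((w z) 0) 0 = w z := by
    have := pt_coords (w z); rwa [h0] at this
  have e (s : ℂ) : w' (pt ((w z) 0) s) = z + s • w' vα₁ := by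
    have : pt ((w z) 0) s = w z + s • vα₁ := by
      rw [smul_α₁, ← hw, pt_split, zero_add, pt_0, add_zero]
    rw [this, map_add, P.r, map_smul]
  simp only [e] at this
  rw [this, neg_smul, sub_eq_add_neg]

theorem final {m : ℕ} (hm : 1 ≤ m) {p : V2 → ℂ} (hp : RaAG2 m p) :
    ∃ q : V2 → ℂ, RaAG2 m q ∧ ∀ z, D2Reg z → q z = applyD2 m p z := by
  obtain ⟨q, hq, h⟩ := entire hm hp
  refine ⟨q, ⟨hq, ?_, ?_⟩, h⟩
  · intro α hα s h1 h2 z hz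
    exact qinv_long hm hp hq h (by
      simp only [longRoots, List.mem_cons, List.not_mem_nil, or_false] at hα ⊢; tauto) s ⟨h1, h2⟩ z hz
  · intro β hβ s hs z hz
    exact qinv_short hm hp hq h (by
      simp only [shortRoots, List.mem_cons, List.not_mem_nil, or_false] at hβ ⊢; tauto) s hs z hz
end AG2pf

/-- The generalised Macdonald–Ruijsenaars operator `D₂`
preserves the ring `R^a_{AG₂}` of analytic quasi-invariants. -/
theorem stmt_15 (m : ℕ) (hm : 1 ≤ m) (p : (Fin 2 → ℂ) → ℂ) (hp : RaAG2 m p) :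
    ∃ q : (Fin 2 → ℂ) → ℂ, RaAG2 m q ∧
      ∀ z : Fin 2 → ℂ, D2Reg z → q z = applyD2 m p z := by
  exact AG2pf.final hm hp

end
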